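/- arXiv:1209.3096 — 6 statements merged into one kernel-verified Lean document; each statement's English description precedes it below -/
import Mathlib

section
/- Let d ≥ 5 and let u : ℝ^d → ℝ be a C¹ function with compact support. Then there exists a constant C depending only on d such that ∫_{ℝ^d} |u(x)|^{2d/(d−2)} / |x| dx ≤ C · (∫_{ℝ^d} |∇u|² dx)^{2/(d−2)} · ∫_{ℝ^d} ( |u(x)|²/|x|³ + |∇_θu(x)|²/|x| ) dx. -/
open MeasureTheory
open scoped ENNReal RealInnerProductSpace

noncomputable section

/-- Euclidean space `ℝ^d`. -/
abbrev Ed (d : ℕ) : Type := EuclideanSpace ℝ (Fin d)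

/-- The angular part of the gradient: `∇_θ f(x) = ∇f(x) - (x/|x|)⟨x/|x|, ∇f(x)⟩`. -/
def angularGrad {d : ℕ} (f : Ed d → ℝ) (x : Ed d) : Ed d :=
  gradient f x - ⟪‖x‖⁻¹ • x, gradient f x⟫ • (‖x‖⁻¹ • x)

open Module Set
open scoped NNReal

section Cone

variable {E F : Type*} [NormedAddCommGroup E] [InnerProductSpace ℝ E]
  [NormedAddCommGroup F] [InnerProductSpace ℝ F]

/-- The unit vector in direction `ι y + e`: central projection onto the unit sphere of the affine
hyperplane through `e` parametrized by `ι`. -/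
def centralProj (ι : F →ₗᵢ[ℝ] E) (e : E) (y : F) : E := ‖ι y + e‖⁻¹ • (ι y + e)

lemma norm_sq_add_smul {ι : F →ₗᵢ[ℝ] E} {e : E} (he : ‖e‖ = 1) (hι : ∀ y, ⟪ι y, e⟫ = 0)
    (y : F) (s : ℝ) : ‖ι y + s • e‖ ^ 2 = ‖y‖ ^ 2 + s ^ 2 := by
  rw [norm_add_sq_real, inner_smul_right, hι, norm_smul, he, ι.norm_map]
  simp

lemma one_le_norm_add {ι : F →ₗᵢ[ℝ] E} {e : E} (he : ‖e‖ = 1) (hι : ∀ y, ⟪ι y, e⟫ = 0)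
    (y : F) : 1 ≤ ‖ι y + e‖ := by
  have h := norm_sq_add_smul he hι y 1
  rw [one_smul] at h
  nlinarith [norm_nonneg (ι y + e), sq_nonneg ‖y‖]

lemma norm_centralProj {ι : F →ₗᵢ[ℝ] E} {e : E} (he : ‖e‖ = 1) (hι : ∀ y, ⟪ι y, e⟫ = 0)
    (y : F) : ‖centralProj ι e y‖ = 1 := by
  have h := one_le_norm_add he hι y
  rw [centralProj, norm_smul, norm_inv, norm_norm, inv_mul_cancel₀ (by positivity)]

lemma contDiff_centralProj {ι : F →ₗᵢ[ℝ] E} {e : E} (he : ‖e‖ = 1) (hι : ∀ y, ⟪ι y, e⟫ = 0) :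
    ContDiff ℝ 1 (centralProj ι e) := by
  have h1 : ContDiff ℝ 1 fun y : F => ι y + e :=
    ι.toContinuousLinearMap.contDiff.add contDiff_const
  have h0 : ∀ y, ι y + e ≠ 0 := fun y => norm_pos_iff.1 (by linarith [one_le_norm_add he hι y])
  exact ((h1.norm ℝ h0).inv fun y => norm_ne_zero_iff.2 (h0 y)).smul h1

/-- The linear change of variables `(y, s) ↦ ι y + s • e`. -/
def hyperplaneEquiv [FiniteDimensional ℝ E] [FiniteDimensional ℝ F]
    {ι : F →ₗᵢ[ℝ] E} {e : E} (he : ‖e‖ = 1) (hι : ∀ y, ⟪ι y, e⟫ = 0)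
    (hd : finrank ℝ F + 1 = finrank ℝ E) : (F × ℝ) ≃L[ℝ] E :=
  (LinearEquiv.ofInjectiveOfFinrankEq
    (ι.toLinearMap.coprod (LinearMap.toSpanSingleton ℝ E e)) (by
      rw [← LinearMap.ker_eq_bot, LinearMap.ker_eq_bot']
      rintro ⟨y, s⟩ h
      have h1 := norm_sq_add_smul he hι y s
      have h2 : ι y + s • e = 0 := by simpa using h
      rw [h2] at h1
      simp only [norm_zero] at h1
      have hy : ‖y‖ = 0 := by nlinarith [sq_nonneg ‖y‖, sq_nonneg s]
      have hs : s = 0 := by nlinarith [sq_nonneg ‖y‖, sq_nonneg s]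
      simp [norm_eq_zero.1 hy, hs]) (by simpa using hd)).toContinuousLinearEquiv

lemma hyperplaneEquiv_apply [FiniteDimensional ℝ E] [FiniteDimensional ℝ F]
    {ι : F →ₗᵢ[ℝ] E} {e : E} (he : ‖e‖ = 1) (hι : ∀ y, ⟪ι y, e⟫ = 0)
    (hd : finrank ℝ F + 1 = finrank ℝ E) (p : F × ℝ) :
    hyperplaneEquiv he hι hd p = ι p.1 + p.2 • e := by
  rfl

lemma lintegral_eq_mul_lintegral_smul [FiniteDimensional ℝ F] [MeasurableSpace F] [BorelSpace F]
    (μ : Measure F) [μ.IsAddHaarMeasure] (g : F → ℝ≥0∞) {s : ℝ} (hs : 0 < s) :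
    ∫⁻ y, g y ∂μ = ENNReal.ofReal (s ^ finrank ℝ F) * ∫⁻ y, g (s • y) ∂μ := by
  have h := lintegral_map_equiv g (Homeomorph.smulOfNeZero s hs.ne' : F ≃ₜ F).toMeasurableEquiv
    (μ := μ)
  simp only [Homeomorph.toMeasurableEquiv_coe, Homeomorph.smulOfNeZero_apply] at h
  have h2 := Measure.map_addHaar_smul μ hs.ne'
  rw [← h, h2, lintegral_smul_measure, smul_eq_mul, ← mul_assoc,
    ← ENNReal.ofReal_mul (by positivity), abs_of_pos (by positivity),
    mul_inv_cancel₀ (by positivity), ENNReal.ofReal_one, one_mul]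

lemma lintegral_Ioi_smul (h : ℝ → ℝ≥0∞) {a : ℝ} (ha : 0 < a) :
    ∫⁻ s in Ioi (0 : ℝ), h s = ENNReal.ofReal a * ∫⁻ r in Ioi (0 : ℝ), h (a * r) := by
  rw [← lintegral_indicator measurableSet_Ioi, ← lintegral_indicator measurableSet_Ioi,
    lintegral_eq_mul_lintegral_smul volume _ ha]
  simp only [finrank_self, pow_one]
  congr 2
  ext r
  simp [indicator, ha]

lemma exists_lintegral_halfSpace_eq [FiniteDimensional ℝ E] [FiniteDimensional ℝ F]
    [MeasurableSpace E] [BorelSpace E] [MeasurableSpace F] [BorelSpace F]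
    (μ : Measure E) [μ.IsAddHaarMeasure] (ν : Measure F) [ν.IsAddHaarMeasure]
    {ι : F →ₗᵢ[ℝ] E} {e : E} (he : ‖e‖ = 1) (hι : ∀ y, ⟪ι y, e⟫ = 0)
    (hd : finrank ℝ F + 1 = finrank ℝ E) :
    ∃ c : ℝ≥0, c ≠ 0 ∧ ∀ G : E → ℝ≥0∞, Measurable G →
      ∫⁻ x in {x | 0 < ⟪e, x⟫}, G x ∂μ = c * ∫⁻ y, (∫⁻ r in Ioi (0 : ℝ),
        ENNReal.ofReal (‖ι y + e‖⁻¹ ^ (finrank ℝ F + 1) * r ^ finrank ℝ F) *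
          G (r • centralProj ι e y)) ∂ν := by
  set L := hyperplaneEquiv he hι hd
  refine ⟨Measure.addHaarScalarFactor μ ((ν.prod volume).map L),
    (Measure.addHaarScalarFactor_pos_of_isAddHaarMeasure _ _).ne', fun G hG => ?_⟩
  have hmeas : MeasurableSet {x : E | 0 < ⟪e, x⟫} :=
    (isOpen_lt continuous_const (by fun_prop)).measurableSet
  have hjoint : Measurable fun p : F × ℝ => G (p.2 • (ι p.1 + e)) := hG.comp (by fun_prop)
  rw [← lintegral_indicator hmeas]
  conv_lhs => rw [Measure.isAddLeftInvariant_eq_smul μ ((ν.prod volume).map L)]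
  rw [lintegral_smul_measure, ENNReal.smul_def, smul_eq_mul,
    lintegral_map (hG.indicator hmeas) L.continuous.measurable,
    lintegral_prod_symm (fun p => indicator {x : E | 0 < ⟪e, x⟫} G (L p))
      ((hG.indicator hmeas).comp L.continuous.measurable).aemeasurable]
  congr 1
  calc ∫⁻ s, ∫⁻ y, indicator {x : E | 0 < ⟪e, x⟫} G (L (y, s)) ∂ν
      = ∫⁻ s in Ioi (0 : ℝ), ∫⁻ y, G (ι y + s • e) ∂ν := by
        rw [← lintegral_indicator measurableSet_Ioi]
        refine lintegral_congr fun s => ?_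
        have hL : ∀ y, L (y, s) = ι y + s • e := fun y => hyperplaneEquiv_apply he hι hd (y, s)
        have hinner : ∀ y, ⟪e, ι y + s • e⟫ = s := fun y => by
          rw [inner_add_right, inner_smul_right, real_inner_comm, hι,
            real_inner_self_eq_norm_sq, he]
          simp
        by_cases hs : 0 < s
        · simp [indicator, hinner, hL, hs]
        · simp [indicator, hinner, hL, hs]
    _ = ∫⁻ s in Ioi (0 : ℝ), ∫⁻ y,
          ENNReal.ofReal (s ^ finrank ℝ F) * G (s • (ι y + e)) ∂ν := by
        refine setLIntegral_congr_fun measurableSet_Ioi fun s hs => ?_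
        rw [lintegral_eq_mul_lintegral_smul ν _ hs, ← lintegral_const_mul' _ _ ENNReal.ofReal_ne_top]
        simp
    _ = ∫⁻ y, (∫⁻ s in Ioi (0 : ℝ),
          ENNReal.ofReal (s ^ finrank ℝ F) * G (s • (ι y + e))) ∂ν := by
        refine lintegral_lintegral_swap (Measurable.aemeasurable ?_)
        exact (by fun_prop : Measurable fun p : ℝ × F => ENNReal.ofReal (p.1 ^ finrank ℝ F)).mul
          (hjoint.comp measurable_swap)
    _ = _ := by
        refine lintegral_congr fun y => ?_
        have ha : 0 < ‖ι y + e‖⁻¹ := inv_pos.2 (by linarith [one_le_norm_add he hι y])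
        rw [lintegral_Ioi_smul _ ha, ← lintegral_const_mul' _ _ ENNReal.ofReal_ne_top]
        refine setLIntegral_congr_fun measurableSet_Ioi fun r hr => ?_
        rw [← mul_assoc, ← ENNReal.ofReal_mul ha.le, centralProj, smul_smul, mul_comm r,
          mul_pow, pow_succ', mul_assoc]

lemma exists_lintegral_cone_le [FiniteDimensional ℝ E] [FiniteDimensional ℝ F]
    [MeasurableSpace E] [BorelSpace E] [MeasurableSpace F] [BorelSpace F]
    (μ : Measure E) [μ.IsAddHaarMeasure] (ν : Measure F) [ν.IsAddHaarMeasure]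
    {ι : F →ₗᵢ[ℝ] E} {e : E} (he : ‖e‖ = 1) (hι : ∀ y, ⟪ι y, e⟫ = 0)
    (hd : finrank ℝ F + 1 = finrank ℝ E) (R : ℝ) :
    ∃ c : ℝ≥0, ∀ G : E → ℝ≥0∞, Measurable G →
      ∫⁻ x in {x | 0 < ⟪e, x⟫ ∧ ‖x‖ ≤ R * ⟪e, x⟫}, G x ∂μ ≤
        c * ∫⁻ y in Metric.closedBall 0 R, (∫⁻ r in Ioi (0 : ℝ),
          ENNReal.ofReal (r ^ finrank ℝ F) * G (r • centralProj ι e y)) ∂ν := by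
  obtain ⟨c, -, hc⟩ := exists_lintegral_halfSpace_eq μ ν he hι hd
  refine ⟨c, fun G hG => ?_⟩
  have hopen : MeasurableSet {x : E | 0 < ⟪e, x⟫} :=
    (isOpen_lt continuous_const (by fun_prop)).measurableSet
  have hcone : MeasurableSet {x : E | ‖x‖ ≤ R * ⟪e, x⟫} :=
    (isClosed_le (by fun_prop) (by fun_prop)).measurableSet
  have hinter : {x : E | 0 < ⟪e, x⟫ ∧ ‖x‖ ≤ R * ⟪e, x⟫} =
      {x : E | ‖x‖ ≤ R * ⟪e, x⟫} ∩ {x : E | 0 < ⟪e, x⟫} := by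
    ext x; simp [and_comm]
  rw [hinter, ← setLIntegral_indicator hcone, hc _ (hG.indicator hcone),
    ← lintegral_indicator Metric.isClosed_closedBall.measurableSet]
  gcongr with y
  have hf1 := one_le_norm_add he hι y
  by_cases hy : ‖ι y + e‖ ≤ R
  · have hyR : y ∈ Metric.closedBall (0 : F) R := by
      have h := norm_sq_add_smul he hι y 1
      rw [one_smul] at h
      rw [mem_closedBall_zero_iff]
      nlinarith [norm_nonneg (ι y + e), norm_nonneg y]
    rw [indicator_of_mem hyR]
    refine setLIntegral_mono' measurableSet_Ioi fun r hr => ?_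
    have hr0 : (0 : ℝ) < r := hr
    gcongr
    · have : ‖ι y + e‖⁻¹ ^ (finrank ℝ F + 1) ≤ 1 :=
        pow_le_one₀ (by positivity) (inv_le_one_of_one_le₀ hf1)
      exact mul_le_of_le_one_left (by positivity) this
    · exact indicator_le_self _ _ _
  · have : ∀ r ∈ Ioi (0 : ℝ),
        ENNReal.ofReal (‖ι y + e‖⁻¹ ^ (finrank ℝ F + 1) * r ^ finrank ℝ F) *
          indicator {x : E | ‖x‖ ≤ R * ⟪e, x⟫} G (r • centralProj ι e y) = 0 := by
      intro r hr
      have hr0 : (0 : ℝ) < r := hr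
      rw [indicator_of_notMem, mul_zero]
      have h1 : ⟪e, ι y + e⟫ = 1 := by
        rw [inner_add_right, real_inner_comm, hι, real_inner_self_eq_norm_sq, he]; simp
      rw [mem_ofPred_eq, norm_smul, norm_centralProj he hι, inner_smul_right, centralProj,
        inner_smul_right, h1, Real.norm_of_nonneg hr0.le, not_le]
      have h2 : R * ‖ι y + e‖⁻¹ < 1 := by
        rw [← div_eq_mul_inv, div_lt_one (by linarith)]
        exact not_le.1 hy
      nlinarith
    rw [setLIntegral_congr_fun measurableSet_Ioi this]
    simp

lemma exists_lintegral_polar_le [FiniteDimensional ℝ E] [FiniteDimensional ℝ F]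
    [MeasurableSpace E] [BorelSpace E] [MeasurableSpace F] [BorelSpace F]
    (μ : Measure E) [μ.IsAddHaarMeasure] (ν : Measure F) [ν.IsAddHaarMeasure]
    {ι : F →ₗᵢ[ℝ] E} {e : E} (he : ‖e‖ = 1) (hι : ∀ y, ⟪ι y, e⟫ = 0)
    (hd : finrank ℝ F + 1 = finrank ℝ E) (R : ℝ) :
    ∃ c : ℝ≥0, ∀ G : E → ℝ≥0∞, Measurable G →
      ∫⁻ y in Metric.closedBall 0 R, (∫⁻ r in Ioi (0 : ℝ),
          ENNReal.ofReal (r ^ finrank ℝ F) * G (r • centralProj ι e y)) ∂ν ≤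
        c * ∫⁻ x, G x ∂μ := by
  obtain ⟨c, hc0, hc⟩ := exists_lintegral_halfSpace_eq μ ν he hι hd
  refine ⟨((R + 1) ^ (finrank ℝ F + 1)).toNNReal * c⁻¹, fun G hG => ?_⟩
  calc ∫⁻ y in Metric.closedBall 0 R, (∫⁻ r in Ioi (0 : ℝ),
          ENNReal.ofReal (r ^ finrank ℝ F) * G (r • centralProj ι e y)) ∂ν
      ≤ ∫⁻ y in Metric.closedBall 0 R, (ENNReal.ofReal ((R + 1) ^ (finrank ℝ F + 1)) *
          ∫⁻ r in Ioi (0 : ℝ),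
          ENNReal.ofReal (‖ι y + e‖⁻¹ ^ (finrank ℝ F + 1) * r ^ finrank ℝ F) *
          G (r • centralProj ι e y)) ∂ν := by
        refine setLIntegral_mono' Metric.isClosed_closedBall.measurableSet fun y hy => ?_
        rw [← lintegral_const_mul' _ _ ENNReal.ofReal_ne_top]
        refine setLIntegral_mono' measurableSet_Ioi fun r hr => ?_
        have hr0 : (0 : ℝ) < r := hr
        rw [mem_closedBall_zero_iff] at hy
        have hR : 0 ≤ R := (norm_nonneg y).trans hy
        rw [← mul_assoc, ← ENNReal.ofReal_mul (by positivity), ← mul_assoc, ← mul_pow]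
        gcongr
        have h1 := one_le_norm_add he hι y
        have h2 : ‖ι y + e‖ ≤ R + 1 := by
          refine (norm_add_le _ _).trans ?_
          rw [ι.norm_map, he]
          linarith
        refine le_mul_of_one_le_left (by positivity) (one_le_pow₀ ?_)
        rwa [← div_eq_mul_inv, one_le_div (by linarith)]
    _ ≤ ENNReal.ofReal ((R + 1) ^ (finrank ℝ F + 1)) *
          ∫⁻ y, (∫⁻ r in Ioi (0 : ℝ),
          ENNReal.ofReal (‖ι y + e‖⁻¹ ^ (finrank ℝ F + 1) * r ^ finrank ℝ F) *
          G (r • centralProj ι e y)) ∂ν := by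
        rw [lintegral_const_mul' _ _ ENNReal.ofReal_ne_top]
        gcongr
        exact Measure.restrict_le_self
    _ ≤ _ := by
        rw [ENNReal.coe_mul, ENNReal.coe_inv hc0, mul_assoc]
        refine mul_le_mul' le_rfl ?_
        rw [← ENNReal.div_eq_inv_mul,
          ENNReal.le_div_iff_mul_le (by simp [hc0]) (by simp), mul_comm, ← hc G hG]
        exact setLIntegral_le_lintegral _ _

lemma enorm_le_lintegral_ray_fderiv {v : E → ℝ} (hv : ContDiff ℝ 1 v) (hvs : HasCompactSupport v)
    {φ : E} (hφ : ‖φ‖ = 1) (r : ℝ) :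
    ‖v (r • φ)‖ₑ ≤ ∫⁻ s in Ioi r, ‖fderiv ℝ v (s • φ)‖ₑ := by
  have hφ0 : φ ≠ 0 := by rintro rfl; simp at hφ
  have hline : ContDiff ℝ 1 fun t : ℝ => t • -φ := by fun_prop
  have hg : ContDiff ℝ 1 (v ∘ fun t : ℝ => t • -φ) := hv.comp hline
  have hgs : HasCompactSupport (v ∘ fun t : ℝ => t • -φ) :=
    hvs.comp_isClosedEmbedding (isClosedEmbedding_smul_left (neg_ne_zero.2 hφ0))
  have h := hgs.enorm_le_lintegral_Ici_deriv hg (-r)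
  simp only [Function.comp_apply, neg_smul_neg] at h
  refine h.trans ?_
  have hderiv : ∀ t : ℝ, ‖deriv (v ∘ fun t : ℝ => t • -φ) t‖ₑ ≤ ‖fderiv ℝ v (-t • φ)‖ₑ := by
    intro t
    have hd : HasDerivAt (fun t : ℝ => t • -φ) (-φ) t := by
      simpa using (hasDerivAt_id t).smul_const (-φ)
    have h2 := ((hv.differentiable one_ne_zero _).hasFDerivAt (x := t • -φ)).comp_hasDerivAt t hd
    rw [h2.deriv, neg_smul, ← smul_neg]
    refine (ContinuousLinearMap.le_opENorm _ _).trans ?_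
    rw [enorm_neg, ← ofReal_norm φ, hφ]
    simp
  calc ∫⁻ t in Iic (-r), ‖deriv (v ∘ fun t : ℝ => t • -φ) t‖ₑ
      ≤ ∫⁻ t in Iic (-r), ‖fderiv ℝ v (-t • φ)‖ₑ := lintegral_mono hderiv
    _ = ∫⁻ t in Iio (-r), ‖fderiv ℝ v (-t • φ)‖ₑ := by
        rw [setLIntegral_congr Iio_ae_eq_Iic]
    _ = ∫⁻ s in Ioi r, ‖fderiv ℝ v (s • φ)‖ₑ := by
        rw [← lintegral_indicator measurableSet_Iio, ← lintegral_indicator measurableSet_Ioi,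
          ← lintegral_neg_eq_self]
        congr 1
        ext s
        simp [indicator, neg_lt_neg_iff]

/-- Spherical traces of a compactly supported `C¹` function are bounded in `L¹` by its gradient. -/
lemma exists_lintegral_trace_le [FiniteDimensional ℝ E] [FiniteDimensional ℝ F]
    [MeasurableSpace E] [BorelSpace E] [MeasurableSpace F] [BorelSpace F]
    (μ : Measure E) [μ.IsAddHaarMeasure] (ν : Measure F) [ν.IsAddHaarMeasure]
    {ι : F →ₗᵢ[ℝ] E} {e : E} (he : ‖e‖ = 1) (hι : ∀ y, ⟪ι y, e⟫ = 0)
    (hd : finrank ℝ F + 1 = finrank ℝ E) (R : ℝ) :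
    ∃ c : ℝ≥0, ∀ v : E → ℝ, ContDiff ℝ 1 v → HasCompactSupport v → ∀ r : ℝ, 0 < r →
      ENNReal.ofReal (r ^ finrank ℝ F) *
          ∫⁻ y in Metric.closedBall 0 R, ‖v (r • centralProj ι e y)‖ₑ ∂ν ≤
        c * ∫⁻ x, ‖fderiv ℝ v x‖ₑ ∂μ := by
  obtain ⟨c, hc⟩ := exists_lintegral_polar_le μ ν he hι hd R
  refine ⟨c, fun v hv hvs r hr => ?_⟩
  refine le_trans ?_ (hc (fun x => ‖fderiv ℝ v x‖ₑ)
    (hv.continuous_fderiv one_ne_zero).enorm.measurable)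
  rw [← lintegral_const_mul' _ _ ENNReal.ofReal_ne_top]
  refine lintegral_mono fun y => ?_
  calc ENNReal.ofReal (r ^ finrank ℝ F) * ‖v (r • centralProj ι e y)‖ₑ
      ≤ ENNReal.ofReal (r ^ finrank ℝ F) *
          ∫⁻ s in Ioi r, ‖fderiv ℝ v (s • centralProj ι e y)‖ₑ := by
        gcongr
        exact enorm_le_lintegral_ray_fderiv hv hvs (norm_centralProj he hι y) r
    _ ≤ ∫⁻ s in Ioi r, ENNReal.ofReal (s ^ finrank ℝ F) *
          ‖fderiv ℝ v (s • centralProj ι e y)‖ₑ := by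
        rw [← lintegral_const_mul' _ _ ENNReal.ofReal_ne_top]
        refine setLIntegral_mono' measurableSet_Ioi fun s hs => ?_
        have hs0 : r < s := hs
        gcongr
    _ ≤ _ := lintegral_mono_set (Ioi_subset_Ioi hr.le)

/-- The `L²` Gagliardo-Nirenberg-Sobolev inequality in integral form. -/
lemma exists_lintegral_rpow_le_lintegral_fderiv_sq [FiniteDimensional ℝ E] [MeasurableSpace E]
    [BorelSpace E] (μ : Measure E) [μ.IsAddHaarMeasure] {N : ℝ} (hN : (finrank ℝ E : ℝ) = N)
    (h2 : 2 < N) :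
    ∃ C : ℝ≥0, ∀ w : E → ℝ, ContDiff ℝ 1 w → HasCompactSupport w →
      (∫⁻ x, ‖w x‖ₑ ^ (2 * N / (N - 2)) ∂μ) ^ ((N - 2) / N) ≤
        C * ∫⁻ x, ‖fderiv ℝ w x‖ₑ ^ (2 : ℝ) ∂μ := by
  refine ⟨eLpNormLESNormFDerivOfEqInnerConst μ (2 : ℝ≥0) ^ 2, fun w hw hws => ?_⟩
  have hN2 : 0 < N - 2 := by linarith
  have hp0 : 0 < 2 * N / (N - 2) := by positivity
  have hfin : 0 < finrank ℝ E := by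
    rw [← Nat.cast_pos (α := ℝ), hN]; linarith
  have h := eLpNorm_le_eLpNorm_fderiv_of_eq_inner μ hw hws (p := 2)
    (p' := (2 * N / (N - 2)).toNNReal) (by norm_num) hfin (by
      rw [Real.coe_toNNReal _ hp0.le, hN]
      push_cast
      field_simp)
  rw [eLpNorm_nnreal_eq_lintegral (by simpa using hp0), eLpNorm_nnreal_eq_lintegral (by norm_num),
    Real.coe_toNNReal _ hp0.le] at h
  have h' := ENNReal.rpow_le_rpow h (show (0 : ℝ) ≤ 2 by norm_num)
  rw [ENNReal.mul_rpow_of_nonneg _ _ (by norm_num), ← ENNReal.rpow_mul, ← ENNReal.rpow_mul] at h'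
  convert h' using 2
  · field_simp
  · push_cast
    rw [← ENNReal.rpow_natCast]
    norm_num
  · simp

/-- Sobolev trace inequality on spheres centred at the origin, in central projection
coordinates. -/
lemma exists_lintegral_sphere_trace_le [FiniteDimensional ℝ E] [FiniteDimensional ℝ F]
    [MeasurableSpace E] [BorelSpace E] [MeasurableSpace F] [BorelSpace F]
    (μ : Measure E) [μ.IsAddHaarMeasure] (ν : Measure F) [ν.IsAddHaarMeasure]
    {ι : F →ₗᵢ[ℝ] E} {e : E} (he : ‖e‖ = 1) (hι : ∀ y, ⟪ι y, e⟫ = 0)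
    (hd : finrank ℝ F + 1 = finrank ℝ E) {N : ℝ} (hN : (finrank ℝ F : ℝ) = N) (h1 : 1 < N)
    (R : ℝ) :
    ∃ C : ℝ≥0, ∀ u : E → ℝ, ContDiff ℝ 1 u → HasCompactSupport u → ∀ r : ℝ, 0 < r →
      ENNReal.ofReal (r ^ finrank ℝ F) *
          ∫⁻ y in Metric.closedBall 0 R, ‖u (r • centralProj ι e y)‖ₑ ^ (2 * N / (N - 1)) ∂ν ≤
        C * (∫⁻ x, ‖fderiv ℝ u x‖ₑ ^ (2 : ℝ) ∂μ) ^ (N / (N - 1)) := by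
  obtain ⟨C₁, hC₁⟩ := exists_lintegral_trace_le μ ν he hι hd R
  have hE : (finrank ℝ E : ℝ) = N + 1 := by rw [← hd, ← hN]; push_cast; rfl
  obtain ⟨C₂, hC₂⟩ := exists_lintegral_rpow_le_lintegral_fderiv_sq μ hE (by linarith)
  have hN1 : 0 < N - 1 := by linarith
  have hN0 : 0 < N := by linarith
  have hq : 1 < 2 * N / (N - 1) := by rw [one_lt_div hN1]; linarith
  set q : ℝ≥0 := (2 * N / (N - 1)).toNNReal
  have hqr : (q : ℝ) = 2 * N / (N - 1) := Real.coe_toNNReal _ (by linarith)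
  have hq1 : 1 < q := by rw [← NNReal.coe_lt_coe, hqr]; exact_mod_cast hq
  refine ⟨C₁ * (q * C₂ ^ ((N + 1) / (2 * (N - 1)))), fun u hu hus r hr => ?_⟩
  have hcont := hu.continuous
  have hdcont := hu.continuous_fderiv one_ne_zero
  have hv : ContDiff ℝ 1 fun x => ‖u x‖ ^ (q : ℝ) := hu.norm_rpow (by exact_mod_cast hq1)
  have hvs : HasCompactSupport fun x => ‖u x‖ ^ (q : ℝ) :=
    hus.norm.rpow_const (by rw [hqr]; linarith)
  have h := hC₁ _ hv hvs r hr
  have hB := hC₂ u hu hus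
  set B := ∫⁻ x, ‖fderiv ℝ u x‖ₑ ^ (2 : ℝ) ∂μ
  have hexp : 2 * (N + 1) / (N + 1 - 2) = ((q : ℝ) - 1) * 2 := by
    have : N + 1 - 2 = N - 1 := by ring
    rw [hqr, this]; field_simp; ring
  rw [hexp] at hB
  have hS : (∫⁻ x, ‖u x‖ₑ ^ (((q : ℝ) - 1) * 2) ∂μ) ^ (1 / 2 : ℝ) ≤
      C₂ ^ ((N + 1) / (2 * (N - 1))) * B ^ ((N + 1) / (2 * (N - 1))) := by
    have := ENNReal.rpow_le_rpow hB (show 0 ≤ (N + 1) / (2 * (N - 1)) by positivity)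
    rw [← ENNReal.rpow_mul, ENNReal.mul_rpow_of_nonneg _ _ (by positivity)] at this
    convert this using 2
    have : N + 1 - 2 = N - 1 := by ring
    rw [this]; field_simp
  calc ENNReal.ofReal (r ^ finrank ℝ F) *
        ∫⁻ y in Metric.closedBall 0 R, ‖u (r • centralProj ι e y)‖ₑ ^ (2 * N / (N - 1)) ∂ν
      = ENNReal.ofReal (r ^ finrank ℝ F) *
          ∫⁻ y in Metric.closedBall 0 R, ‖‖u (r • centralProj ι e y)‖ ^ (q : ℝ)‖ₑ ∂ν := by
        simp_rw [Real.enorm_rpow_of_nonneg (norm_nonneg _) q.coe_nonneg, enorm_norm, hqr]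
    _ ≤ C₁ * ∫⁻ x, ‖fderiv ℝ (fun x => ‖u x‖ ^ (q : ℝ)) x‖ₑ ∂μ := h
    _ ≤ C₁ * ∫⁻ x, q * (‖u x‖ₑ ^ ((q : ℝ) - 1) * ‖fderiv ℝ u x‖ₑ) ∂μ := by
        gcongr with x
        rw [← mul_assoc]
        exact enorm_fderiv_norm_rpow_le (hu.differentiable one_ne_zero) hq1
    _ = C₁ * (q * ∫⁻ x, (‖u x‖ₑ ^ (((q : ℝ) - 1) * 2)) ^ (1 / 2 : ℝ) *
          (‖fderiv ℝ u x‖ₑ ^ (2 : ℝ)) ^ (1 / 2 : ℝ) ∂μ) := by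
        rw [lintegral_const_mul' _ _ ENNReal.coe_ne_top]
        have hhalf : ((q : ℝ) - 1) * 2 * (1 / 2) = q - 1 := by ring
        simp_rw [← ENNReal.rpow_mul, hhalf]
        norm_num
    _ ≤ C₁ * (q * ((∫⁻ x, ‖u x‖ₑ ^ (((q : ℝ) - 1) * 2) ∂μ) ^ (1 / 2 : ℝ) *
          B ^ (1 / 2 : ℝ))) := by
        gcongr
        exact ENNReal.lintegral_mul_norm_pow_le (by fun_prop) (by fun_prop) (by norm_num)
          (by norm_num) (by norm_num)
    _ ≤ C₁ * (q * ((C₂ ^ ((N + 1) / (2 * (N - 1))) * B ^ ((N + 1) / (2 * (N - 1)))) *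
          B ^ (1 / 2 : ℝ))) := by gcongr
    _ = _ := by
        have : N / (N - 1) = (N + 1) / (2 * (N - 1)) + 1 / 2 := by field_simp; ring
        rw [this, ENNReal.rpow_add_of_nonneg _ _ (by positivity) (by norm_num)]
        push_cast
        rw [ENNReal.coe_rpow_of_nonneg _ (by positivity)]
        ring

lemma norm_fderiv_comp_centralProj_le {d : ℕ} {ι : F →ₗᵢ[ℝ] Ed d} {e : Ed d} (he : ‖e‖ = 1)
    (hι : ∀ y, ⟪ι y, e⟫ = 0) {u : Ed d → ℝ} (hu : ContDiff ℝ 1 u) {r : ℝ} (hr : 0 < r) (y : F) :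
    ‖fderiv ℝ (fun y => u (r • centralProj ι e y)) y‖ ≤
      r * ‖angularGrad u (r • centralProj ι e y)‖ := by
  set φ := centralProj ι e y with hφ
  have hf1 := one_le_norm_add he hι y
  have hφ1 : ‖φ‖ = 1 := norm_centralProj he hι y
  have hang : angularGrad u (r • φ) =
      gradient u (r • φ) - ⟪φ, gradient u (r • φ)⟫ • φ := by
    have : ‖r • φ‖⁻¹ • r • φ = φ := by
      rw [norm_smul, hφ1, Real.norm_of_nonneg hr.le, mul_one, smul_smul,
        inv_mul_cancel₀ hr.ne', one_smul]
    rw [angularGrad, this]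
  have hperp : ⟪angularGrad u (r • φ), φ⟫ = 0 := by
    rw [hang, inner_sub_left, inner_smul_left, real_inner_self_eq_norm_sq, hφ1,
      real_inner_comm]
    simp
  have hφd := ((contDiff_centralProj he hι).differentiable one_ne_zero y).hasFDerivAt
  set D := fderiv ℝ (centralProj ι e) y
  have hD : ∀ h, ⟪φ, D h⟫ = 0 := by
    intro h
    have h1 := hφd.norm_sq
    have h2 : (fun y => ‖centralProj ι e y‖ ^ 2) = fun _ => (1 : ℝ) := by
      ext y; rw [norm_centralProj he hι, one_pow]
    rw [h2] at h1
    have h3 := congrArg (fun l => l h) (h1.unique (hasFDerivAt_const (1 : ℝ) y))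
    simpa using h3
  have hD2 : ∀ h, ∃ t : ℝ, D h = ‖ι y + e‖⁻¹ • ι h + t • φ := by
    intro h
    have h0 : ι y + e ≠ 0 := norm_pos_iff.1 (by linarith)
    have hf : HasFDerivAt (fun y => ι y + e) ι.toContinuousLinearMap y :=
      ι.toContinuousLinearMap.hasFDerivAt.add_const e
    have ha : DifferentiableAt ℝ (fun y => ‖ι y + e‖⁻¹) y :=
      (hf.differentiableAt.norm ℝ h0).inv (norm_ne_zero_iff.2 h0)
    have h1 := (ha.hasFDerivAt.smul hf).unique hφd
    refine ⟨fderiv ℝ (fun y => ‖ι y + e‖⁻¹) y h * ‖ι y + e‖, ?_⟩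
    have h2 := congrArg (fun l => l h) h1
    simp only [add_apply, smul_apply,
      ContinuousLinearMap.smulRight_apply, LinearIsometry.coe_toContinuousLinearMap] at h2
    rw [← h2, hφ, centralProj, smul_smul, mul_assoc, mul_inv_cancel₀ (by linarith), mul_one]
  have hw : HasFDerivAt (fun y => u (r • centralProj ι e y))
      ((fderiv ℝ u (r • φ)).comp (r • D)) y :=
    ((hu.differentiable one_ne_zero _).hasFDerivAt).comp y (hφd.const_smul r)
  rw [hw.fderiv]
  refine ContinuousLinearMap.opNorm_le_bound _ (by positivity) fun h => ?_
  obtain ⟨t, ht⟩ := hD2 h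
  have key : fderiv ℝ u (r • φ) (D h) = ‖ι y + e‖⁻¹ * ⟪angularGrad u (r • φ), ι h⟫ := by
    have h1 : gradient u (r • φ) = angularGrad u (r • φ) + ⟪φ, gradient u (r • φ)⟫ • φ := by
      rw [hang]; abel
    rw [← inner_gradient_left, h1, inner_add_left, inner_smul_left, hD, mul_zero, add_zero, ht,
      inner_add_right, inner_smul_right, inner_smul_right, hperp, mul_zero, add_zero]
  rw [ContinuousLinearMap.comp_apply, smul_apply, map_smul, smul_eq_mul, key,
    norm_mul, norm_mul, norm_inv, norm_norm, Real.norm_of_nonneg hr.le, mul_assoc]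
  refine mul_le_mul_of_nonneg_left ?_ hr.le
  calc ‖ι y + e‖⁻¹ * ‖⟪angularGrad u (r • φ), ι h⟫‖
      ≤ 1 * (‖angularGrad u (r • φ)‖ * ‖ι h‖) :=
        mul_le_mul (inv_le_one_of_one_le₀ hf1) (norm_inner_le_norm _ _) (norm_nonneg _)
          zero_le_one
    _ = _ := by rw [one_mul, ι.norm_map]

lemma exists_cutoff [FiniteDimensional ℝ F] {R : ℝ} (hR : 0 < R) :
    ∃ (η : F → ℝ) (L : ℝ), ContDiff ℝ 1 η ∧ (∀ y, η y ∈ Icc 0 1) ∧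
      (∀ y ∈ Metric.closedBall 0 R, η y = 1) ∧ tsupport η = Metric.closedBall 0 (R + 1) ∧
      ∀ y, ‖fderiv ℝ η y‖ ≤ L := by
  let b : ContDiffBump (0 : F) := ⟨R, R + 1, hR, by linarith⟩
  obtain ⟨L, hL⟩ := (b.contDiff (n := 1)).continuous_fderiv one_ne_zero
    |>.bounded_above_of_compact_support (b.hasCompactSupport.fderiv ℝ)
  exact ⟨b, L, b.contDiff, fun y => ⟨b.nonneg, b.le_one⟩,
    fun y hy => b.one_of_mem_closedBall hy, b.tsupport_eq, hL⟩

lemma contDiff_comp_centralProj {ι : F →ₗᵢ[ℝ] E} {e : E} (he : ‖e‖ = 1)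
    (hι : ∀ y, ⟪ι y, e⟫ = 0) {u : E → ℝ} (hu : ContDiff ℝ 1 u) (r : ℝ) :
    ContDiff ℝ 1 fun y => u (r • centralProj ι e y) :=
  hu.comp ((contDiff_centralProj he hι).const_smul r)

lemma lintegral_fderiv_cutoff_sq_le {d : ℕ} [FiniteDimensional ℝ F] [MeasurableSpace F]
    [BorelSpace F] (ν : Measure F) {ι : F →ₗᵢ[ℝ] Ed d} {e : Ed d} (he : ‖e‖ = 1)
    (hι : ∀ y, ⟪ι y, e⟫ = 0) {R L : ℝ} {η : F → ℝ} (hη : ContDiff ℝ 1 η)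
    (hη01 : ∀ y, η y ∈ Icc (0 : ℝ) 1) (hηs : tsupport η = Metric.closedBall 0 R)
    (hL : ∀ y, ‖fderiv ℝ η y‖ ≤ L) {u : Ed d → ℝ} (hu : ContDiff ℝ 1 u) {r : ℝ} (hr : 0 < r) :
    ∫⁻ y, ‖fderiv ℝ (fun y => η y * u (r • centralProj ι e y)) y‖ₑ ^ (2 : ℝ) ∂ν ≤
      ENNReal.ofReal (2 * (L ^ 2 + 1)) * ∫⁻ y in Metric.closedBall 0 R,
        ENNReal.ofReal (u (r • centralProj ι e y) ^ 2 +
          r ^ 2 * ‖angularGrad u (r • centralProj ι e y)‖ ^ 2) ∂ν := by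
  rw [← lintegral_const_mul' _ _ ENNReal.ofReal_ne_top,
    ← lintegral_indicator Metric.isClosed_closedBall.measurableSet]
  refine lintegral_mono fun y => ?_
  have hL0 : 0 ≤ L := (norm_nonneg _).trans (hL y)
  by_cases hy : y ∈ Metric.closedBall 0 R
  · rw [indicator_of_mem hy, ← ENNReal.ofReal_mul (by positivity), ← ofReal_norm,
      ENNReal.ofReal_rpow_of_nonneg (norm_nonneg _) (by norm_num), Real.rpow_two]
    refine ENNReal.ofReal_le_ofReal ?_
    set a := ‖angularGrad u (r • centralProj ι e y)‖
    set b := u (r • centralProj ι e y)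
    have hw := norm_fderiv_comp_centralProj_le he hι hu hr y
    have hbound : ‖fderiv ℝ (fun y => η y * u (r • centralProj ι e y)) y‖ ≤ L * |b| + r * a := by
      rw [fderiv_fun_mul (hη.differentiable one_ne_zero y)
        ((contDiff_comp_centralProj he hι hu r).differentiable one_ne_zero y)]
      refine (norm_add_le _ _).trans ?_
      rw [norm_smul, norm_smul, Real.norm_of_nonneg (hη01 y).1, Real.norm_eq_abs, add_comm]
      refine add_le_add ?_ ?_
      · rw [mul_comm]
        exact mul_le_mul_of_nonneg_right (hL y) (abs_nonneg _)
      · exact (mul_le_of_le_one_left (norm_nonneg _) (hη01 y).2).trans hw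
    refine (pow_le_pow_left₀ (norm_nonneg _) hbound 2).trans ?_
    have h1 : (L * |b| + r * a) ^ 2 ≤ 2 * ((L * |b|) ^ 2 + (r * a) ^ 2) := add_sq_le
    have h2 : |b| ^ 2 = b ^ 2 := sq_abs b
    rw [mul_pow, mul_pow, h2] at h1
    nlinarith [mul_nonneg (sq_nonneg L) (mul_nonneg (sq_nonneg r) (sq_nonneg a)), sq_nonneg b]
  · have h0 : fderiv ℝ (fun y => η y * u (r • centralProj ι e y)) y = 0 := by
      by_contra h
      have h1 := support_fderiv_subset ℝ (Function.mem_support.2 h)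
      exact hy (hηs ▸ tsupport_mul_subset_left h1)
    rw [h0, ← ofReal_norm, norm_zero]
    simp

/-- The inequality on a cap of a single sphere, in central projection coordinates. -/
lemma exists_lintegral_slice_le {d : ℕ} [FiniteDimensional ℝ F] [MeasurableSpace F]
    [BorelSpace F] (ν : Measure F) [ν.IsAddHaarMeasure] {ι : F →ₗᵢ[ℝ] Ed d} {e : Ed d}
    (he : ‖e‖ = 1) (hι : ∀ y, ⟪ι y, e⟫ = 0) (hd : finrank ℝ F + 1 = finrank ℝ (Ed d))
    {N : ℝ} (hN : (finrank ℝ F : ℝ) = N) (h2 : 2 < N) {R : ℝ} (hR : 0 < R) :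
    ∃ C : ℝ≥0, ∀ u : Ed d → ℝ, ContDiff ℝ 1 u → HasCompactSupport u → ∀ r : ℝ, 0 < r →
      ENNReal.ofReal (r ^ 2) * ∫⁻ y in Metric.closedBall 0 R,
          ‖u (r • centralProj ι e y)‖ₑ ^ (2 * (N + 1) / (N - 1)) ∂ν ≤
        C * (∫⁻ x, ‖fderiv ℝ u x‖ₑ ^ (2 : ℝ)) ^ (2 / (N - 1)) *
          ∫⁻ y in Metric.closedBall 0 (R + 1), ENNReal.ofReal (u (r • centralProj ι e y) ^ 2 +
            r ^ 2 * ‖angularGrad u (r • centralProj ι e y)‖ ^ 2) ∂ν := by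
  obtain ⟨C₁, hC₁⟩ := exists_lintegral_sphere_trace_le volume ν he hι hd hN (by linarith) (R + 1)
  obtain ⟨C₂, hC₂⟩ := exists_lintegral_rpow_le_lintegral_fderiv_sq ν hN h2
  obtain ⟨η, L, hη, hη01, hη1, hηs, hL⟩ := exists_cutoff (F := F) hR
  have hN0 : 0 < N := by linarith
  have hN1 : 0 < N - 1 := by linarith
  have hN2 : 0 < N - 2 := by linarith
  refine ⟨C₁ ^ (2 / N) * (C₂ * (2 * (L ^ 2 + 1)).toNNReal), fun u hu hus r hr => ?_⟩
  have hw := contDiff_comp_centralProj he hι hu r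
  set w := fun y => u (r • centralProj ι e y)
  have hW : ContDiff ℝ 1 fun y => η y * w y := hη.mul hw
  have hWs : HasCompactSupport fun y => η y * w y := by
    have : HasCompactSupport η := by
      rw [HasCompactSupport, hηs]; exact isCompact_closedBall _ _
    exact this.mul_right
  have hWc := hW.continuous
  set B := ∫⁻ x, ‖fderiv ℝ u x‖ₑ ^ (2 : ℝ)
  set A := ∫⁻ y in Metric.closedBall 0 (R + 1), ENNReal.ofReal (u (r • centralProj ι e y) ^ 2 +
            r ^ 2 * ‖angularGrad u (r • centralProj ι e y)‖ ^ 2) ∂ν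
  set q : ℝ := 2 * N / (N - 1)
  set m : ℝ := 2 * N / (N - 2)
  have hq0 : 0 < q := by positivity
  have hsob : (∫⁻ y, ‖η y * w y‖ₑ ^ m ∂ν) ^ ((N - 2) / N) ≤
      C₂ * (ENNReal.ofReal (2 * (L ^ 2 + 1)) * A) := by
    refine (hC₂ _ hW hWs).trans ?_
    gcongr
    exact lintegral_fderiv_cutoff_sq_le ν he hι hη hη01 hηs hL hu hr
  have htr : ENNReal.ofReal (r ^ 2) * (∫⁻ y, ‖η y * w y‖ₑ ^ q ∂ν) ^ (2 / N) ≤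
      C₁ ^ (2 / N) * B ^ (2 / (N - 1)) := by
    have hle : ∫⁻ y, ‖η y * w y‖ₑ ^ q ∂ν ≤
        ∫⁻ y in Metric.closedBall 0 (R + 1), ‖w y‖ₑ ^ q ∂ν := by
      rw [← lintegral_indicator Metric.isClosed_closedBall.measurableSet]
      refine lintegral_mono fun y => ?_
      by_cases hy : y ∈ Metric.closedBall 0 (R + 1)
      · rw [indicator_of_mem hy, enorm_mul]
        gcongr
        refine mul_le_of_le_one_left' ?_
        rw [Real.enorm_of_nonneg (hη01 y).1]
        exact ENNReal.ofReal_le_one.2 (hη01 y).2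
      · rw [image_eq_zero_of_notMem_tsupport (f := η) (by rwa [hηs])]
        simp [hq0]
    have h := ENNReal.rpow_le_rpow ((mul_le_mul_right hle _).trans (hC₁ u hu hus r hr))
      (show 0 ≤ 2 / N by positivity)
    rw [ENNReal.mul_rpow_of_nonneg _ _ (by positivity),
      ENNReal.mul_rpow_of_nonneg _ _ (by positivity), ← ENNReal.rpow_mul,
      ENNReal.ofReal_rpow_of_nonneg (by positivity) (by positivity), ← Real.rpow_natCast,
      hN, ← Real.rpow_mul hr.le] at h
    have e1 : N * (2 / N) = 2 := by field_simp
    have e2 : N / (N - 1) * (2 / N) = 2 / (N - 1) := by field_simp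
    rwa [e1, e2, Real.rpow_two] at h
  have hholder : ∫⁻ y, ‖η y * w y‖ₑ ^ (2 * (N + 1) / (N - 1)) ∂ν ≤
      (∫⁻ y, ‖η y * w y‖ₑ ^ m ∂ν) ^ ((N - 2) / N) *
        (∫⁻ y, ‖η y * w y‖ₑ ^ q ∂ν) ^ (2 / N) := by
    refine le_trans (le_of_eq (lintegral_congr fun y => ?_))
      (ENNReal.lintegral_mul_norm_pow_le (hWc.enorm.measurable.pow_const _).aemeasurable
        (hWc.enorm.measurable.pow_const _).aemeasurable (by positivity)
        (by positivity) (by field_simp; ring))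
    rw [← ENNReal.rpow_mul, ← ENNReal.rpow_mul,
      ← ENNReal.rpow_add_of_nonneg _ _ (by positivity) (by positivity)]
    congr 1
    simp only [m, q]
    field_simp
    ring
  calc ENNReal.ofReal (r ^ 2) * ∫⁻ y in Metric.closedBall 0 R,
          ‖w y‖ₑ ^ (2 * (N + 1) / (N - 1)) ∂ν
      = ENNReal.ofReal (r ^ 2) * ∫⁻ y in Metric.closedBall 0 R,
          ‖η y * w y‖ₑ ^ (2 * (N + 1) / (N - 1)) ∂ν := by
        congr 1
        refine setLIntegral_congr_fun Metric.isClosed_closedBall.measurableSet fun y hy => ?_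
        rw [hη1 y hy, one_mul]
    _ ≤ ENNReal.ofReal (r ^ 2) * ((∫⁻ y, ‖η y * w y‖ₑ ^ m ∂ν) ^ ((N - 2) / N) *
        (∫⁻ y, ‖η y * w y‖ₑ ^ q ∂ν) ^ (2 / N)) :=
        mul_le_mul_right ((setLIntegral_le_lintegral _ _).trans hholder) _
    _ = (ENNReal.ofReal (r ^ 2) * (∫⁻ y, ‖η y * w y‖ₑ ^ q ∂ν) ^ (2 / N)) *
        (∫⁻ y, ‖η y * w y‖ₑ ^ m ∂ν) ^ ((N - 2) / N) := by ring
    _ ≤ (C₁ ^ (2 / N) * B ^ (2 / (N - 1))) *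
        (C₂ * (ENNReal.ofReal (2 * (L ^ 2 + 1)) * A)) := mul_le_mul' htr hsob
    _ = _ := by
        push_cast
        rw [ENNReal.coe_rpow_of_nonneg _ (by positivity), ENNReal.ofReal]
        ring

lemma measurable_angularGrad {d : ℕ} {u : Ed d → ℝ} (hu : ContDiff ℝ 1 u) :
    Measurable (angularGrad u) := by
  have hg : Measurable (gradient u) :=
    ((InnerProductSpace.toDual ℝ (Ed d)).symm.continuous.comp
      (hu.continuous_fderiv one_ne_zero)).measurable
  have hx : Measurable fun x : Ed d => ‖x‖⁻¹ • x := by fun_prop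
  have hin : Measurable fun x : Ed d => ⟪‖x‖⁻¹ • x, gradient u x⟫ := hx.inner hg
  have hs : Measurable fun x : Ed d => ⟪‖x‖⁻¹ • x, gradient u x⟫ • (‖x‖⁻¹ • x) := by fun_prop
  exact hg.sub hs

lemma exists_setLIntegral_cone_le {d : ℕ} [FiniteDimensional ℝ F] [MeasurableSpace F]
    [BorelSpace F] (ν : Measure F) [ν.IsAddHaarMeasure] {ι : F →ₗᵢ[ℝ] Ed d} {e : Ed d}
    (he : ‖e‖ = 1) (hι : ∀ y, ⟪ι y, e⟫ = 0) (hd : finrank ℝ F + 1 = finrank ℝ (Ed d))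
    {N : ℝ} (hN : (finrank ℝ F : ℝ) = N) (h2 : 2 < N) {R : ℝ} (hR : 0 < R) :
    ∃ C : ℝ≥0, ∀ u : Ed d → ℝ, ContDiff ℝ 1 u → HasCompactSupport u →
      ∫⁻ x in {x | 0 < ⟪e, x⟫ ∧ ‖x‖ ≤ R * ⟪e, x⟫},
          ENNReal.ofReal (|u x| ^ (2 * (N + 1) / (N - 1)) / ‖x‖) ≤
        C * (∫⁻ x, ‖fderiv ℝ u x‖ₑ ^ (2 : ℝ)) ^ (2 / (N - 1)) *
          ∫⁻ x, ENNReal.ofReal (u x ^ 2 / ‖x‖ ^ 3 + ‖angularGrad u x‖ ^ 2 / ‖x‖) := by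
  obtain ⟨C₁, hC₁⟩ := exists_lintegral_cone_le volume ν he hι hd R
  obtain ⟨C₂, hC₂⟩ := exists_lintegral_polar_le volume ν he hι hd (R + 1)
  obtain ⟨C, hC⟩ := exists_lintegral_slice_le ν he hι hd hN h2 hR
  refine ⟨C₁ * C * C₂, fun u hu hus => ?_⟩
  have hP : 0 ≤ 2 * (N + 1) / (N - 1) := div_nonneg (by linarith) (by linarith)
  set P : ℝ := 2 * (N + 1) / (N - 1)
  set B := (∫⁻ x, ‖fderiv ℝ u x‖ₑ ^ (2 : ℝ)) ^ (2 / (N - 1))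
  have hum : Measurable u := hu.continuous.measurable
  have ham := measurable_angularGrad hu
  set G : Ed d → ℝ≥0∞ := fun x => ENNReal.ofReal (|u x| ^ P / ‖x‖)
  set H : Ed d → ℝ≥0∞ := fun x =>
    ENNReal.ofReal (u x ^ 2 / ‖x‖ ^ 3 + ‖angularGrad u x‖ ^ 2 / ‖x‖)
  have hG : Measurable G := by
    have : Measurable fun x => |u x| := hum.abs
    exact ((this.pow_const P).div measurable_norm).ennreal_ofReal
  have hH : Measurable H :=
    (((hum.pow_const 2).div (measurable_norm.pow_const 3)).add
      ((ham.norm.pow_const 2).div measurable_norm)).ennreal_ofReal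
  have hφ : Continuous (centralProj ι e) := (contDiff_centralProj he hι).continuous
  have hjoint : ∀ K : Ed d → ℝ≥0∞, Measurable K → Measurable fun p : F × ℝ =>
      ENNReal.ofReal (p.2 ^ finrank ℝ F) * K (p.2 • centralProj ι e p.1) := fun K hK =>
    (by fun_prop : Measurable fun p : F × ℝ => ENNReal.ofReal (p.2 ^ finrank ℝ F)).mul
      (hK.comp (by fun_prop))
  have hslice : ∀ r ∈ Ioi (0 : ℝ),
      ∫⁻ y in Metric.closedBall 0 R,
        ENNReal.ofReal (r ^ finrank ℝ F) * G (r • centralProj ι e y) ∂ν ≤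
      C * B * ∫⁻ y in Metric.closedBall 0 (R + 1),
        ENNReal.ofReal (r ^ finrank ℝ F) * H (r • centralProj ι e y) ∂ν := by
    intro r hr
    have hr0 : (0 : ℝ) < r := hr
    have hnorm : ∀ y, ‖r • centralProj ι e y‖ = r := fun y => by
      rw [norm_smul, norm_centralProj he hι, mul_one, Real.norm_of_nonneg hr0.le]
    calc ∫⁻ y in Metric.closedBall 0 R,
          ENNReal.ofReal (r ^ finrank ℝ F) * G (r • centralProj ι e y) ∂ν
        = ∫⁻ y in Metric.closedBall 0 R, ENNReal.ofReal (r ^ finrank ℝ F / r ^ 3) *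
            (ENNReal.ofReal (r ^ 2) * ‖u (r • centralProj ι e y)‖ₑ ^ P) ∂ν := by
          refine lintegral_congr fun y => ?_
          simp only [G]
          rw [hnorm, ← ofReal_norm, ENNReal.ofReal_rpow_of_nonneg (norm_nonneg _) hP,
            ← ENNReal.ofReal_mul (by positivity), ← ENNReal.ofReal_mul (by positivity),
            ← ENNReal.ofReal_mul (by positivity), Real.norm_eq_abs]
          congr 1
          field_simp
      _ = ENNReal.ofReal (r ^ finrank ℝ F / r ^ 3) * (ENNReal.ofReal (r ^ 2) *
            ∫⁻ y in Metric.closedBall 0 R, ‖u (r • centralProj ι e y)‖ₑ ^ P ∂ν) := by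
          rw [lintegral_const_mul' _ _ ENNReal.ofReal_ne_top,
            lintegral_const_mul' _ _ ENNReal.ofReal_ne_top]
      _ ≤ ENNReal.ofReal (r ^ finrank ℝ F / r ^ 3) * (C * B *
          ∫⁻ y in Metric.closedBall 0 (R + 1), ENNReal.ofReal (u (r • centralProj ι e y) ^ 2 +
            r ^ 2 * ‖angularGrad u (r • centralProj ι e y)‖ ^ 2) ∂ν) :=
          mul_le_mul_right (hC u hu hus r hr0) _
      _ = C * B * ∫⁻ y in Metric.closedBall 0 (R + 1),
            ENNReal.ofReal (r ^ finrank ℝ F) * H (r • centralProj ι e y) ∂ν := by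
          rw [mul_left_comm, ← lintegral_const_mul' _ _ ENNReal.ofReal_ne_top]
          congr 1
          refine lintegral_congr fun y => ?_
          simp only [H]
          rw [hnorm, ← ENNReal.ofReal_mul (by positivity), ← ENNReal.ofReal_mul (by positivity)]
          congr 1
          field_simp
  calc ∫⁻ x in {x | 0 < ⟪e, x⟫ ∧ ‖x‖ ≤ R * ⟪e, x⟫}, G x
      ≤ C₁ * ∫⁻ y in Metric.closedBall 0 R, (∫⁻ r in Ioi (0 : ℝ),
          ENNReal.ofReal (r ^ finrank ℝ F) * G (r • centralProj ι e y)) ∂ν := hC₁ G hG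
    _ = C₁ * ∫⁻ r in Ioi (0 : ℝ), ∫⁻ y in Metric.closedBall 0 R,
          ENNReal.ofReal (r ^ finrank ℝ F) * G (r • centralProj ι e y) ∂ν := by
        rw [lintegral_lintegral_swap (hjoint G hG).aemeasurable]
    _ ≤ C₁ * ∫⁻ r in Ioi (0 : ℝ), C * B * ∫⁻ y in Metric.closedBall 0 (R + 1),
          ENNReal.ofReal (r ^ finrank ℝ F) * H (r • centralProj ι e y) ∂ν :=
        mul_le_mul_right (setLIntegral_mono' measurableSet_Ioi hslice) _
    _ = C₁ * (C * B * ∫⁻ y in Metric.closedBall 0 (R + 1), (∫⁻ r in Ioi (0 : ℝ),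
          ENNReal.ofReal (r ^ finrank ℝ F) * H (r • centralProj ι e y)) ∂ν) := by
        rw [lintegral_const_mul _ (hjoint H hH).lintegral_prod_left',
          ← lintegral_lintegral_swap (hjoint H hH).aemeasurable]
    _ ≤ C₁ * (C * B * (C₂ * ∫⁻ x, H x)) :=
        mul_le_mul_right (mul_le_mul_right (hC₂ H hH) _) _
    _ = _ := by push_cast; ring

end Cone

/-- The weighted inequality on the cone of opening `R` about an arbitrary axis `e`. -/
lemma exists_setLIntegral_axis_le {d : ℕ} (hd : 4 ≤ d) {e : Ed d} (he : ‖e‖ = 1) {R : ℝ}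
    (hR : 0 < R) :
    ∃ C : ℝ≥0, ∀ u : Ed d → ℝ, ContDiff ℝ 1 u → HasCompactSupport u →
      ∫⁻ x in {x | 0 < ⟪e, x⟫ ∧ ‖x‖ ≤ R * ⟪e, x⟫},
          ENNReal.ofReal (|u x| ^ ((2 * d : ℝ) / ((d : ℝ) - 2)) / ‖x‖) ≤
        C * (∫⁻ x, ‖fderiv ℝ u x‖ₑ ^ (2 : ℝ)) ^ (2 / ((d : ℝ) - 2)) *
          ∫⁻ x, ENNReal.ofReal (u x ^ 2 / ‖x‖ ^ 3 + ‖angularGrad u x‖ ^ 2 / ‖x‖) := by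
  have hdE : finrank ℝ (Ed d) = d - 1 + 1 := by simp; omega
  have : Fact (finrank ℝ (Ed d) = d - 1 + 1) := ⟨hdE⟩
  have he0 : e ≠ 0 := by rintro rfl; simp at he
  have hfin : finrank ℝ (ℝ ∙ e)ᗮ = d - 1 := Submodule.finrank_orthogonal_span_singleton he0
  let ι : EuclideanSpace ℝ (Fin (finrank ℝ (ℝ ∙ e)ᗮ)) →ₗᵢ[ℝ] Ed d :=
    (ℝ ∙ e)ᗮ.subtypeₗᵢ.comp (stdOrthonormalBasis ℝ (ℝ ∙ e)ᗮ).repr.symm.toLinearIsometry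
  have hι : ∀ y, ⟪ι y, e⟫ = 0 := fun y =>
    Submodule.mem_orthogonal_singleton_iff_inner_left.1
      ((stdOrthonormalBasis ℝ (ℝ ∙ e)ᗮ).repr.symm y).2
  have hd4 : (4 : ℝ) ≤ d := by exact_mod_cast hd
  obtain ⟨C, hC⟩ := exists_setLIntegral_cone_le volume he hι
    (by rw [hdE, finrank_euclideanSpace_fin, hfin]) (N := (d : ℝ) - 1)
    (by rw [finrank_euclideanSpace_fin, hfin, Nat.cast_sub (by omega), Nat.cast_one])
    (by linarith) hR
  refine ⟨C, fun u hu hus => ?_⟩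
  have h := hC u hu hus
  have e1 : (d : ℝ) - 1 + 1 = d := by ring
  have e2 : (d : ℝ) - 1 - 1 = d - 2 := by ring
  rwa [e1, e2] at h

/-- Every nonzero vector lies in a cone about one of the signed coordinate axes. -/
lemma exists_norm_le_mul_inner_axis {d : ℕ} {x : Ed d} (hx : x ≠ 0) :
    ∃ p : Fin d × ℤˣ, 0 < ⟪((p.2 : ℤ) : ℝ) • EuclideanSpace.single p.1 (1 : ℝ), x⟫ ∧
      ‖x‖ ≤ d * ⟪((p.2 : ℤ) : ℝ) • EuclideanSpace.single p.1 (1 : ℝ), x⟫ := by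
  have hx0 : 0 < ‖x‖ := norm_pos_iff.2 hx
  obtain ⟨i, hi⟩ : ∃ i, ‖x‖ ≤ d * |x i| := by
    by_contra! h
    have hd : d ≠ 0 := by
      rintro rfl
      exact hx (Subsingleton.elim _ _)
    have : Nonempty (Fin d) := ⟨⟨0, Nat.pos_of_ne_zero hd⟩⟩
    have hd1 : (1 : ℝ) ≤ d := by exact_mod_cast Nat.one_le_iff_ne_zero.2 hd
    have h1 : ∑ i : Fin d, (d * |x i|) ^ 2 < ∑ _i : Fin d, ‖x‖ ^ 2 :=
      Finset.sum_lt_sum_of_nonempty Finset.univ_nonempty fun i _ =>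
        pow_lt_pow_left₀ (h i) (by positivity) two_ne_zero
    simp_rw [mul_pow, sq_abs] at h1
    rw [← Finset.mul_sum, ← EuclideanSpace.real_norm_sq_eq] at h1
    simp only [Finset.sum_const, Finset.card_univ, Fintype.card_fin, nsmul_eq_mul] at h1
    have : 0 < ‖x‖ ^ 2 := by positivity
    have := mul_le_mul_of_nonneg_right (by nlinarith : (d : ℝ) ≤ d ^ 2) (sq_nonneg ‖x‖)
    linarith
  have hpos : 0 < |x i| := by
    by_contra h
    have : |x i| = 0 := le_antisymm (not_lt.1 h) (abs_nonneg _)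
    rw [this, mul_zero] at hi
    linarith
  have hin : ∀ s : ℝ, ⟪s • EuclideanSpace.single i (1 : ℝ), x⟫ = s * x i := fun s => by
    rw [real_inner_smul_left, EuclideanSpace.inner_single_left]
    simp
  rcases abs_cases (x i) with ⟨h, -⟩ | ⟨h, -⟩ <;> rw [h] at hpos hi
  · refine ⟨(i, 1), ?_⟩
    rw [hin]
    simpa using ⟨hpos, hi⟩
  · refine ⟨(i, -1), ?_⟩
    rw [hin]
    simpa using ⟨neg_pos.1 hpos, hi.trans_eq (mul_neg _ _)⟩

/-- Weighted Sobolev-type inequality: for `d ≥ 5` and `u ∈ C¹_c(ℝ^d)`,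
`∫ |u|^{2d/(d-2)}/|x| ≤ C(d) (∫|∇u|²)^{2/(d-2)} ∫ (|u|²/|x|³ + |∇_θ u|²/|x|)`. -/
theorem stmt3 (d : ℕ) (hd : 5 ≤ d) :
    ∃ C : ℝ, 0 < C ∧
      ∀ u : Ed d → ℝ, ContDiff ℝ 1 u → HasCompactSupport u →
        (∫⁻ x : Ed d, ENNReal.ofReal (|u x| ^ ((2 * d : ℝ) / ((d : ℝ) - 2)) / ‖x‖))
          ≤ ENNReal.ofReal C
            * (∫⁻ x : Ed d, ENNReal.ofReal (‖gradient u x‖ ^ 2)) ^ (2 / ((d : ℝ) - 2))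
            * ∫⁻ x : Ed d,
                ENNReal.ofReal ((u x) ^ 2 / ‖x‖ ^ 3 + ‖angularGrad u x‖ ^ 2 / ‖x‖) := by
  let axis : Fin d × ℤˣ → Ed d := fun p =>
    ((p.2 : ℤ) : ℝ) • EuclideanSpace.single p.1 (1 : ℝ)
  have haxis : ∀ p, ‖axis p‖ = 1 := by
    rintro ⟨i, s⟩
    rcases Int.units_eq_one_or s with rfl | rfl <;> simp [axis]
  have hd0 : (0 : ℝ) < d := by exact_mod_cast (by omega : 0 < d)
  choose C hC using fun p => exists_setLIntegral_axis_le (by omega : 4 ≤ d) (haxis p) hd0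
  refine ⟨(∑ p, C p : ℝ≥0) + 1, by positivity, fun u hu hus => ?_⟩
  set P : ℝ := (2 * d : ℝ) / ((d : ℝ) - 2)
  have hgrad : ∫⁻ x : Ed d, ENNReal.ofReal (‖gradient u x‖ ^ 2) =
      ∫⁻ x, ‖fderiv ℝ u x‖ₑ ^ (2 : ℝ) := by
    refine lintegral_congr fun x => ?_
    rw [gradient, LinearIsometryEquiv.norm_map, ← ofReal_norm,
      ENNReal.ofReal_rpow_of_nonneg (norm_nonneg _) (by norm_num), Real.rpow_two]
  rw [hgrad]
  set B := (∫⁻ x, ‖fderiv ℝ u x‖ₑ ^ (2 : ℝ)) ^ (2 / ((d : ℝ) - 2))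
  set A := ∫⁻ x, ENNReal.ofReal (u x ^ 2 / ‖x‖ ^ 3 + ‖angularGrad u x‖ ^ 2 / ‖x‖)
  calc ∫⁻ x, ENNReal.ofReal (|u x| ^ P / ‖x‖)
      = ∫⁻ x in ⋃ p, {x | 0 < ⟪axis p, x⟫ ∧ ‖x‖ ≤ d * ⟪axis p, x⟫},
          ENNReal.ofReal (|u x| ^ P / ‖x‖) := by
        refine (setLIntegral_eq_of_support_subset fun x hx => ?_).symm
        have hx0 : x ≠ 0 := by rintro rfl; simp at hx
        exact mem_iUnion.2 (exists_norm_le_mul_inner_axis hx0)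
    _ ≤ ∑ p, ∫⁻ x in {x | 0 < ⟪axis p, x⟫ ∧ ‖x‖ ≤ d * ⟪axis p, x⟫},
          ENNReal.ofReal (|u x| ^ P / ‖x‖) := by
        rw [← tsum_fintype (L := .unconditional _)]
        exact lintegral_iUnion_le _ _
    _ ≤ ∑ p, C p * B * A := Finset.sum_le_sum fun p _ => hC p u hu hus
    _ = ((∑ p, C p : ℝ≥0) : ℝ≥0∞) * B * A := by
        rw [ENNReal.ofNNReal_finsetSum, Finset.sum_mul, Finset.sum_mul]
    _ ≤ ENNReal.ofReal ((∑ p, C p : ℝ≥0) + 1) * B * A := by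
        gcongr
        rw [← ENNReal.ofReal_coe_nnreal]
        exact ENNReal.ofReal_le_ofReal (by linarith)
end
end

section
/- Let d ≥ 2, 1 ≤ p < d, β = (d−1)p/(d−p) and ν = (d−p)/p. Then there exists a constant C depending only on d and p such that for every C¹ function u : ℝ^d → ℝ with compact support and every r > 0, r^ν · ( ∫_{S^{d−1}} |u(rθ)|^β dσ(θ) )^{1/β} ≤ C · ( ∫_{ℝ^d} |∇u(x)|^p dx )^{1/p}. -/
open MeasureTheory
open scoped ENNReal

noncomputable section

section

open Set Metric
open scoped NNReal

/-- Integrating the derivative along the ray spanned by `w`, outwards from `s • w`. -/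
theorem enorm_le_lintegral_fderiv_ray {E : Type*} [NormedAddCommGroup E] [NormedSpace ℝ E]
    {v : E → ℝ} (hv : ContDiff ℝ 1 v) (hv' : HasCompactSupport v) {w : E} (hw : w ≠ 0) (s : ℝ) :
    ‖v (s • w)‖ₑ ≤ ‖w‖ₑ * ∫⁻ t in Ici s, ‖fderiv ℝ v (t • w)‖ₑ := by
  have hw' : -w ≠ 0 := neg_ne_zero.2 hw
  have hg : ContDiff ℝ 1 fun t : ℝ => v (t • -w) := by fun_prop
  have hg' : HasCompactSupport fun t : ℝ => v (t • -w) :=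
    hv'.comp_isClosedEmbedding (isClosedEmbedding_smul_left hw')
  have hd (t : ℝ) : ‖deriv (fun t : ℝ => v (t • -w)) t‖ₑ ≤ ‖w‖ₑ * ‖fderiv ℝ v (t • -w)‖ₑ := by
    have h := ((hv.differentiable one_ne_zero (t • -w)).hasFDerivAt.comp_hasDerivAt t
      ((hasDerivAt_id t).smul_const (-w))).deriv
    simp only [Function.comp_def, id, one_smul] at h
    rw [h, mul_comm]
    simpa using (fderiv ℝ v (t • -w)).le_opENorm (-w)
  have hneg : MeasurePreserving (Neg.neg : ℝ → ℝ) volume volume := Measure.measurePreserving_neg _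
  calc ‖v (s • w)‖ₑ = ‖v ((-s) • -w)‖ₑ := by simp
    _ ≤ ∫⁻ t in Iic (-s), ‖deriv (fun t : ℝ => v (t • -w)) t‖ₑ :=
      HasCompactSupport.enorm_le_lintegral_Ici_deriv hg hg' (-s)
    _ ≤ ∫⁻ t in Iic (-s), ‖w‖ₑ * ‖fderiv ℝ v (t • -w)‖ₑ := lintegral_mono fun t => hd t
    _ = ‖w‖ₑ * ∫⁻ t in Iic (-s), ‖fderiv ℝ v (t • -w)‖ₑ := lintegral_const_mul' _ _ (by simp)
    _ = ‖w‖ₑ * ∫⁻ t in Ici s, ‖fderiv ℝ v (t • w)‖ₑ := by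
      rw [← hneg.setLIntegral_comp_preimage_emb (MeasurableEquiv.neg ℝ).measurableEmbedding]
      simp

/-- A weighted form of `enorm_le_lintegral_fderiv_ray`, which uses that `t ↦ t ^ n` increases. -/
theorem weighted_enorm_le_lintegral_fderiv_ray {E : Type*} [NormedAddCommGroup E]
    [NormedSpace ℝ E] {v : E → ℝ} (hv : ContDiff ℝ 1 v) (hv' : HasCompactSupport v) {w : E}
    (hw : w ≠ 0) {s : ℝ} (hs : 0 < s) (n : ℕ) :
    ENNReal.ofReal (s ^ n) * ‖v (s • w)‖ₑ ≤
      ‖w‖ₑ * ∫⁻ t in Ioi 0, ENNReal.ofReal (t ^ n) * ‖fderiv ℝ v (t • w)‖ₑ := by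
  calc ENNReal.ofReal (s ^ n) * ‖v (s • w)‖ₑ
      ≤ ENNReal.ofReal (s ^ n) * (‖w‖ₑ * ∫⁻ t in Ici s, ‖fderiv ℝ v (t • w)‖ₑ) := by
        gcongr; exact enorm_le_lintegral_fderiv_ray hv hv' hw s
    _ = ‖w‖ₑ * ∫⁻ t in Ici s, ENNReal.ofReal (s ^ n) * ‖fderiv ℝ v (t • w)‖ₑ := by
        rw [lintegral_const_mul' _ _ ENNReal.ofReal_ne_top, mul_left_comm]
    _ ≤ ‖w‖ₑ * ∫⁻ t in Ici s, ENNReal.ofReal (t ^ n) * ‖fderiv ℝ v (t • w)‖ₑ := by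
        gcongr 1
        refine setLIntegral_mono' measurableSet_Ici fun t ht => ?_
        gcongr
        exact ht
    _ ≤ _ := by
        gcongr

/-- The point of the hyperplane `{x | x i = ε}` whose remaining coordinates are `y`. -/
def faceLift {n : ℕ} (i : Fin (n + 1)) (ε : ℝ) (y : Fin n → ℝ) : Ed (n + 1) :=
  WithLp.toLp 2 (i.insertNth ε y)

theorem contDiff_faceLift {n : ℕ} (i : Fin (n + 1)) (ε : ℝ) : ContDiff ℝ 1 (faceLift i ε) := by
  refine contDiff_euclidean.2 fun j => ?_
  induction j using i.succAboveCases with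
  | x => simpa [faceLift] using contDiff_const
  | p j => simpa [faceLift] using contDiff_apply ℝ ℝ j

theorem faceLift_ne_zero {n : ℕ} (i : Fin (n + 1)) {ε : ℝ} (hε : ε ≠ 0) (y : Fin n → ℝ) :
    faceLift i ε y ≠ 0 := fun h => hε <| by
  simpa [faceLift] using congrArg (fun x : Ed (n + 1) => x i) h

theorem smul_faceLift {n : ℕ} (i : Fin (n + 1)) (ε t : ℝ) (y : Fin n → ℝ) :
    t • faceLift i ε y = faceLift i (t * ε) (t • y) := by
  ext j
  induction j using i.succAboveCases with
  | x => simp [faceLift]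
  | p j => simp [faceLift]

theorem lintegral_faceLift {n : ℕ} (i : Fin (n + 1)) {g : Ed (n + 1) → ℝ≥0∞}
    (hg : Measurable g) :
    ∫⁻ t : ℝ, ∫⁻ y, g (faceLift i t y) = ∫⁻ x, g x := by
  have h := (PiLp.volume_preserving_toLp (Fin (n + 1))).comp
    (volume_preserving_piFinSuccAbove (fun _ : Fin (n + 1) => ℝ) i).symm
  rw [← h.lintegral_comp hg, Measure.volume_eq_prod]
  exact (lintegral_prod _ (hg.comp h.measurable).aemeasurable).symm

/-- Integration over a cone based on a face of the cube, in the coordinates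
`(y, t) ↦ t • faceLift i ε y`. -/
theorem lintegral_cone_le {n : ℕ} (i : Fin (n + 1)) {ε : ℝ} (hε : |ε| = 1)
    {g : Ed (n + 1) → ℝ≥0∞} (hg : Measurable g) :
    ∫⁻ y, ∫⁻ t in Ioi (0 : ℝ), ENNReal.ofReal (t ^ n) * g (t • faceLift i ε y) ≤
      ∫⁻ x, g x := by
  have hlift : Measurable fun q : ℝ × (Fin n → ℝ) => q.1 • faceLift i ε q.2 :=
    measurable_fst.smul ((contDiff_faceLift i ε).continuous.measurable.comp measurable_snd)
  rw [lintegral_lintegral_swap (by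
    refine Measurable.aemeasurable ?_
    exact (measurable_snd.pow_const n).ennreal_ofReal.mul (hg.comp (hlift.comp measurable_swap)))]
  have hmeas (t : ℝ) : Measurable fun y => g (faceLift i t y) :=
    hg.comp (contDiff_faceLift i t).continuous.measurable
  have hscale (t : ℝ) (ht : t ∈ Ioi (0 : ℝ)) :
      ∫⁻ y, ENNReal.ofReal (t ^ n) * g (t • faceLift i ε y) =
        ∫⁻ y, g (faceLift i (t * ε) y) := by
    have ht : 0 < t := ht
    simp_rw [smul_faceLift]
    rw [lintegral_const_mul' _ _ ENNReal.ofReal_ne_top,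
      ← lintegral_map (hmeas (t * ε)) (measurable_const_smul t),
      Measure.map_addHaar_smul _ ht.ne', lintegral_smul_measure, smul_eq_mul, ← mul_assoc,
      ← ENNReal.ofReal_mul (by positivity), abs_of_nonneg (by positivity)]
    simp [ht.ne']
  rw [setLIntegral_congr_fun measurableSet_Ioi hscale]
  refine (setLIntegral_le_lintegral _ _).trans_eq ?_
  rw [← lintegral_faceLift i hg]
  rcases eq_or_eq_neg_of_abs_eq hε with rfl | rfl
  · simp
  · simpa using! (Measure.measurePreserving_neg (volume : Measure ℝ)).lintegral_comp_emb
      (MeasurableEquiv.neg ℝ).measurableEmbedding fun t : ℝ => ∫⁻ y, g (faceLift i t y)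

/-- The radial projection to the unit sphere of the hyperplane `{x | x i = ε}`. -/
def faceChart {n : ℕ} (i : Fin (n + 1)) (ε : ℝ) (y : Fin n → ℝ) : Ed (n + 1) :=
  ‖faceLift i ε y‖⁻¹ • faceLift i ε y

theorem contDiff_faceChart {n : ℕ} (i : Fin (n + 1)) {ε : ℝ} (hε : ε ≠ 0) :
    ContDiff ℝ 1 (faceChart i ε) :=
  (((contDiff_faceLift i ε).norm ℝ (faceLift_ne_zero i hε)).inv fun y =>
    norm_ne_zero_iff.2 (faceLift_ne_zero i hε y)).smul (contDiff_faceLift i ε)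

/-- The charts `faceChart i (±1)` of the faces of the cube cover the unit sphere. -/
theorem exists_faceChart_eq {n : ℕ} {θ : Ed (n + 1)} (hθ : ‖θ‖ = 1) :
    ∃ i, ∃ ε ∈ ({1, -1} : Finset ℝ), ∃ y ∈ Icc (-1 : Fin n → ℝ) 1, faceChart i ε y = θ := by
  obtain ⟨i, -, hi⟩ := Finset.univ.exists_max_image (fun i => |θ i|) Finset.univ_nonempty
  have hi' : 0 < |θ i| := by
    refine (abs_nonneg _).lt_of_ne fun h => ?_
    have : θ = 0 := by
      ext j
      exact abs_eq_zero.1 (le_antisymm ((hi j (Finset.mem_univ j)).trans h.ge) (abs_nonneg _))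
    simp [this] at hθ
  have hlift : faceLift i (|θ i|⁻¹ * θ i) (fun j => |θ i|⁻¹ * θ (i.succAbove j)) =
      |θ i|⁻¹ • θ := by
    ext j
    induction j using i.succAboveCases with
    | x => simp [faceLift]
    | p j => simp [faceLift]
  refine ⟨i, |θ i|⁻¹ * θ i, ?_, fun j => |θ i|⁻¹ * θ (i.succAbove j), ?_, ?_⟩
  · have : |(|θ i|⁻¹ * θ i)| = 1 := by rw [abs_mul, abs_inv, abs_abs, inv_mul_cancel₀ hi'.ne']
    simpa using eq_or_eq_neg_of_abs_eq this
  · have hle (j) : |(|θ i|⁻¹ * θ (i.succAbove j))| ≤ 1 := by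
      rw [abs_mul, abs_inv, abs_abs, inv_mul_le_one₀ hi']
      exact hi _ (Finset.mem_univ _)
    exact ⟨fun j => (abs_le.1 (hle j)).1, fun j => (abs_le.1 (hle j)).2⟩
  · rw [faceChart, hlift, norm_smul, hθ, norm_inv, Real.norm_eq_abs, abs_abs, mul_one, inv_inv,
      smul_smul, mul_inv_cancel₀ hi'.ne', one_smul]

/-- The surface measure is dominated by the Lebesgue measures of the faces of the cube. -/
theorem hausdorffMeasure_sphere_le (n : ℕ) : ∃ K : Fin (n + 1) → ℝ → ℝ≥0,
    (μH[(n : ℝ)] : Measure (Ed (n + 1))).restrict (sphere 0 1) ≤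
      ∑ i, ∑ ε ∈ ({1, -1} : Finset ℝ),
        K i ε • (volume.restrict (Icc (-1 : Fin n → ℝ) 1)).map (faceChart i ε) := by
  have hK (i : Fin (n + 1)) (ε : ℝ) :
      ∃ K : ℝ≥0, ε ≠ 0 → LipschitzOnWith K (faceChart i ε) (Icc (-1) 1) := by
    by_cases hε : ε = 0
    · exact ⟨0, fun h => absurd hε h⟩
    · obtain ⟨K, hK⟩ := (contDiff_faceChart i hε).contDiffOn.exists_lipschitzOnWith one_ne_zero
        (convex_Icc _ _) isCompact_Icc
      exact ⟨K, fun _ => hK⟩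
  choose K hK using hK
  refine ⟨fun i ε => K i ε ^ (n : ℝ), Measure.le_iff.2 fun s hs => ?_⟩
  have hsub : s ∩ sphere 0 1 ⊆ ⋃ i, ⋃ ε ∈ ({1, -1} : Finset ℝ),
      faceChart i ε '' (faceChart i ε ⁻¹' s ∩ Icc (-1 : Fin n → ℝ) 1) := by
    rintro θ ⟨hθs, hθ⟩
    obtain ⟨i, ε, hε, y, hy, rfl⟩ := exists_faceChart_eq (mem_sphere_zero_iff_norm.1 hθ)
    exact mem_iUnion.2 ⟨i, mem_iUnion₂.2 ⟨ε, hε, y, ⟨hθs, hy⟩, rfl⟩⟩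
  rw [Measure.restrict_apply hs, Measure.finsetSum_apply]
  refine (measure_mono hsub).trans ((measure_iUnion_fintype_le _ _).trans ?_)
  refine Finset.sum_le_sum fun i _ => ?_
  rw [Measure.finsetSum_apply]
  refine (measure_biUnion_finset_le _ _).trans ?_
  refine Finset.sum_le_sum fun ε hε => ?_
  have hε' : ε ≠ 0 := by
    rcases (by simpa using hε : ε = 1 ∨ ε = -1) with rfl | rfl <;> norm_num
  have hm : Measurable (faceChart i ε) := (contDiff_faceChart i hε').continuous.measurable
  refine (((hK i ε hε').mono inter_subset_right).hausdorffMeasure_image_le n.cast_nonneg).trans ?_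
  have hvol : (μH[(n : ℝ)] : Measure (Fin n → ℝ)) = volume := by
    simpa using hausdorffMeasure_pi_real (ι := Fin n)
  rw [hvol, Measure.smul_apply, Measure.map_apply hm hs, Measure.restrict_apply (hm hs),
    ENNReal.smul_def, smul_eq_mul, ENNReal.coe_rpow_of_nonneg _ n.cast_nonneg]

theorem exists_lintegral_faceChart_le {n : ℕ} (i : Fin (n + 1)) {ε : ℝ} (hε : |ε| = 1) :
    ∃ M : ℝ≥0, ∀ v : Ed (n + 1) → ℝ, ContDiff ℝ 1 v → HasCompactSupport v → ∀ r : ℝ, 0 < r →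
      ENNReal.ofReal (r ^ n) * ∫⁻ y in Icc (-1 : Fin n → ℝ) 1, ‖v (r • faceChart i ε y)‖ₑ ≤
        M * ∫⁻ x, ‖fderiv ℝ v x‖ₑ := by
  obtain ⟨M, hM⟩ := (isCompact_Icc (a := (-1 : Fin n → ℝ)) (b := 1)).exists_bound_of_continuousOn
    (contDiff_faceLift i ε).continuous.continuousOn
  have hε' : ε ≠ 0 := by rintro rfl; simp at hε
  refine ⟨(M ^ n).toNNReal * M.toNNReal, fun v hv hv' r hr => ?_⟩
  have hpt (y : Fin n → ℝ) (hy : y ∈ Icc (-1 : Fin n → ℝ) 1) :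
      ENNReal.ofReal (r ^ n) * ‖v (r • faceChart i ε y)‖ₑ ≤
        ((M ^ n).toNNReal * M.toNNReal : ℝ≥0) * ∫⁻ t in Ioi (0 : ℝ),
          ENNReal.ofReal (t ^ n) * ‖fderiv ℝ v (t • faceLift i ε y)‖ₑ := by
    have hw := faceLift_ne_zero i hε' y
    have hw' : 0 < ‖faceLift i ε y‖ := norm_pos_iff.2 hw
    have hr' : ENNReal.ofReal (r ^ n) = ENNReal.ofReal (‖faceLift i ε y‖ ^ n) *
        ENNReal.ofReal ((r * ‖faceLift i ε y‖⁻¹) ^ n) := by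
      rw [← ENNReal.ofReal_mul (by positivity), ← mul_pow, mul_comm r,
        mul_inv_cancel_left₀ hw'.ne']
    rw [faceChart, smul_smul, hr', mul_assoc, ENNReal.coe_mul, mul_assoc]
    refine mul_le_mul' (ENNReal.ofReal_le_ofReal (by gcongr; exact hM y hy)) <|
      (weighted_enorm_le_lintegral_fderiv_ray hv hv' hw (by positivity) n).trans ?_
    gcongr
    rw [← ofReal_norm]
    exact ENNReal.ofReal_le_ofReal (hM y hy)
  rw [← lintegral_const_mul' _ _ ENNReal.ofReal_ne_top]
  refine (setLIntegral_mono' measurableSet_Icc hpt).trans ?_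
  rw [lintegral_const_mul' _ _ ENNReal.coe_ne_top]
  gcongr
  exact (setLIntegral_le_lintegral _ _).trans <|
    lintegral_cone_le i hε (hv.continuous_fderiv one_ne_zero).enorm.measurable

/-- The trace estimate on spheres for `p = 1`. -/
theorem exists_lintegral_sphere_le_lintegral_fderiv (n : ℕ) :
    ∃ C : ℝ≥0, ∀ v : Ed (n + 1) → ℝ, ContDiff ℝ 1 v → HasCompactSupport v → ∀ r : ℝ, 0 < r →
      ENNReal.ofReal (r ^ n) * ∫⁻ θ in sphere (0 : Ed (n + 1)) 1, ‖v (r • θ)‖ₑ ∂μH[(n : ℝ)] ≤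
        C * ∫⁻ x, ‖fderiv ℝ v x‖ₑ := by
  obtain ⟨K, hK⟩ := hausdorffMeasure_sphere_le n
  have hM (i : Fin (n + 1)) (ε : ℝ) : ∃ M : ℝ≥0, |ε| = 1 → ∀ v : Ed (n + 1) → ℝ, ContDiff ℝ 1 v →
      HasCompactSupport v → ∀ r : ℝ, 0 < r →
      ENNReal.ofReal (r ^ n) * ∫⁻ y in Icc (-1 : Fin n → ℝ) 1, ‖v (r • faceChart i ε y)‖ₑ ≤
        M * ∫⁻ x, ‖fderiv ℝ v x‖ₑ := by
    by_cases hε : |ε| = 1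
    · obtain ⟨M, hM⟩ := exists_lintegral_faceChart_le i hε
      exact ⟨M, fun _ => hM⟩
    · exact ⟨0, fun h => absurd h hε⟩
  choose M hM using hM
  refine ⟨∑ i, ∑ ε ∈ ({1, -1} : Finset ℝ), K i ε * M i ε, fun v hv hv' r hr => ?_⟩
  have hmeas : Measurable fun θ : Ed (n + 1) => ‖v (r • θ)‖ₑ :=
    (hv.continuous.comp (continuous_const_smul r)).enorm.measurable
  calc _ ≤ ENNReal.ofReal (r ^ n) * ∫⁻ θ, ‖v (r • θ)‖ₑ ∂(∑ i, ∑ ε ∈ ({1, -1} : Finset ℝ),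
        K i ε • (volume.restrict (Icc (-1 : Fin n → ℝ) 1)).map (faceChart i ε)) := by
        gcongr
    _ = ∑ i, ∑ ε ∈ ({1, -1} : Finset ℝ), ENNReal.ofReal (r ^ n) * (K i ε *
          ∫⁻ θ, ‖v (r • θ)‖ₑ
            ∂(volume.restrict (Icc (-1 : Fin n → ℝ) 1)).map (faceChart i ε)) := by
        simp_rw [lintegral_finsetSum_measure, lintegral_smul_measure, Finset.mul_sum,
          ENNReal.smul_def, smul_eq_mul]
    _ ≤ ∑ i, ∑ ε ∈ ({1, -1} : Finset ℝ), (K i ε * M i ε : ℝ≥0) * ∫⁻ x, ‖fderiv ℝ v x‖ₑ := by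
        refine Finset.sum_le_sum fun i _ => Finset.sum_le_sum fun ε hε => ?_
        have hε' : |ε| = 1 := by
          rcases (by simpa using hε : ε = 1 ∨ ε = -1) with rfl | rfl <;> simp
        have hε0 : ε ≠ 0 := by rintro rfl; simp at hε'
        rw [lintegral_map hmeas (contDiff_faceChart i hε0).continuous.measurable, mul_left_comm,
          ENNReal.coe_mul, mul_assoc]
        exact mul_le_mul' le_rfl (hM i ε hε' v hv hv' r hr)
    _ = _ := by
        push_cast
        simp_rw [Finset.sum_mul]

/-- The trace estimate on spheres, before taking roots: apply the case `p = 1` to `|u| ^ β`, then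
use Hölder's inequality and the Gagliardo-Nirenberg-Sobolev inequality. -/
theorem exists_lintegral_rpow_sphere_le (n : ℕ) {p : ℝ} (hp : 1 ≤ p) (hpn : p < n + 1) {β : ℝ}
    (hβ : β = n * p / (n + 1 - p)) :
    ∃ C : ℝ≥0, ∀ u : Ed (n + 1) → ℝ, ContDiff ℝ 1 u → HasCompactSupport u → ∀ r : ℝ, 0 < r →
      ENNReal.ofReal (r ^ n) *
          ∫⁻ θ in sphere (0 : Ed (n + 1)) 1, ‖u (r • θ)‖ₑ ^ β ∂μH[(n : ℝ)] ≤
        C * ((∫⁻ x, ‖fderiv ℝ u x‖ₑ ^ p) ^ (1 / p)) ^ β := by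
  obtain ⟨C, hC⟩ := exists_lintegral_sphere_le_lintegral_fderiv n
  have hd : 0 < n + 1 - p := sub_pos.2 hpn
  rcases hp.eq_or_lt with rfl | hp1
  · have hβ1 : β = 1 := by
      rw [hβ, add_sub_cancel_right, mul_one, div_self]
      linarith
    exact ⟨C, fun u hu hu' r hr => by simpa [hβ1] using hC u hu hu' r hr⟩
  have hp0 : 0 < p := by linarith
  have hβsub : β - 1 = (n + 1) * (p - 1) / (n + 1 - p) := by
    rw [hβ]; field_simp; ring
  have hβ1 : 1 < β := by
    have : 0 < β - 1 := by rw [hβsub]; have := sub_pos.2 hp1; positivity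
    linarith
  have hpq : p.HolderConjugate p.conjExponent := .conjExponent hp1
  set q := p.conjExponent with hq
  have hq' : q = p / (p - 1) := rfl
  set s : ℝ := (n + 1) * p / (n + 1 - p) with hs
  have hs0 : 0 < s := by positivity
  have hsq : (β - 1) * q = s := by
    have := (sub_pos.2 hp1).ne'
    rw [hβsub, hq', hs]; field_simp
  let P : ℝ≥0 := ⟨p, hp0.le⟩
  let S : ℝ≥0 := ⟨s, hs0.le⟩
  have hP0 : P ≠ 0 := fun h => hp0.ne' (congrArg NNReal.toReal h)
  have hS0 : S ≠ 0 := fun h => hs0.ne' (congrArg NNReal.toReal h)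
  let b : ℝ≥0 := ⟨β, by linarith⟩
  let D := SNormLESNormFDerivOfEqConst ℝ (volume : Measure (Ed (n + 1))) P
  refine ⟨C * (b * D ^ (β - 1)), fun u hu hu' r hr => ?_⟩
  set A := (∫⁻ x, ‖fderiv ℝ u x‖ₑ ^ p) ^ (1 / p) with hA
  set B := ∫⁻ x, ‖u x‖ₑ ^ s with hB
  have hsob : B ^ (1 / s) ≤ D * A := by
    have h := eLpNorm_le_eLpNorm_fderiv_of_eq (volume : Measure (Ed (n + 1))) hu hu'
      (p := P) (p' := S) hp (by simp) (by
        have : (n : ℝ) + 1 ≠ 0 := by positivity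
        change s⁻¹ = p⁻¹ - _
        simp only [finrank_euclideanSpace, Fintype.card_fin, hs]
        push_cast
        field_simp)
    rwa [eLpNorm_nnreal_eq_lintegral hS0, eLpNorm_nnreal_eq_lintegral hP0] at h
  have hBq : B ^ (1 / q) ≤ D ^ (β - 1) * A ^ (β - 1) := by
    have : 1 / q = 1 / s * (β - 1) := by
      rw [← hsq]; field_simp [(sub_pos.2 hβ1).ne']
    rw [this, ENNReal.rpow_mul, ← ENNReal.mul_rpow_of_nonneg _ _ (by linarith)]
    gcongr
  have hv : ContDiff ℝ 1 fun x => ‖u x‖ ^ β := hu.norm_rpow hβ1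
  have hv' : HasCompactSupport fun x => ‖u x‖ ^ β :=
    hu'.comp_left (g := fun t : ℝ => ‖t‖ ^ β) (by simp [(zero_lt_one.trans hβ1).ne'])
  have henorm (x : Ed (n + 1)) : ‖‖u x‖ ^ β‖ₑ = ‖u x‖ₑ ^ β := by
    rw [Real.enorm_rpow_of_nonneg (norm_nonneg _) (by linarith), enorm_norm]
  have hmeas : Measurable fun x => ‖fderiv ℝ u x‖ₑ :=
    (hu.continuous_fderiv one_ne_zero).enorm.measurable
  have hmeas' : Measurable fun x => ‖u x‖ₑ ^ (β - 1) :=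
    hu.continuous.enorm.measurable.pow_const _
  calc ENNReal.ofReal (r ^ n) *
          ∫⁻ θ in sphere (0 : Ed (n + 1)) 1, ‖u (r • θ)‖ₑ ^ β ∂μH[(n : ℝ)]
      ≤ C * ∫⁻ x, ‖fderiv ℝ (fun x => ‖u x‖ ^ β) x‖ₑ := by
        simpa only [henorm] using hC _ hv hv' r hr
    _ ≤ C * ∫⁻ x, b * (‖fderiv ℝ u x‖ₑ * ‖u x‖ₑ ^ (β - 1)) := by
        gcongr with x
        refine (enorm_fderiv_norm_rpow_le (p := b) (hu.differentiable one_ne_zero) hβ1).trans_eq ?_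
        rw [mul_assoc, mul_comm (‖u x‖ₑ ^ _)]
        rfl
    _ = C * (b * ∫⁻ x, ‖fderiv ℝ u x‖ₑ * ‖u x‖ₑ ^ (β - 1)) := by
        rw [lintegral_const_mul' _ _ ENNReal.coe_ne_top]
    _ ≤ C * (b * (A * B ^ (1 / q))) := by
        gcongr
        refine (ENNReal.lintegral_mul_le_Lp_mul_Lq volume hpq hmeas.aemeasurable
          hmeas'.aemeasurable).trans_eq ?_
        simp_rw [← ENNReal.rpow_mul, hsq, hA, hB]
    _ ≤ C * (b * (A * (D ^ (β - 1) * A ^ (β - 1)))) := by gcongr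
    _ = (C * (b * D ^ (β - 1)) : ℝ≥0) * A ^ β := by
        have : A ^ β = A * A ^ (β - 1) := by
          have h := ENNReal.rpow_add_of_nonneg (x := A) 1 (β - 1) zero_le_one (by linarith)
          rwa [add_sub_cancel, ENNReal.rpow_one] at h
        rw [this, ENNReal.coe_mul, ENNReal.coe_mul, ENNReal.coe_rpow_of_nonneg _ (by linarith)]
        ring

end

/-- Trace estimate in polar coordinates (Nakanishi): for `1 ≤ p < d`,
`β = (d-1)p/(d-p)`, `ν = (d-p)/p`, one has
`r^ν ‖u(r·)‖_{L^β(S^{d-1})} ≤ C(d,p) ‖∇u‖_{L^p(ℝ^d)}` for all `r > 0` and `u ∈ C¹_c`.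
The surface measure on the unit sphere is the `(d-1)`-dimensional Hausdorff measure. -/
theorem stmt4 (d : ℕ) (hd : 2 ≤ d) (p : ℝ) (hp1 : 1 ≤ p) (hpd : p < d) :
    ∃ C : ℝ, 0 < C ∧
      ∀ u : Ed d → ℝ, ContDiff ℝ 1 u → HasCompactSupport u →
      ∀ r : ℝ, 0 < r →
        ENNReal.ofReal (r ^ (((d : ℝ) - p) / p))
          * (∫⁻ θ in Metric.sphere (0 : Ed d) 1,
              ENNReal.ofReal (|u (r • θ)| ^ (((d : ℝ) - 1) * p / ((d : ℝ) - p)))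
                ∂(μH[(d : ℝ) - 1])) ^ (1 / (((d : ℝ) - 1) * p / ((d : ℝ) - p)))
          ≤ ENNReal.ofReal C
            * (∫⁻ x : Ed d, ENNReal.ofReal (‖gradient u x‖ ^ p)) ^ (1 / p) := by
  obtain ⟨n, rfl⟩ : ∃ n, d = n + 1 := ⟨d - 1, by omega⟩
  have hn : (0 : ℝ) < n := by exact_mod_cast (by omega : 0 < n)
  push_cast at hpd ⊢
  rw [add_sub_cancel_right]
  have hd' : 0 < (n : ℝ) + 1 - p := sub_pos.2 hpd
  have hp0 : 0 < p := by linarith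
  set β : ℝ := n * p / (n + 1 - p) with hβ
  have hβ0 : 0 < β := by positivity
  obtain ⟨C, hC⟩ := exists_lintegral_rpow_sphere_le n hp1 hpd hβ
  refine ⟨(C : ℝ) ^ (1 / β) + 1, by positivity, fun u hu hu' r hr => ?_⟩
  have hu_rpow (x : Ed (n + 1)) : ENNReal.ofReal (|u x| ^ β) = ‖u x‖ₑ ^ β := by
    rw [← ENNReal.ofReal_rpow_of_nonneg (abs_nonneg _) hβ0.le, ← Real.norm_eq_abs, ofReal_norm]
  have hgrad (x : Ed (n + 1)) : ENNReal.ofReal (‖gradient u x‖ ^ p) = ‖fderiv ℝ u x‖ₑ ^ p := by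
    rw [gradient, LinearIsometryEquiv.norm_map,
      ← ENNReal.ofReal_rpow_of_nonneg (norm_nonneg _) hp0.le, ofReal_norm]
  have hr_rpow : ENNReal.ofReal (r ^ (((n : ℝ) + 1 - p) / p)) =
      ENNReal.ofReal (r ^ n) ^ (1 / β) := by
    rw [ENNReal.ofReal_rpow_of_nonneg (by positivity) (by positivity), ← Real.rpow_natCast,
      ← Real.rpow_mul hr.le]
    congr 2
    rw [hβ]
    field_simp
  simp_rw [hu_rpow, hgrad]
  rw [hr_rpow, ← ENNReal.mul_rpow_of_nonneg _ _ (by positivity)]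
  calc _ ≤ (C * ((∫⁻ x, ‖fderiv ℝ u x‖ₑ ^ p) ^ (1 / p)) ^ β) ^ (1 / β) :=
        ENNReal.rpow_le_rpow (hC u hu hu' r hr) (by positivity)
    _ = ENNReal.ofReal ((C : ℝ) ^ (1 / β)) * (∫⁻ x, ‖fderiv ℝ u x‖ₑ ^ p) ^ (1 / p) := by
        rw [ENNReal.mul_rpow_of_nonneg _ _ (by positivity), ← ENNReal.rpow_mul _ β,
          mul_one_div_cancel hβ0.ne', ENNReal.rpow_one,
          ← ENNReal.ofReal_rpow_of_nonneg C.coe_nonneg (by positivity), ENNReal.ofReal_coe_nnreal]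
    _ ≤ _ := by
        gcongr
        linarith
end
end

section
/- Let d ≥ 2, 1 ≤ p < d, β = (d−1)p/(d−p) and ν = (d−p)/p. Then there exists a constant C depending only on d and p such that for every C¹ function u : ℝ^d → ℝ with compact support, ( ∫_{S^{d−1}} ( sup_{r>0} r^ν |u(rθ)| )^β dσ(θ) )^{1/β} ≤ C · ( ∫_{ℝ^d} |∇u(x)|^p dx )^{1/p}. -/
open MeasureTheory
open scoped ENNReal

noncomputable section

open Set Module
open scoped NNReal

theorem lintegral_Ioi_eq_comp_mul_left {a : ℝ} (ha : 0 < a) (f : ℝ → ℝ≥0∞) :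
    ∫⁻ s in Ioi 0, f s = ENNReal.ofReal a * ∫⁻ t in Ioi 0, f (a * t) := by
  have himg : (fun t : ℝ => a * t) '' Ioi 0 = Ioi 0 := by
    rw [Set.image_mul_left_Ioi ha, mul_zero]
  have h := lintegral_image_eq_lintegral_abs_deriv_mul (s := Ioi (0 : ℝ)) (f := fun t => a * t)
    (f' := fun _ => a) measurableSet_Ioi
    (fun x _ => by simpa using ((hasDerivAt_id x).const_mul a).hasDerivWithinAt)
    (mul_right_injective₀ ha.ne').injOn f
  rw [himg] at h
  rw [h, lintegral_const_mul' _ _ ENNReal.ofReal_ne_top, abs_of_pos ha]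

theorem ofReal_pow_mul_lintegral_comp_smul {n : ℕ} {t : ℝ} (ht : 0 < t)
    {f : (Fin n → ℝ) → ℝ≥0∞} (hf : Measurable f) :
    ENNReal.ofReal (t ^ n) * ∫⁻ y, f (t • y) = ∫⁻ y, f y := by
  rw [← lintegral_map hf (measurable_const_smul t), Measure.map_addHaar_smul _ ht.ne',
    lintegral_smul_measure, finrank_fin_fun, abs_of_pos (by positivity), smul_eq_mul, ← mul_assoc,
    ← ENNReal.ofReal_mul (by positivity), mul_inv_cancel₀ (by positivity), ENNReal.ofReal_one,
    one_mul]

theorem setLIntegral_image_hausdorffMeasure_le {X Y : Type*} [MetricSpace X] [MeasurableSpace X]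
    [BorelSpace X] [MetricSpace Y] [MeasurableSpace Y] [BorelSpace Y] {L : ℝ≥0} {f : X → Y}
    (hf : LipschitzWith L f) {s : ℝ} (hs : 0 ≤ s) (K : Set X) {F : Y → ℝ≥0∞} (hF : Measurable F) :
    ∫⁻ y in f '' K, F y ∂μH[s] ≤ (L : ℝ≥0∞) ^ s * ∫⁻ x in K, F (f x) ∂μH[s] := by
  have hfm : Measurable f := hf.continuous.measurable
  have hle : (μH[s] : Measure Y).restrict (f '' K) ≤
      ((L : ℝ≥0∞) ^ s) • ((μH[s] : Measure X).restrict K).map f := by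
    refine Measure.le_iff.2 fun A hA => ?_
    rw [Measure.restrict_apply hA, Measure.smul_apply, Measure.map_apply hfm hA,
      Measure.restrict_apply (hfm hA), Set.inter_comm, ← Set.image_inter_preimage, Set.inter_comm,
      smul_eq_mul]
    exact hf.hausdorffMeasure_image_le hs _
  calc _ ≤ ∫⁻ y, F y ∂(((L : ℝ≥0∞) ^ s) • ((μH[s] : Measure X).restrict K).map f) :=
        lintegral_mono' hle le_rfl
    _ = _ := by rw [lintegral_smul_measure, lintegral_map hF hfm, smul_eq_mul]

/-- The point of `ℝ^{n+1}` with `i`-th coordinate `a` and remaining coordinates `y`. -/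
def insertCoord {n : ℕ} (i : Fin (n + 1)) (a : ℝ) (y : Fin n → ℝ) : Ed (n + 1) :=
  WithLp.toLp 2 (i.insertNth (α := fun _ => ℝ) a y)

theorem continuous_insertCoord {n : ℕ} (i : Fin (n + 1)) :
    Continuous fun q : ℝ × (Fin n → ℝ) => insertCoord i q.1 q.2 :=
  (PiLp.continuous_toLp 2 _).comp (Continuous.finInsertNth i continuous_fst continuous_snd)

theorem smul_insertCoord {n : ℕ} (i : Fin (n + 1)) (t a : ℝ) (y : Fin n → ℝ) :
    t • insertCoord i a y = insertCoord i (t * a) (t • y) := by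
  ext j
  refine Fin.succAboveCases i ?_ (fun k => ?_) j <;> simp [insertCoord]

theorem lipschitzWith_insertCoord {n : ℕ} (i : Fin (n + 1)) (a : ℝ) :
    LipschitzWith (((n + 1 : ℕ) : ℝ≥0) ^ (1 / 2 : ℝ)) (insertCoord i a) := by
  have h := PiLp.lipschitzWith_toLp 2 (fun _ : Fin (n + 1) => ℝ)
  have h2 : LipschitzWith 1 fun y : Fin n → ℝ => i.insertNth (α := fun _ => ℝ) a y :=
    LipschitzWith.of_dist_le_mul fun y z => by simp [Fin.dist_insertNth_insertNth]
  simpa [insertCoord, Function.comp_def] using! h.comp h2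

theorem norm_insertCoord_le {n : ℕ} (i : Fin (n + 1)) {a : ℝ} (ha : |a| ≤ 1) {y : Fin n → ℝ}
    (hy : ‖y‖ ≤ 1) : ‖insertCoord i a y‖ ≤ ((n + 1 : ℕ) : ℝ) ^ (1 / 2 : ℝ) := by
  have h := (PiLp.lipschitzWith_toLp 2 (fun _ : Fin (n + 1) => ℝ)).dist_le_mul
    (i.insertNth (α := fun _ => ℝ) a y) 0
  have h2 : ‖i.insertNth (α := fun _ => ℝ) a y‖ ≤ 1 := by
    refine (pi_norm_le_iff_of_nonneg zero_le_one).2 fun j => ?_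
    refine Fin.succAboveCases i ?_ (fun k => ?_) j
    · simpa using ha
    · simpa using (norm_le_pi_norm y k).trans hy
  simp only [dist_zero_right, WithLp.toLp_zero, Fintype.card_fin] at h
  refine h.trans ?_
  refine (mul_le_of_le_one_right (by positivity) h2).trans (le_of_eq ?_)
  simp

theorem abs_le_norm_insertCoord {n : ℕ} (i : Fin (n + 1)) (a : ℝ) (y : Fin n → ℝ) :
    |a| ≤ ‖insertCoord i a y‖ := by
  simpa [insertCoord] using PiLp.norm_apply_le (insertCoord i a y) i

theorem norm_inv_smul_sub_inv_smul_le {E : Type*} [NormedAddCommGroup E] [NormedSpace ℝ E]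
    {x y : E} (hx : 1 ≤ ‖x‖) (hy : 1 ≤ ‖y‖) :
    ‖‖x‖⁻¹ • x - ‖y‖⁻¹ • y‖ ≤ 2 * ‖x - y‖ := by
  have hx0 : 0 < ‖x‖ := by linarith
  have hy0 : 0 < ‖y‖ := by linarith
  have h1 : ‖x‖⁻¹ • x - ‖y‖⁻¹ • y = ‖x‖⁻¹ • (x - y) + (‖x‖⁻¹ * (‖y‖ - ‖x‖) * ‖y‖⁻¹) • y := by
    have : ‖x‖⁻¹ * (‖y‖ - ‖x‖) * ‖y‖⁻¹ = ‖x‖⁻¹ - ‖y‖⁻¹ := by field_simp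
    rw [this]
    module
  rw [h1]
  refine (norm_add_le _ _).trans ?_
  rw [norm_smul, norm_smul, norm_mul, norm_mul, norm_inv, norm_inv, norm_norm, norm_norm, mul_assoc,
    inv_mul_cancel₀ hy0.ne', mul_one, ← mul_add, Real.norm_eq_abs]
  have h2 : |‖y‖ - ‖x‖| ≤ ‖x - y‖ := by
    rw [abs_sub_comm]; exact abs_norm_sub_norm_le x y
  have h3 : ‖x‖⁻¹ ≤ 1 := inv_le_one_of_one_le₀ hx
  calc ‖x‖⁻¹ * (‖x - y‖ + |‖y‖ - ‖x‖|) ≤ 1 * (‖x - y‖ + ‖x - y‖) := by gcongr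
    _ = _ := by ring

/-- The central projection of the affine hyperplane `{x | x i = a}` onto the unit sphere. -/
def sphereChart {n : ℕ} (i : Fin (n + 1)) (a : ℝ) (y : Fin n → ℝ) : Ed (n + 1) :=
  ‖insertCoord i a y‖⁻¹ • insertCoord i a y

theorem lipschitzWith_sphereChart {n : ℕ} (i : Fin (n + 1)) {a : ℝ} (ha : |a| = 1) :
    LipschitzWith (2 * ((n + 1 : ℕ) : ℝ≥0) ^ (1 / 2 : ℝ)) (sphereChart i a) := by
  refine LipschitzWith.of_dist_le_mul fun y z => ?_
  rw [dist_eq_norm, sphereChart, sphereChart]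
  refine (norm_inv_smul_sub_inv_smul_le (ha ▸ abs_le_norm_insertCoord i a y)
    (ha ▸ abs_le_norm_insertCoord i a z)).trans ?_
  rw [← dist_eq_norm, NNReal.coe_mul, mul_assoc]
  exact mul_le_mul_of_nonneg_left ((lipschitzWith_insertCoord i a).dist_le_mul y z) (by norm_num)

theorem sphere_subset_iUnion_image_sphereChart (n : ℕ) :
    Metric.sphere (0 : Ed (n + 1)) 1 ⊆
      ⋃ q : Fin (n + 1) × ℤˣ, sphereChart q.1 ((q.2 : ℤ) : ℝ) '' Metric.closedBall 0 1 := by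
  intro θ hθ
  have hθ1 : ‖θ‖ = 1 := by simpa using hθ
  obtain ⟨i, hi⟩ := Finite.exists_max fun j => |θ j|
  have hpos : 0 < |θ i| := by
    refine lt_of_le_of_ne (abs_nonneg _) fun h0 => ?_
    have : θ = 0 := by
      ext j
      simpa using (hi j).trans h0.symm.le
    simp [this] at hθ1
  obtain ⟨e, he⟩ : ∃ e : ℤˣ, ((e : ℤ) : ℝ) = |θ i|⁻¹ * θ i := by
    rcases lt_or_gt_of_ne (abs_pos.1 hpos) with h | h
    · exact ⟨-1, by rw [abs_of_neg h]; simp [inv_neg, h.ne]⟩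
    · exact ⟨1, by rw [abs_of_pos h]; simp [h.ne']⟩
  have hx : insertCoord i ((e : ℤ) : ℝ) (fun k => |θ i|⁻¹ * θ (i.succAbove k)) = |θ i|⁻¹ • θ := by
    ext j
    refine Fin.succAboveCases i ?_ (fun k => ?_) j
    · simp [insertCoord, he]
    · simp [insertCoord]
  refine mem_iUnion.2 ⟨(i, e), fun k => |θ i|⁻¹ * θ (i.succAbove k), ?_, ?_⟩
  · rw [mem_closedBall_zero_iff, pi_norm_le_iff_of_nonneg zero_le_one]
    intro k
    rw [norm_mul, norm_inv, Real.norm_eq_abs, Real.norm_eq_abs, abs_abs]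
    exact (inv_mul_le_one₀ hpos).2 (hi _)
  · simp only [sphereChart, hx, norm_smul, norm_inv, Real.norm_eq_abs, abs_abs, hθ1, mul_one,
      inv_inv, smul_smul, mul_inv_cancel₀ hpos.ne', one_smul]

theorem lintegral_lintegral_insertCoord {n : ℕ} (i : Fin (n + 1)) {h : Ed (n + 1) → ℝ≥0∞}
    (hh : Measurable h) : ∫⁻ t, ∫⁻ y, h (insertCoord i t y) = ∫⁻ x, h x := by
  have hm : Measurable fun q : ℝ × (Fin n → ℝ) => h (insertCoord i q.1 q.2) :=
    hh.comp (continuous_insertCoord i).measurable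
  rw [lintegral_lintegral hm.aemeasurable,
    ← (PiLp.volume_preserving_toLp (Fin (n + 1))).lintegral_comp hh,
    ← ((volume_preserving_piFinSuccAbove (fun _ : Fin (n + 1) => ℝ) i).symm _).lintegral_comp
      (f := fun v => h (WithLp.toLp 2 v)) (hh.comp (PiLp.continuous_toLp 2 _).measurable)]
  rfl

theorem lintegral_lintegral_cone_le {n : ℕ} (i : Fin (n + 1)) {a : ℝ} (ha : |a| = 1)
    {h : Ed (n + 1) → ℝ≥0∞} (hh : Measurable h) :
    ∫⁻ y, ∫⁻ t in Ioi 0, ENNReal.ofReal (t ^ n) * h (t • insertCoord i a y) ≤ ∫⁻ x, h x := by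
  have hm : Measurable fun q : ℝ × (Fin n → ℝ) => h (insertCoord i q.1 q.2) :=
    hh.comp (continuous_insertCoord i).measurable
  have ha0 : a ≠ 0 := by rintro rfl; simp at ha
  calc _ = ∫⁻ t in Ioi 0, ∫⁻ y, ENNReal.ofReal (t ^ n) * h (insertCoord i (t * a) (t • y)) := by
        simp_rw [smul_insertCoord]
        refine lintegral_lintegral_swap (Measurable.aemeasurable ?_)
        refine Measurable.mul (by fun_prop)
          (hm.comp (f := fun q : (Fin n → ℝ) × ℝ => (q.2 * a, q.2 • q.1)) (by fun_prop))
    _ = ∫⁻ t in Ioi 0, ∫⁻ y, h (insertCoord i (t * a) y) := by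
        refine setLIntegral_congr_fun measurableSet_Ioi fun t ht => ?_
        have hmt : Measurable fun y => h (insertCoord i (t * a) y) :=
          hm.comp (measurable_const.prodMk measurable_id)
        rw [lintegral_const_mul' _ _ ENNReal.ofReal_ne_top,
          ofReal_pow_mul_lintegral_comp_smul ht hmt]
    _ ≤ ∫⁻ t, ∫⁻ y, h (insertCoord i (t * a) y) := setLIntegral_le_lintegral _ _
    _ = ∫⁻ t, ∫⁻ y, h (insertCoord i t y) := by
        have hg : Measurable fun t => ∫⁻ y, h (insertCoord i t y) := hm.lintegral_prod_right'
        rw [← lintegral_map (f := fun t => ∫⁻ y, h (insertCoord i t y)) hg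
          (measurable_mul_const a)]
        have := Real.map_volume_mul_right ha0
        rw [this]
        simp [abs_inv, ha]
    _ = _ := lintegral_lintegral_insertCoord i hh

theorem setLIntegral_sphereChart_le {n : ℕ} (i : Fin (n + 1)) {a : ℝ} (ha : |a| = 1)
    {h : Ed (n + 1) → ℝ≥0∞} (hh : Measurable h) :
    ∫⁻ y in Metric.closedBall 0 1,
        ∫⁻ s in Ioi 0, ENNReal.ofReal (s ^ n) * h (s • sphereChart i a y) ≤
      ENNReal.ofReal ((((n + 1 : ℕ) : ℝ) ^ (1 / 2 : ℝ)) ^ (n + 1)) * ∫⁻ x, h x := by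
  set B : ℝ := ((n + 1 : ℕ) : ℝ) ^ (1 / 2 : ℝ)
  calc _ ≤ ∫⁻ y in Metric.closedBall 0 1, ENNReal.ofReal (B ^ (n + 1)) *
          ∫⁻ t in Ioi 0, ENNReal.ofReal (t ^ n) * h (t • insertCoord i a y) := by
        refine setLIntegral_mono' Metric.isClosed_closedBall.measurableSet fun y hy => ?_
        have hN : 0 < ‖insertCoord i a y‖ :=
          zero_lt_one.trans_le (ha ▸ abs_le_norm_insertCoord i a y)
        have hNB : ‖insertCoord i a y‖ ≤ B :=
          norm_insertCoord_le i ha.le (mem_closedBall_zero_iff.1 hy)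
        rw [lintegral_Ioi_eq_comp_mul_left hN,
          ← lintegral_const_mul' _ _ ENNReal.ofReal_ne_top,
          ← lintegral_const_mul' _ _ ENNReal.ofReal_ne_top]
        refine setLIntegral_mono' measurableSet_Ioi fun t ht => ?_
        have ht0 : (0 : ℝ) < t := ht
        have hsm : (‖insertCoord i a y‖ * t) • sphereChart i a y = t • insertCoord i a y := by
          rw [sphereChart, smul_smul, mul_right_comm, mul_inv_cancel₀ hN.ne', one_mul]
        rw [hsm, ← mul_assoc, ← mul_assoc, ← ENNReal.ofReal_mul hN.le,
          ← ENNReal.ofReal_mul (by positivity)]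
        refine mul_le_mul_left (ENNReal.ofReal_le_ofReal ?_) _
        calc ‖insertCoord i a y‖ * (‖insertCoord i a y‖ * t) ^ n
            = ‖insertCoord i a y‖ ^ (n + 1) * t ^ n := by ring
          _ ≤ _ := by gcongr
    _ ≤ ENNReal.ofReal (B ^ (n + 1)) *
          ∫⁻ y, ∫⁻ t in Ioi 0, ENNReal.ofReal (t ^ n) * h (t • insertCoord i a y) := by
        rw [lintegral_const_mul' _ _ ENNReal.ofReal_ne_top]
        gcongr
        exact Measure.restrict_le_self
    _ ≤ _ := by gcongr; exact lintegral_lintegral_cone_le i ha hh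

/-- Integration in polar coordinates, with the Hausdorff measure on the sphere, is controlled by
integration over the whole space. -/
theorem exists_lintegral_sphere_le (n : ℕ) :
    ∃ C : ℝ≥0, ∀ h : Ed (n + 1) → ℝ≥0∞, Measurable h →
      ∫⁻ θ in Metric.sphere (0 : Ed (n + 1)) 1,
        (∫⁻ s in Ioi 0, ENNReal.ofReal (s ^ n) * h (s • θ)) ∂μH[(n : ℝ)] ≤ C * ∫⁻ x, h x := by
  set L : ℝ≥0 := 2 * ((n + 1 : ℕ) : ℝ≥0) ^ (1 / 2 : ℝ)
  set B : ℝ := (((n + 1 : ℕ) : ℝ) ^ (1 / 2 : ℝ)) ^ (n + 1)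
  refine ⟨∑ q : Fin (n + 1) × ℤˣ, L ^ (n : ℝ) * B.toNNReal, fun h hh => ?_⟩
  set F : Ed (n + 1) → ℝ≥0∞ := fun θ => ∫⁻ s in Ioi 0, ENNReal.ofReal (s ^ n) * h (s • θ)
  have hF : Measurable F := by
    refine Measurable.lintegral_prod_right' (f := fun q : Ed (n + 1) × ℝ =>
      ENNReal.ofReal (q.2 ^ n) * h (q.2 • q.1)) ?_
    exact Measurable.mul (by fun_prop) (hh.comp (by fun_prop))
  have hvol : (μH[(n : ℝ)] : Measure (Fin n → ℝ)) = volume := by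
    simpa using hausdorffMeasure_pi_real (ι := Fin n)
  calc _ ≤ ∑' q : Fin (n + 1) × ℤˣ,
          ∫⁻ θ in sphereChart q.1 ((q.2 : ℤ) : ℝ) '' Metric.closedBall 0 1, F θ ∂μH[(n : ℝ)] :=
        (lintegral_mono_set (sphere_subset_iUnion_image_sphereChart n)).trans
          (lintegral_iUnion_le _ _)
    _ = ∑ q : Fin (n + 1) × ℤˣ,
          ∫⁻ θ in sphereChart q.1 ((q.2 : ℤ) : ℝ) '' Metric.closedBall 0 1, F θ ∂μH[(n : ℝ)] :=
        tsum_fintype _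
    _ ≤ ∑ q : Fin (n + 1) × ℤˣ, ((L ^ (n : ℝ) * B.toNNReal : ℝ≥0) : ℝ≥0∞) * ∫⁻ x, h x := by
        refine Finset.sum_le_sum fun q _ => ?_
        have hq : |((q.2 : ℤ) : ℝ)| = 1 := by
          rcases Int.units_eq_one_or q.2 with h | h <;> simp [h]
        refine (setLIntegral_image_hausdorffMeasure_le (lipschitzWith_sphereChart q.1 hq)
          n.cast_nonneg _ hF).trans ?_
        rw [hvol, ENNReal.coe_mul (L ^ (n : ℝ)), ENNReal.coe_rpow_of_nonneg _ n.cast_nonneg, mul_assoc]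
        gcongr
        exact setLIntegral_sphereChart_le q.1 hq hh
    _ = _ := by rw [← Finset.sum_mul, ENNReal.ofNNReal_finsetSum]

theorem HasCompactSupport.enorm_le_lintegral_Ici_fderiv_smul {E : Type*} [NormedAddCommGroup E]
    [NormedSpace ℝ E] {v : E → ℝ} (hv : ContDiff ℝ 1 v) (hc : HasCompactSupport v) {θ : E}
    (hθ : ‖θ‖ = 1) (r : ℝ) :
    ‖v (r • θ)‖ₑ ≤ ∫⁻ s in Ici r, ‖fderiv ℝ v (s • θ)‖ₑ := by
  have hθ0 : -θ ≠ 0 := by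
    rw [neg_ne_zero]
    rintro rfl
    simp at hθ
  have hf : ContDiff ℝ 1 fun s : ℝ => v (s • -θ) := by fun_prop
  have hfc : HasCompactSupport fun s : ℝ => v (s • -θ) :=
    hc.comp_isClosedEmbedding (isClosedEmbedding_smul_left hθ0)
  have h := hfc.enorm_le_lintegral_Ici_deriv hf (-r)
  simp only [smul_neg, neg_smul, neg_neg] at h
  refine h.trans ?_
  have hpre : (fun s : ℝ => -s) ⁻¹' Ici r = Iic (-r) := by
    ext s
    simp
  rw [← (Measure.measurePreserving_neg (volume : Measure ℝ)).setLIntegral_comp_preimage_emb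
    (MeasurableEquiv.neg ℝ).measurableEmbedding _ (Ici r), hpre]
  refine lintegral_mono fun s => ?_
  have hd : HasDerivAt (fun s : ℝ => v (-(s • θ))) (fderiv ℝ v (-(s • θ)) (-θ)) s := by
    have h1 : HasDerivAt (fun s : ℝ => -(s • θ)) (-θ) s := by
      simpa using! ((hasDerivAt_id s).smul_const θ).neg
    exact ((hv.differentiable one_ne_zero _).hasFDerivAt).comp_hasDerivAt s h1
  rw [hd.deriv, neg_smul]
  refine (ContinuousLinearMap.le_opENorm _ _).trans (le_of_eq ?_)
  rw [enorm_neg, ← ofReal_norm (x := θ), hθ, ENNReal.ofReal_one, mul_one]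

theorem exists_contDiff_enorm_eq_rpow {E : Type*} [NormedAddCommGroup E] [NormedSpace ℝ E]
    {b : ℝ≥0} (hb : 1 ≤ b) {u : E → ℝ} (hu : ContDiff ℝ 1 u) (hc : HasCompactSupport u) :
    ∃ v : E → ℝ, ContDiff ℝ 1 v ∧ HasCompactSupport v ∧ (∀ x, ‖v x‖ₑ = ‖u x‖ₑ ^ (b : ℝ)) ∧
      ∀ x, ‖fderiv ℝ v x‖ₑ ≤ b * (‖u x‖ₑ ^ ((b : ℝ) - 1) * ‖fderiv ℝ u x‖ₑ) := by
  rcases hb.eq_or_lt with rfl | hb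
  · exact ⟨u, hu, hc, by simp, by simp⟩
  · have hb' : (1 : ℝ) < b := hb
    refine ⟨fun x => ‖u x‖ ^ (b : ℝ), hu.norm_rpow hb', hc.norm.rpow_const (by positivity),
      fun x => ?_, fun x => ?_⟩
    · exact (Real.enorm_rpow_of_nonneg (norm_nonneg _) b.coe_nonneg).trans (by rw [enorm_norm])
    · rw [← mul_assoc]
      exact enorm_fderiv_norm_rpow_le (hu.differentiable one_ne_zero) hb

theorem ofReal_pow_mul_enorm_rpow_le {E : Type*} [NormedAddCommGroup E] [NormedSpace ℝ E]
    (n : ℕ) {b : ℝ≥0} (hb : 1 ≤ b) {u : E → ℝ} (hu : ContDiff ℝ 1 u) (hc : HasCompactSupport u)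
    {θ : E} (hθ : ‖θ‖ = 1) {r : ℝ} (hr : 0 < r) :
    ENNReal.ofReal (r ^ n) * ‖u (r • θ)‖ₑ ^ (b : ℝ) ≤ ∫⁻ s in Ioi 0, ENNReal.ofReal (s ^ n) *
      (b * (‖u (s • θ)‖ₑ ^ ((b : ℝ) - 1) * ‖fderiv ℝ u (s • θ)‖ₑ)) := by
  obtain ⟨v, hv, hvc, hvu, hvd⟩ := exists_contDiff_enorm_eq_rpow hb hu hc
  rw [← hvu]
  calc _ ≤ ENNReal.ofReal (r ^ n) * ∫⁻ s in Ici r, ‖fderiv ℝ v (s • θ)‖ₑ := by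
        gcongr
        exact hvc.enorm_le_lintegral_Ici_fderiv_smul hv hθ r
    _ = ∫⁻ s in Ici r, ENNReal.ofReal (r ^ n) * ‖fderiv ℝ v (s • θ)‖ₑ :=
        (lintegral_const_mul' _ _ ENNReal.ofReal_ne_top).symm
    _ ≤ ∫⁻ s in Ici r, ENNReal.ofReal (s ^ n) *
          (b * (‖u (s • θ)‖ₑ ^ ((b : ℝ) - 1) * ‖fderiv ℝ u (s • θ)‖ₑ)) := by
        refine setLIntegral_mono' measurableSet_Ici fun s hs => ?_
        have hrs : r ≤ s := hs
        gcongr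
        exact hvd _
    _ ≤ _ := lintegral_mono_set fun s hs => hr.trans_le hs

theorem exists_lintegral_rpow_mul_fderiv_le (n : ℕ) (hn : 1 ≤ n) {p : ℝ} (hp : 1 ≤ p)
    (hpn : p < n + 1) :
    ∃ C : ℝ≥0, ∀ u : Ed (n + 1) → ℝ, ContDiff ℝ 1 u → HasCompactSupport u →
      ∫⁻ x, ‖u x‖ₑ ^ (n * p / (n + 1 - p) - 1) * ‖fderiv ℝ u x‖ₑ ≤
        C * ((∫⁻ x, ‖fderiv ℝ u x‖ₑ ^ p) ^ (1 / p)) ^ (n * p / (n + 1 - p)) := by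
  have hn1 : (1 : ℝ) ≤ n := by exact_mod_cast hn
  have hnp : 0 < (n : ℝ) + 1 - p := by linarith
  set β : ℝ := n * p / (n + 1 - p) with hβ
  rcases hp.eq_or_lt with rfl | hp1
  · have hβ1 : β = 1 := by rw [hβ]; field_simp; ring
    refine ⟨1, fun u _ _ => ?_⟩
    simp [hβ1]
  have hp0 : 0 < p := by linarith
  have hβ1 : 0 ≤ β - 1 := by
    rw [hβ, sub_nonneg, one_le_div hnp]
    nlinarith
  set q : ℝ := p.conjExponent with hq
  have hpq : p.HolderConjugate q := .conjExponent hp1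
  set p' : ℝ := (n + 1) * p / (n + 1 - p) with hp'
  have hp'0 : 0 < p' := by positivity
  have hqp : (β - 1) * q = p' := by
    have : p - 1 ≠ 0 := by linarith
    rw [hβ, hq, hp', Real.conjExponent]
    field_simp
    ring
  have hqp' : p' * (1 / q) = β - 1 := by
    rw [← hqp]; field_simp [hpq.symm.pos.ne']
  set K : ℝ≥0 := SNormLESNormFDerivOfEqConst ℝ (volume : Measure (Ed (n + 1))) p
  refine ⟨K ^ (β - 1), fun u hu hc => ?_⟩
  set D : ℝ≥0∞ := (∫⁻ x, ‖fderiv ℝ u x‖ₑ ^ p) ^ (1 / p) with hD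
  have hsob : (∫⁻ x, ‖u x‖ₑ ^ p') ^ (1 / p') ≤ K * D := by
    obtain ⟨P, hP⟩ : ∃ P : ℝ≥0, (P : ℝ) = p := ⟨⟨p, hp0.le⟩, rfl⟩
    obtain ⟨P', hP'⟩ : ∃ P' : ℝ≥0, (P' : ℝ) = p' := ⟨⟨p', hp'0.le⟩, rfl⟩
    have hP0 : P ≠ 0 := by
      rintro rfl
      exact hp0.ne hP
    have hP'0 : P' ≠ 0 := by
      rintro rfl
      exact hp'0.ne hP'
    have h := eLpNorm_le_eLpNorm_fderiv_of_eq (volume : Measure (Ed (n + 1))) hu hc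
      (p := P) (p' := P') (by rwa [← NNReal.coe_le_coe, hP]) (by simp) (by
        rw [NNReal.coe_inv, hP, hP', finrank_euclideanSpace_fin, hp']
        push_cast
        field_simp)
    rw [eLpNorm_nnreal_eq_lintegral hP'0, eLpNorm_nnreal_eq_lintegral hP0, hP, hP'] at h
    exact h
  have hcu := hu.continuous
  have hcd : Continuous (fderiv ℝ u) := hu.continuous_fderiv one_ne_zero
  calc ∫⁻ x, ‖u x‖ₑ ^ (β - 1) * ‖fderiv ℝ u x‖ₑ
      ≤ (∫⁻ x, (‖u x‖ₑ ^ (β - 1)) ^ q) ^ (1 / q) * D :=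
        ENNReal.lintegral_mul_le_Lp_mul_Lq volume hpq.symm
          (f := fun x => ‖u x‖ₑ ^ (β - 1)) (g := fun x => ‖fderiv ℝ u x‖ₑ)
          (by fun_prop) (by fun_prop)
    _ = ((∫⁻ x, ‖u x‖ₑ ^ p') ^ (1 / p')) ^ (β - 1) * D := by
        simp_rw [← ENNReal.rpow_mul, hqp]
        rw [← hqp', ← mul_assoc, one_div_mul_cancel hp'0.ne', one_mul]
    _ ≤ (K * D) ^ (β - 1) * D := by gcongr
    _ = (K ^ (β - 1) : ℝ≥0) * D ^ β := by
        rw [ENNReal.mul_rpow_of_nonneg _ _ hβ1, ENNReal.coe_rpow_of_nonneg _ hβ1, mul_assoc]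
        congr 1
        conv_lhs => rw [← ENNReal.rpow_one D]
        rw [← ENNReal.rpow_mul, one_mul, ← ENNReal.rpow_add_of_nonneg _ _ hβ1 zero_le_one,
          sub_add_cancel]

/-- Radial-supremum trace estimate (Nakanishi): for `1 ≤ p < d`, `β = (d-1)p/(d-p)`,
`ν = (d-p)/p`, one has
`‖ sup_{r>0} r^ν |u(rθ)| ‖_{L^β_θ(S^{d-1})} ≤ C(d,p) ‖∇u‖_{L^p(ℝ^d)}` for all `u ∈ C¹_c`.
The surface measure on the unit sphere is the `(d-1)`-dimensional Hausdorff measure. -/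
theorem stmt5 (d : ℕ) (hd : 2 ≤ d) (p : ℝ) (hp1 : 1 ≤ p) (hpd : p < d) :
    ∃ C : ℝ, 0 < C ∧
      ∀ u : Ed d → ℝ, ContDiff ℝ 1 u → HasCompactSupport u →
        (∫⁻ θ in Metric.sphere (0 : Ed d) 1,
            (⨆ (r : ℝ) (_ : 0 < r),
                ENNReal.ofReal (r ^ (((d : ℝ) - p) / p) * |u (r • θ)|))
              ^ (((d : ℝ) - 1) * p / ((d : ℝ) - p))
              ∂(μH[(d : ℝ) - 1])) ^ (1 / (((d : ℝ) - 1) * p / ((d : ℝ) - p)))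
          ≤ ENNReal.ofReal C
            * (∫⁻ x : Ed d, ENNReal.ofReal (‖gradient u x‖ ^ p)) ^ (1 / p) := by
  obtain ⟨n, rfl⟩ : ∃ n, d = n + 1 := ⟨d - 1, by omega⟩
  have hn : 1 ≤ n := by omega
  have hn1 : (1 : ℝ) ≤ n := by exact_mod_cast hn
  have hdn : ((n + 1 : ℕ) : ℝ) - 1 = n := by push_cast; ring
  rw [hdn]
  push_cast at hpd ⊢
  have hnp : 0 < (n : ℝ) + 1 - p := by linarith
  have hp0 : 0 < p := by linarith
  obtain ⟨C₁, hC₁⟩ := exists_lintegral_sphere_le n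
  obtain ⟨C₂, hC₂⟩ := exists_lintegral_rpow_mul_fderiv_le n hn hp1 hpd
  set β : ℝ := n * p / (n + 1 - p) with hβ
  have hβ1 : 1 ≤ β := by
    rw [hβ, one_le_div hnp]
    nlinarith
  have hβ0 : 0 < β := by linarith
  have hνβ : (n + 1 - p) / p * β = n := by rw [hβ]; field_simp
  set b : ℝ≥0 := ⟨β, hβ0.le⟩ with hb
  have hbβ : (b : ℝ) = β := rfl
  set M : ℝ≥0 := C₁ * b * C₂ + 1
  refine ⟨(M : ℝ) ^ (1 / β), by positivity, fun u hu hc => ?_⟩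
  have hcu := hu.continuous
  have hcd : Continuous (fderiv ℝ u) := hu.continuous_fderiv one_ne_zero
  set D : ℝ≥0∞ := (∫⁻ x, ‖fderiv ℝ u x‖ₑ ^ p) ^ (1 / p) with hD
  have hgrad : (∫⁻ x, ENNReal.ofReal (‖gradient u x‖ ^ p)) ^ (1 / p) = D := by
    rw [hD]
    congr 2 with x
    rw [gradient, LinearIsometryEquiv.norm_map, ← ENNReal.ofReal_rpow_of_nonneg (norm_nonneg _)
      hp0.le, ofReal_norm]
  rw [hgrad]
  have hsup : ∀ θ ∈ Metric.sphere (0 : Ed (n + 1)) 1,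
      (⨆ (r : ℝ) (_ : 0 < r), ENNReal.ofReal (r ^ ((n + 1 - p) / p) * |u (r • θ)|)) ^ β ≤
        ∫⁻ s in Ioi 0, ENNReal.ofReal (s ^ n) *
          (b * (‖u (s • θ)‖ₑ ^ (β - 1) * ‖fderiv ℝ u (s • θ)‖ₑ)) := by
    intro θ hθ
    rw [← ENNReal.le_rpow_inv_iff hβ0]
    refine iSup₂_le fun r hr => ?_
    rw [ENNReal.le_rpow_inv_iff hβ0]
    refine le_of_eq_of_le ?_ (ofReal_pow_mul_enorm_rpow_le n (b := b) hβ1 hu hc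
      (by simpa using hθ) hr)
    rw [ENNReal.ofReal_mul (by positivity), ENNReal.mul_rpow_of_nonneg _ _ hβ0.le,
      ENNReal.ofReal_rpow_of_nonneg (by positivity) hβ0.le, ← Real.rpow_mul hr.le, hνβ,
      Real.rpow_natCast, ← Real.norm_eq_abs, ofReal_norm, hbβ]
  have hmain : ∫⁻ θ in Metric.sphere (0 : Ed (n + 1)) 1,
      (⨆ (r : ℝ) (_ : 0 < r), ENNReal.ofReal (r ^ ((n + 1 - p) / p) * |u (r • θ)|)) ^ β
        ∂μH[(n : ℝ)] ≤ M * D ^ β := by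
    calc _ ≤ ∫⁻ θ in Metric.sphere (0 : Ed (n + 1)) 1,
          (∫⁻ s in Ioi 0, ENNReal.ofReal (s ^ n) *
            (b * (‖u (s • θ)‖ₑ ^ (β - 1) * ‖fderiv ℝ u (s • θ)‖ₑ))) ∂μH[(n : ℝ)] :=
          setLIntegral_mono' Metric.isClosed_sphere.measurableSet hsup
      _ ≤ C₁ * ∫⁻ x, b * (‖u x‖ₑ ^ (β - 1) * ‖fderiv ℝ u x‖ₑ) :=
          hC₁ (fun x => b * (‖u x‖ₑ ^ (β - 1) * ‖fderiv ℝ u x‖ₑ)) (by fun_prop)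
      _ = C₁ * (b * ∫⁻ x, ‖u x‖ₑ ^ (β - 1) * ‖fderiv ℝ u x‖ₑ) := by
          rw [lintegral_const_mul' _ _ ENNReal.coe_ne_top]
      _ ≤ C₁ * (b * (C₂ * D ^ β)) := by gcongr; exact hC₂ u hu hc
      _ = ((C₁ * b * C₂ : ℝ≥0) : ℝ≥0∞) * D ^ β := by push_cast; ring
      _ ≤ M * D ^ β := by
          gcongr
          exact le_self_add
  calc _ ≤ (M * D ^ β) ^ (1 / β) := by gcongr
    _ = _ := by
        rw [ENNReal.mul_rpow_of_nonneg _ _ (by positivity), ← ENNReal.rpow_mul,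
          mul_one_div_cancel hβ0.ne', ENNReal.rpow_one,
          ← ENNReal.ofReal_rpow_of_nonneg M.coe_nonneg (by positivity), ENNReal.ofReal_coe_nnreal]
end
end

section
/- Let d ≥ 1 and let u : ℝ^d → ℝ be measurable such that the function (x,y) ↦ |u(x)|²|u(y)|²/|x−y|⁵ is integrable on ℝ^d × ℝ^d. Then, with V(z) = |z|⁻⁴ so that ∇V(z) = −4z/|z|⁶, one has −∬_{ℝ^d×ℝ^d} (x/|x|) · ∇V(x−y) |u(x)|² |u(y)|² dy dx ≥ 0; equivalently ∬_{ℝ^d×ℝ^d} ⟨x, x−y⟩ / (|x| |x−y|⁶) · |u(x)|² |u(y)|² dy dx ≥ 0. -/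
open MeasureTheory
open scoped RealInnerProductSpace

noncomputable section

/-- The gradient of `V(z) = |z|⁻⁴`, namely `∇V(z) = -4z/|z|⁶`. -/
def gradV {d : ℕ} (z : Ed d) : Ed d := (-4 / ‖z‖ ^ 6) • z

/-- The radial unit vector field `x ↦ x/|x|` is monotone. -/
lemma inner_radial_sub_nonneg {E : Type*} [NormedAddCommGroup E] [InnerProductSpace ℝ E]
    (x y : E) : 0 ≤ ⟪x, x - y⟫ / ‖x‖ + ⟪y, y - x⟫ / ‖y‖ := by
  have key : ∀ a b : E, ‖a‖ - ‖b‖ ≤ ⟪a, a - b⟫ / ‖a‖ := by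
    intro a b
    rcases eq_or_ne a 0 with rfl | ha
    · simp
    · have ha' : 0 < ‖a‖ := norm_pos_iff.mpr ha
      rw [le_div_iff₀ ha', inner_sub_right, real_inner_self_eq_norm_sq]
      nlinarith [real_inner_le_norm a b]
  linarith [key x y, key y x]

/-- The symmetric-in-`(x, y)` part of the Morawetz kernel is nonnegative. -/
lemma morawetz_kernel_add_swap_nonneg {E : Type*} [NormedAddCommGroup E] [InnerProductSpace ℝ E]
    (x y : E) :
    0 ≤ ⟪x, x - y⟫ / (‖x‖ * ‖x - y‖ ^ 6) + ⟪y, y - x⟫ / (‖y‖ * ‖y - x‖ ^ 6) := by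
  rw [norm_sub_rev y x, ← div_div, ← div_div, ← add_div]
  exact div_nonneg (inner_radial_sub_nonneg x y) (by positivity)

lemma abs_morawetz_kernel_le {E : Type*} [NormedAddCommGroup E] [InnerProductSpace ℝ E]
    (x y : E) : |⟪x, x - y⟫ / (‖x‖ * ‖x - y‖ ^ 6)| ≤ 1 / ‖x - y‖ ^ 5 := by
  rcases eq_or_ne x 0 with rfl | hx
  · simp
  rcases eq_or_ne (x - y) 0 with hxy | hxy
  · simp [hxy]
  have hx' : 0 < ‖x‖ := norm_pos_iff.mpr hx
  have hxy' : 0 < ‖x - y‖ := norm_pos_iff.mpr hxy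
  rw [abs_div, abs_of_pos (by positivity : 0 < ‖x‖ * ‖x - y‖ ^ 6),
    div_le_div_iff₀ (by positivity) (by positivity)]
  calc |⟪x, x - y⟫| * ‖x - y‖ ^ 5 ≤ ‖x‖ * ‖x - y‖ * ‖x - y‖ ^ 5 := by
        gcongr
        exact abs_real_inner_le_norm x (x - y)
    _ = 1 * (‖x‖ * ‖x - y‖ ^ 6) := by ring

lemma inner_gradV {d : ℕ} (x y : Ed d) :
    ⟪‖x‖⁻¹ • x, gradV (x - y)⟫ = -4 * (⟪x, x - y⟫ / (‖x‖ * ‖x - y‖ ^ 6)) := by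
  rw [gradV, real_inner_smul_left, real_inner_smul_right, ← div_div]
  ring

lemma integral_morawetz_kernel_nonneg {d : ℕ} {u : Ed d → ℝ} (hu : Measurable u)
    (hint : Integrable (fun p : Ed d × Ed d =>
      (u p.1) ^ 2 * (u p.2) ^ 2 / ‖p.1 - p.2‖ ^ 5)) :
    0 ≤ ∫ x : Ed d, ∫ y : Ed d,
        ⟪x, x - y⟫ / (‖x‖ * ‖x - y‖ ^ 6) * (u x) ^ 2 * (u y) ^ 2 := by
  set F : Ed d × Ed d → ℝ := fun p =>
    ⟪p.1, p.1 - p.2⟫ / (‖p.1‖ * ‖p.1 - p.2‖ ^ 6) * (u p.1) ^ 2 * (u p.2) ^ 2 with hF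
  have hFint : Integrable F (volume.prod volume) := by
    refine Integrable.mono' hint ?_ (Filter.Eventually.of_forall fun p => ?_)
    · exact Measurable.aestronglyMeasurable (by fun_prop)
    · calc ‖F p‖ = |⟪p.1, p.1 - p.2⟫ / (‖p.1‖ * ‖p.1 - p.2‖ ^ 6)| *
            ((u p.1) ^ 2 * (u p.2) ^ 2) := by
            rw [Real.norm_eq_abs, show F p = _ from mul_assoc _ _ _, abs_mul,
              abs_of_nonneg (by positivity : 0 ≤ (u p.1) ^ 2 * (u p.2) ^ 2)]
        _ ≤ 1 / ‖p.1 - p.2‖ ^ 5 * ((u p.1) ^ 2 * (u p.2) ^ 2) := by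
            gcongr
            exact abs_morawetz_kernel_le p.1 p.2
        _ = (u p.1) ^ 2 * (u p.2) ^ 2 / ‖p.1 - p.2‖ ^ 5 := by ring
  have hsum : 0 ≤ ∫ p, (F p + F p.swap) ∂(volume.prod volume) := by
    refine integral_nonneg fun p => ?_
    have h := mul_nonneg (morawetz_kernel_add_swap_nonneg p.1 p.2)
      (by positivity : 0 ≤ (u p.1) ^ 2 * (u p.2) ^ 2)
    simp only [hF, Prod.fst_swap, Prod.snd_swap, Pi.zero_apply]
    linarith
  have hswap : Integrable (fun p => F p.swap) (volume.prod volume) := hFint.swap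
  rw [integral_add hFint hswap, integral_prod_swap, integral_prod F hFint] at hsum
  linarith

/-- Sign of the Morawetz interaction term: if `(x,y) ↦ u(x)²u(y)²/|x-y|⁵` is integrable,
then `-∬ (x/|x|)·∇V(x-y) u(x)²u(y)² dy dx ≥ 0`, equivalently
`∬ ⟨x, x-y⟩/(|x||x-y|⁶) u(x)²u(y)² dy dx ≥ 0`. -/
theorem stmt7 (d : ℕ) (hd : 1 ≤ d) (u : Ed d → ℝ) (hu : Measurable u)
    (hint : Integrable (fun p : Ed d × Ed d =>
      (u p.1) ^ 2 * (u p.2) ^ 2 / ‖p.1 - p.2‖ ^ 5)) :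
    (0 ≤ -∫ x : Ed d, ∫ y : Ed d,
        ⟪‖x‖⁻¹ • x, gradV (x - y)⟫ * (u x) ^ 2 * (u y) ^ 2) ∧
    (0 ≤ ∫ x : Ed d, ∫ y : Ed d,
        ⟪x, x - y⟫ / (‖x‖ * ‖x - y‖ ^ 6) * (u x) ^ 2 * (u y) ^ 2) := by
  have h := integral_morawetz_kernel_nonneg hu hint
  refine ⟨?_, h⟩
  simp only [inner_gradV, mul_assoc, integral_const_mul] at h ⊢
  linarith
end
end

section
/- Let d ≥ 5 and let J ⊆ ℝ be an interval. Then there exists a constant C depending only on d such that for all measurable functions u, w : J × ℝ^d → ℝ, ∫_J ( ∫_{ℝ^d} | (|·|⁻⁴ ∗ |u(t)|²)(x) · w(t,x) |² dx )^{1/2} dt ≤ C · ( ∫_J ‖u(t)‖_{L^{6d/(3d−8)}(ℝ^d)}³ dt )^{2/3} · ( ∫_J ‖w(t)‖_{L^{6d/(3d−8)}(ℝ^d)}³ dt )^{1/3}, where all quantities are interpreted in [0,∞]. -/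
open MeasureTheory
open scoped ENNReal

noncomputable section

/-- The Hartree potential `(|·|⁻⁴ ∗ f²)(x) = ∫ f(y)² |x-y|⁻⁴ dy`, valued in `[0,∞]`. -/
def hartreePotE {d : ℕ} (f : Ed d → ℝ) (x : Ed d) : ℝ≥0∞ :=
  ∫⁻ y : Ed d, ENNReal.ofReal ((f y) ^ 2 / ‖x - y‖ ^ 4)

/-- The Riesz kernel `v ↦ ‖v‖^(-s)`, valued in `[0,∞)`. -/
def rieszKernel {d : ℕ} (s : ℝ) (v : Ed d) : ℝ≥0∞ := ENNReal.ofReal (‖v‖ ^ (-s))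

lemma measurable_rieszKernel {d : ℕ} (s : ℝ) : Measurable (rieszKernel (d := d) s) := by
  unfold rieszKernel
  fun_prop

lemma rieszKernel_sub_comm {d : ℕ} (s : ℝ) (x y : Ed d) :
    rieszKernel s (x - y) = rieszKernel s (y - x) := by
  simp only [rieszKernel, norm_sub_rev]

lemma rieszKernel_rpow {d : ℕ} (s : ℝ) {p : ℝ} (hp : 0 ≤ p) (v : Ed d) :
    rieszKernel s v ^ p = rieszKernel (s * p) v := by
  rw [rieszKernel, rieszKernel, ENNReal.ofReal_rpow_of_nonneg (by positivity) hp,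
    ← Real.rpow_mul (norm_nonneg v), neg_mul]

lemma rieszKernel_smul {d : ℕ} (s : ℝ) {r : ℝ} (hr : 0 < r) (v : Ed d) :
    rieszKernel s (r • v) = ENNReal.ofReal (r ^ (-s)) * rieszKernel s v := by
  rw [rieszKernel, rieszKernel, norm_smul, Real.norm_of_nonneg hr.le,
    Real.mul_rpow hr.le (norm_nonneg v), ENNReal.ofReal_mul (by positivity)]

lemma lintegral_eq_mul_lintegral_comp_smul {d : ℕ} {f : Ed d → ℝ≥0∞} (hf : Measurable f)
    {r : ℝ} (hr : 0 < r) :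
    ∫⁻ v, f v = ENNReal.ofReal (r ^ (d : ℝ)) * ∫⁻ v, f (r • v) := by
  have h := lintegral_map (μ := (volume : Measure (Ed d))) hf (measurable_const_smul r)
  rw [Measure.map_addHaar_smul _ hr.ne', lintegral_smul_measure] at h
  rw [← h, smul_eq_mul, ← mul_assoc, ← ENNReal.ofReal_mul (by positivity),
    abs_of_pos (by positivity)]
  simp [hr.ne']

lemma lintegral_indicator_rieszKernel_scale {d : ℕ} (s : ℝ) {S : Set ℝ} (hS : MeasurableSet S)
    {r : ℝ} (hr : 0 < r) :
    ∫⁻ v : Ed d, {v | ‖v‖ / r ∈ S}.indicator (rieszKernel s) v =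
      ENNReal.ofReal (r ^ (d - s)) * ∫⁻ v : Ed d, {v | ‖v‖ ∈ S}.indicator (rieszKernel s) v := by
  have hm : MeasurableSet {v : Ed d | ‖v‖ / r ∈ S} :=
    (measurable_norm.div_const r) hS
  have hm' : MeasurableSet {v : Ed d | ‖v‖ ∈ S} := measurable_norm hS
  rw [lintegral_eq_mul_lintegral_comp_smul ((measurable_rieszKernel s).indicator hm) hr,
    sub_eq_add_neg, Real.rpow_add hr, ENNReal.ofReal_mul (by positivity), mul_assoc,
    ← lintegral_const_mul _ ((measurable_rieszKernel s).indicator hm')]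
  refine congrArg _ (lintegral_congr fun v ↦ ?_)
  have hv : ‖r • v‖ / r = ‖v‖ := by
    rw [norm_smul, Real.norm_of_nonneg hr.le, mul_div_cancel_left₀ _ hr.ne']
  by_cases hvS : ‖v‖ ∈ S <;> simp [hv, hvS, rieszKernel_smul s hr]

lemma lintegral_indicator_rieszKernel_lt_top {d : ℕ} [NeZero d] {s : ℝ} {S : Set ℝ}
    (hS : MeasurableSet S)
    (h : IntegrableOn (fun y : ℝ ↦ y ^ (d - 1 - s)) (S ∩ Set.Ioi 0)) :
    ∫⁻ v : Ed d, {v | ‖v‖ ∈ S}.indicator (rieszKernel s) v < ⊤ := by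
  have hi : Integrable (fun v : Ed d ↦ S.indicator (fun y : ℝ ↦ y ^ (-s)) ‖v‖) := by
    rw [integrable_fun_norm_addHaar]
    rw [IntegrableOn, ← Measure.restrict_restrict hS, ← IntegrableOn,
      ← integrable_indicator_iff hS] at h
    refine h.congr ((ae_restrict_mem measurableSet_Ioi).mono fun y (hy : 0 < y) ↦ ?_)
    by_cases hyS : y ∈ S
    · have hd : ((d - 1 : ℕ) : ℝ) = d - 1 := by
        rw [Nat.cast_sub NeZero.one_le, Nat.cast_one]
      simp only [hyS, Set.indicator_of_mem, finrank_euclideanSpace, Fintype.card_fin, smul_eq_mul]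
      rw [← Real.rpow_natCast, hd, ← Real.rpow_add hy, sub_eq_add_neg]
    · simp [hyS]
  refine lt_of_le_of_lt (lintegral_mono fun v ↦ ?_) hi.lintegral_lt_top
  by_cases hv : ‖v‖ ∈ S <;> simp [hv, rieszKernel]

lemma lintegral_rieszKernel_near {d : ℕ} [NeZero d] {s : ℝ} (hs : s < d) :
    ∃ c : ℝ≥0∞, c ≠ ⊤ ∧ ∀ r : ℝ, 0 < r →
      ∫⁻ v : Ed d, {v | ‖v‖ < r}.indicator (rieszKernel s) v = c * ENNReal.ofReal (r ^ (d - s)) := by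
  refine ⟨_, (lintegral_indicator_rieszKernel_lt_top (d := d) (s := s) (S := Set.Iio 1)
    measurableSet_Iio ?_).ne, fun r hr ↦ ?_⟩
  · rw [Set.inter_comm, Set.Ioi_inter_Iio, intervalIntegral.integrableOn_Ioo_rpow_iff one_pos]
    linarith
  · rw [mul_comm, ← lintegral_indicator_rieszKernel_scale s measurableSet_Iio hr]
    simp only [Set.mem_Iio, div_lt_one hr]

lemma lintegral_rieszKernel_far {d : ℕ} [NeZero d] {s : ℝ} (hs : d < s) :
    ∃ c : ℝ≥0∞, c ≠ ⊤ ∧ ∀ r : ℝ, 0 < r →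
      ∫⁻ v : Ed d, {v | r ≤ ‖v‖}.indicator (rieszKernel s) v = c * ENNReal.ofReal (r ^ (d - s)) := by
  refine ⟨_, (lintegral_indicator_rieszKernel_lt_top (d := d) (s := s) (S := Set.Ici 1)
    measurableSet_Ici ?_).ne, fun r hr ↦ ?_⟩
  · exact ((integrableOn_Ici_iff_integrableOn_Ioi).2
      (integrableOn_Ioi_rpow_of_lt (by linarith) one_pos)).mono_set Set.inter_subset_left
  · rw [mul_comm, ← lintegral_indicator_rieszKernel_scale s measurableSet_Ici hr]
    simp only [Set.mem_Ici, one_le_div hr]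

/-- The function `f` cut off to zero where it exceeds the height `M`. -/
def truncAbove {α : Type*} (f : α → ℝ≥0∞) (M : ℝ≥0∞) (y : α) : ℝ≥0∞ :=
  if f y ≤ M then f y else 0

lemma truncAbove_le {α : Type*} (f : α → ℝ≥0∞) (M : ℝ≥0∞) (y : α) : truncAbove f M y ≤ f y := by
  unfold truncAbove
  split_ifs <;> simp

lemma truncAbove_le_height {α : Type*} (f : α → ℝ≥0∞) (M : ℝ≥0∞) (y : α) :
    truncAbove f M y ≤ M := by
  unfold truncAbove
  split_ifs with h <;> simp [h]

lemma truncAbove_of_le {α : Type*} {f : α → ℝ≥0∞} {M : ℝ≥0∞} {y : α} (h : f y ≤ M) :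
    truncAbove f M y = f y := if_pos h

lemma Measurable.truncAbove {α β : Type*} [MeasurableSpace α] [MeasurableSpace β]
    {f : α → ℝ≥0∞} (hf : Measurable f) {M : β → ℝ≥0∞} (hM : Measurable M) {k : β → α}
    (hk : Measurable k) : Measurable fun b ↦ truncAbove f (M b) (k b) :=
  Measurable.ite (measurableSet_le (hf.comp hk) hM) (hf.comp hk) measurable_const

/-- A function of unit `L^a` norm, `a = 3d/(3d-8)`, truncated at height `M`, has Riesz potential
at most a multiple of `M^(4/(3d-8))`. -/
lemma exists_lintegral_truncAbove_mul_rieszKernel_le {d : ℕ} (hd : 5 ≤ d) :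
    ∃ K : ℝ≥0∞, 1 ≤ K ∧ K ≠ ⊤ ∧ ∀ f : Ed d → ℝ≥0∞, Measurable f →
      ∫⁻ y, f y ^ (3 * (d : ℝ) / (3 * d - 8)) ≤ 1 → ∀ (M : ℝ≥0∞) (x : Ed d),
        ∫⁻ y, truncAbove f M y * rieszKernel 4 (x - y) ≤ K * M ^ (4 / (3 * (d : ℝ) - 8)) := by
  have hd5 : (5 : ℝ) ≤ d := by exact_mod_cast hd
  have hd8 : 0 < 3 * (d : ℝ) - 8 := by linarith
  have : NeZero d := ⟨by omega⟩
  obtain ⟨c₁, hc₁, near⟩ := lintegral_rieszKernel_near (d := d) (s := 4) (by linarith)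
  obtain ⟨c₂, hc₂, far⟩ := lintegral_rieszKernel_far (d := d) (s := 4 * (3 * d / 8))
    (by linarith)
  refine ⟨1 + c₁ + c₂ ^ (8 / (3 * (d : ℝ))), by rw [add_assoc]; exact le_self_add, ?_,
    fun f hf hf1 M x ↦ ?_⟩
  · have := ENNReal.rpow_ne_top_of_nonneg (y := 8 / (3 * (d : ℝ))) (by positivity) hc₂
    simp [hc₁, this]
  rcases eq_or_ne M ⊤ with rfl | hMtop
  · rw [ENNReal.top_rpow_of_pos (by positivity), ENNReal.mul_top (by simp)]
    exact le_top
  rcases eq_or_ne M 0 with rfl | hM0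
  · have h0 (y : Ed d) : truncAbove f 0 y = 0 := le_antisymm (truncAbove_le_height f 0 y) bot_le
    simp [h0]
  obtain ⟨m, hm, rfl⟩ : ∃ m : ℝ, 0 < m ∧ M = ENNReal.ofReal m :=
    ⟨M.toReal, ENNReal.toReal_pos hM0 hMtop, (ENNReal.ofReal_toReal hMtop).symm⟩
  set r : ℝ := m ^ (-(3 / (3 * (d : ℝ) - 8))) with hr_def
  have hr : 0 < r := by positivity
  have hmf : Measurable (truncAbove f (ENNReal.ofReal m)) :=
    hf.truncAbove measurable_const measurable_id
  have hmk : Measurable (rieszKernel (d := d) 4) := measurable_rieszKernel 4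
  have hsn : MeasurableSet {v : Ed d | ‖v‖ < r} := measurableSet_lt measurable_norm measurable_const
  have hsf : MeasurableSet {v : Ed d | r ≤ ‖v‖} := measurableSet_le measurable_const measurable_norm
  set kn : Ed d → ℝ≥0∞ := {v | ‖v‖ < r}.indicator (rieszKernel 4) with hkn
  set kf : Ed d → ℝ≥0∞ := {v | r ≤ ‖v‖}.indicator (rieszKernel 4) with hkf
  have hmkn : Measurable kn := hmk.indicator hsn
  have hmkf : Measurable kf := hmk.indicator hsf
  have hsplit (v : Ed d) : rieszKernel 4 v = kn v + kf v := by
    rcases lt_or_ge ‖v‖ r with h | h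
    · simp [hkn, hkf, h, not_le.2 h]
    · simp [hkn, hkf, h, not_lt.2 h]
  have hnear : ∫⁻ y, truncAbove f (ENNReal.ofReal m) y * kn (x - y) ≤
      c₁ * ENNReal.ofReal m ^ (4 / (3 * (d : ℝ) - 8)) := by
    calc
      _ ≤ ∫⁻ y, ENNReal.ofReal m * kn (x - y) := by
        gcongr with y
        exact truncAbove_le_height ..
      _ = ENNReal.ofReal m * (c₁ * ENNReal.ofReal (r ^ ((d : ℝ) - 4))) := by
        rw [lintegral_const_mul _ (by fun_prop), lintegral_sub_left_eq_self kn x, hkn, near r hr]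
      _ = _ := by
        rw [mul_left_comm, ← ENNReal.ofReal_mul hm.le, ENNReal.ofReal_rpow_of_pos hm, hr_def,
          ← Real.rpow_mul hm.le]
        nth_rw 1 [← Real.rpow_one m]
        rw [← Real.rpow_add hm]
        congr 3
        field_simp
        ring
  have hconj : (3 * (d : ℝ) / (3 * d - 8)).HolderConjugate (3 * d / 8) := by
    rw [Real.holderConjugate_iff, one_lt_div hd8]
    refine ⟨by linarith, ?_⟩
    field_simp
    ring
  have hfar : ∫⁻ y, truncAbove f (ENNReal.ofReal m) y * kf (x - y) ≤
      c₂ ^ (8 / (3 * (d : ℝ))) * ENNReal.ofReal m ^ (4 / (3 * (d : ℝ) - 8)) := by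
    calc
      _ ≤ ∫⁻ y, (f * fun y ↦ kf (x - y)) y := by
        gcongr with y
        exact mul_le_mul_left (truncAbove_le ..) _
      _ ≤ (∫⁻ y, f y ^ (3 * (d : ℝ) / (3 * d - 8))) ^ (1 / (3 * (d : ℝ) / (3 * d - 8))) *
          (∫⁻ y, kf (x - y) ^ (3 * (d : ℝ) / 8)) ^ (1 / (3 * (d : ℝ) / 8)) :=
        ENNReal.lintegral_mul_le_Lp_mul_Lq _ hconj hf.aemeasurable
          (by fun_prop : Measurable fun y ↦ kf (x - y)).aemeasurable
      _ ≤ 1 * (c₂ * ENNReal.ofReal (r ^ ((d : ℝ) - 4 * (3 * d / 8)))) ^ (1 / (3 * (d : ℝ) / 8)) := by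
        gcongr
        · exact ENNReal.rpow_le_one hf1 (by positivity)
        · rw [lintegral_sub_left_eq_self (fun v ↦ kf v ^ (3 * (d : ℝ) / 8)) x, ← far r hr]
          refine lintegral_mono fun v ↦ ?_
          by_cases hv : r ≤ ‖v‖
          · simp only [hkf, Set.indicator_apply, Set.mem_ofPred_eq, hv, if_true]
            rw [rieszKernel_rpow _ (by positivity)]
          · have : 0 < 3 * (d : ℝ) / 8 := by positivity
            simp [hkf, hv, this]
      _ = _ := by
        rw [one_mul, ENNReal.mul_rpow_of_nonneg _ _ (by positivity), one_div_div,
          ENNReal.ofReal_rpow_of_pos (by positivity), ENNReal.ofReal_rpow_of_pos hm, hr_def,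
          ← Real.rpow_mul hm.le, ← Real.rpow_mul hm.le]
        congr 3
        field_simp
        ring
  calc
    _ = (∫⁻ y, truncAbove f (ENNReal.ofReal m) y * kn (x - y)) +
        ∫⁻ y, truncAbove f (ENNReal.ofReal m) y * kf (x - y) := by
      rw [← lintegral_add_left (by fun_prop)]
      simp only [hsplit, mul_add]
    _ ≤ _ := add_le_add hnear hfar
    _ ≤ _ := by
      rw [← add_mul, add_assoc]
      exact mul_le_mul_left le_add_self _

lemma mul_mul_le_sum_truncAbove {α : Type*} (f g : α → ℝ≥0∞) (x y z : α) :
    f y * f z * g x ≤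
      truncAbove f (g x) y * truncAbove f (g x) z * g x +
        f y * truncAbove f (f y) z * truncAbove g (f y) x +
        truncAbove f (f z) y * f z * truncAbove g (f z) x := by
  by_cases h₁ : f y ≤ g x ∧ f z ≤ g x
  · rw [truncAbove_of_le h₁.1, truncAbove_of_le h₁.2, add_assoc]
    exact le_self_add
  · rcases le_total (f z) (f y) with h | h
    · have hx : g x ≤ f y := le_of_not_ge fun hy ↦ h₁ ⟨hy, h.trans hy⟩
      rw [truncAbove_of_le h, truncAbove_of_le hx, add_right_comm]
      exact le_add_self
    · have hx : g x ≤ f z := le_of_not_ge fun hz ↦ h₁ ⟨h.trans hz, hz⟩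
      rw [truncAbove_of_le h, truncAbove_of_le hx]
      exact le_add_self

lemma lintegral_add_add_left {α : Type*} [MeasurableSpace α] {μ : Measure α} {f g : α → ℝ≥0∞}
    (hf : Measurable f) (hg : Measurable g) (h : α → ℝ≥0∞) :
    ∫⁻ x, (f x + g x + h x) ∂μ = ∫⁻ x, f x ∂μ + ∫⁻ x, g x ∂μ + ∫⁻ x, h x ∂μ := by
  have hfg : Measurable fun x ↦ f x + g x := hf.add hg
  rw [lintegral_add_left hfg, lintegral_add_left hf]

/-- Trilinear Hardy–Littlewood–Sobolev inequality for functions of norm at most one. -/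
lemma exists_lintegral_rieszPotential_sq_mul_le_of_le_one {d : ℕ} (hd : 5 ≤ d) :
    ∃ K : ℝ≥0∞, 1 ≤ K ∧ K ≠ ⊤ ∧ ∀ f g : Ed d → ℝ≥0∞, Measurable f → Measurable g →
      ∫⁻ y, f y ^ (3 * (d : ℝ) / (3 * d - 8)) ≤ 1 →
      ∫⁻ y, g y ^ (3 * (d : ℝ) / (3 * d - 8)) ≤ 1 →
      ∫⁻ x, (∫⁻ y, f y * rieszKernel 4 (x - y)) ^ 2 * g x ≤ K := by
  obtain ⟨K, hK1, hK, key⟩ := exists_lintegral_truncAbove_mul_rieszKernel_le hd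
  have hd5 : (5 : ℝ) ≤ d := by exact_mod_cast hd
  have hd8 : 0 < 3 * (d : ℝ) - 8 := by linarith
  refine ⟨K ^ 2 + K ^ 2 + K ^ 2, (one_le_pow₀ hK1).trans le_add_self, by simp [hK],
    fun f g hf hg hf1 hg1 ↦ ?_⟩
  set k : Ed d → Ed d → ℝ≥0∞ := fun x y ↦ rieszKernel 4 (x - y) with hk_def
  set θ : ℝ := 4 / (3 * (d : ℝ) - 8) with hθ
  set a : ℝ := 3 * (d : ℝ) / (3 * d - 8) with ha
  have hk {β : Type} [MeasurableSpace β] {p q : β → Ed d} (hp : Measurable p)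
      (hq : Measurable q) : Measurable fun b ↦ k (p b) (q b) :=
    (measurable_rieszKernel 4).comp (hp.sub hq)
  have hkx (x : Ed d) : Measurable (k x) := hk measurable_const measurable_id
  have hpow (t : ℝ≥0∞) : t * (K * t ^ θ) ^ 2 = K ^ 2 * t ^ a := by
    rw [mul_pow, ← ENNReal.rpow_natCast (t ^ θ), ← ENNReal.rpow_mul, mul_left_comm]
    congr 1
    nth_rw 1 [← ENNReal.rpow_one t]
    rw [← ENNReal.rpow_add_of_nonneg _ _ zero_le_one (by positivity)]
    congr 1
    rw [hθ, ha]
    push_cast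
    field_simp
    ring
  have hint {h : Ed d → ℝ≥0∞} (hh : ∫⁻ y, h y ^ a ≤ 1) :
      ∫⁻ x, h x * (K * h x ^ θ) ^ 2 ≤ K ^ 2 := by
    simp only [hpow]
    rw [lintegral_const_mul' _ _ (by simp [hK])]
    exact mul_le_of_le_one_right' hh
  set A : Ed d → Ed d → Ed d → ℝ≥0∞ := fun x y z ↦
    truncAbove f (g x) y * truncAbove f (g x) z * g x * (k x y * k x z) with hA
  set B : Ed d → Ed d → Ed d → ℝ≥0∞ := fun x y z ↦
    f y * truncAbove f (f y) z * truncAbove g (f y) x * (k x y * k x z) with hB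
  have hmA : Measurable fun p : Ed d × Ed d × Ed d ↦ A p.1 p.2.1 p.2.2 := by
    refine .mul (.mul (.mul ?_ ?_) ?_) (.mul (hk ?_ ?_) (hk ?_ ?_))
    · exact hf.truncAbove (by fun_prop) (by fun_prop)
    · exact hf.truncAbove (by fun_prop) (by fun_prop)
    all_goals fun_prop
  have hmB : Measurable fun p : Ed d × Ed d × Ed d ↦ B p.1 p.2.1 p.2.2 := by
    refine .mul (.mul (.mul ?_ ?_) ?_) (.mul (hk ?_ ?_) (hk ?_ ?_))
    · fun_prop
    · exact hf.truncAbove (by fun_prop) (by fun_prop)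
    · exact hg.truncAbove (by fun_prop) (by fun_prop)
    all_goals fun_prop
  have hm2 {T : Ed d → Ed d → Ed d → ℝ≥0∞}
      (hT : Measurable fun p : Ed d × Ed d × Ed d ↦ T p.1 p.2.1 p.2.2) :
      Measurable fun p : Ed d × Ed d ↦ ∫⁻ z, T p.1 p.2 z :=
    (hT.comp MeasurableEquiv.prodAssoc.measurable).lintegral_prod_right'
  have hA2 : ∫⁻ x, ∫⁻ y, ∫⁻ z, A x y z ≤ K ^ 2 := by
    refine (lintegral_mono fun x ↦ ?_).trans (hint hg1)
    have hmt : Measurable fun y ↦ truncAbove f (g x) y * k x y :=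
      (hf.truncAbove measurable_const measurable_id).mul (hkx x)
    calc
      _ = ∫⁻ y, ∫⁻ z, g x * ((truncAbove f (g x) y * k x y) * (truncAbove f (g x) z * k x z)) := by
        refine lintegral_congr fun y ↦ lintegral_congr fun z ↦ ?_
        simp only [hA]
        ring
      _ = g x * ((∫⁻ y, truncAbove f (g x) y * k x y) * ∫⁻ z, truncAbove f (g x) z * k x z) := by
        simp_rw [lintegral_const_mul _ (hmt.const_mul _), lintegral_const_mul _ hmt]
        rw [lintegral_const_mul _ (hmt.mul_const _), lintegral_mul_const _ hmt]
      _ ≤ _ := by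
        rw [← pow_two]
        gcongr
        exact key f hf hf1 _ _
  have hB2 : ∫⁻ x, ∫⁻ y, ∫⁻ z, B x y z ≤ K ^ 2 := by
    rw [lintegral_lintegral_swap (f := fun x y ↦ ∫⁻ z, B x y z)]
    swap
    · exact (hm2 hmB).aemeasurable
    refine (lintegral_mono fun y ↦ ?_).trans (hint hf1)
    have hmf (x : Ed d) : Measurable fun z ↦ truncAbove f (f y) z * k x z :=
      (hf.truncAbove measurable_const measurable_id).mul (hkx x)
    have hmg : Measurable fun x ↦ truncAbove g (f y) x * k y x :=
      (hg.truncAbove measurable_const measurable_id).mul (hkx y)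
    calc
      _ = ∫⁻ x, f y * (truncAbove g (f y) x * k y x * ∫⁻ z, truncAbove f (f y) z * k x z) := by
        refine lintegral_congr fun x ↦ ?_
        rw [← mul_assoc, ← lintegral_const_mul _ (hmf x)]
        refine lintegral_congr fun z ↦ ?_
        simp only [hB, hk_def, rieszKernel_sub_comm 4 x y]
        ring
      _ ≤ ∫⁻ x, f y * (K * f y ^ θ) * (truncAbove g (f y) x * k y x) := by
        refine lintegral_mono fun x ↦ ?_
        rw [mul_assoc (f y), mul_comm (K * f y ^ θ)]
        gcongr
        exact key f hf hf1 _ _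
      _ = f y * (K * f y ^ θ) * ∫⁻ x, truncAbove g (f y) x * k y x := lintegral_const_mul _ hmg
      _ ≤ _ := by
        rw [pow_two, ← mul_assoc (f y) (K * f y ^ θ)]
        exact mul_le_mul_right (key g hg hg1 _ _) _
  have hmA' (x : Ed d) : Measurable fun p : Ed d × Ed d ↦ A x p.1 p.2 :=
    hmA.comp measurable_prodMk_left
  have hmB' (x : Ed d) : Measurable fun p : Ed d × Ed d ↦ B x p.1 p.2 :=
    hmB.comp measurable_prodMk_left
  have hB_swap (x : Ed d) : ∫⁻ y, ∫⁻ z, B x z y = ∫⁻ y, ∫⁻ z, B x y z :=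
    (lintegral_lintegral_swap (f := B x) (hmB' x).aemeasurable).symm
  have hmAI : Measurable fun x ↦ ∫⁻ y, ∫⁻ z, A x y z := (hm2 hmA).lintegral_prod_right'
  have hmBI : Measurable fun x ↦ ∫⁻ y, ∫⁻ z, B x y z := (hm2 hmB).lintegral_prod_right'
  calc
    _ ≤ ∫⁻ x, ((∫⁻ y, ∫⁻ z, A x y z) + (∫⁻ y, ∫⁻ z, B x y z) + ∫⁻ y, ∫⁻ z, B x y z) := by
      refine lintegral_mono fun x ↦ ?_
      have hmf : Measurable fun y ↦ f y * k x y := hf.mul (hkx x)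
      calc
        _ = ∫⁻ y, ∫⁻ z, f y * f z * g x * (k x y * k x z) := by
          rw [pow_two, ← lintegral_mul_const _ hmf, ← lintegral_mul_const _ (hmf.mul_const _)]
          refine lintegral_congr fun y ↦ ?_
          rw [← lintegral_const_mul _ hmf, ← lintegral_mul_const _ (hmf.const_mul _)]
          refine lintegral_congr fun z ↦ ?_
          ring
        _ ≤ ∫⁻ y, ∫⁻ z, (A x y z + B x y z + B x z y) := by
          refine lintegral_mono fun y ↦ lintegral_mono fun z ↦ ?_
          refine (mul_le_mul_left (mul_mul_le_sum_truncAbove f g x y z) _).trans_eq ?_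
          simp only [hA, hB]
          ring
        _ = _ := by
          have hA1 (y : Ed d) : Measurable (A x y) := (hmA' x).comp measurable_prodMk_left
          have hB1 (y : Ed d) : Measurable (B x y) := (hmB' x).comp measurable_prodMk_left
          have hAI : Measurable fun y ↦ ∫⁻ z, A x y z := (hmA' x).lintegral_prod_right'
          have hBI : Measurable fun y ↦ ∫⁻ z, B x y z := (hmB' x).lintegral_prod_right'
          rw [lintegral_congr fun y ↦ lintegral_add_add_left (hA1 y) (hB1 y) fun z ↦ B x z y,
            lintegral_add_add_left hAI hBI, hB_swap]
    _ = _ := lintegral_add_add_left hmAI hmBI _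
    _ ≤ _ := add_le_add (add_le_add hA2 hB2) hB2

/-- Trilinear Hardy–Littlewood–Sobolev inequality. -/
lemma exists_lintegral_rieszPotential_sq_mul_le {d : ℕ} (hd : 5 ≤ d) :
    ∃ K : ℝ≥0∞, 1 ≤ K ∧ K ≠ ⊤ ∧ ∀ f g : Ed d → ℝ≥0∞, Measurable f → Measurable g →
      ∫⁻ x, (∫⁻ y, f y * rieszKernel 4 (x - y)) ^ 2 * g x ≤
        K * ((∫⁻ y, f y ^ (3 * (d : ℝ) / (3 * d - 8))) ^ ((3 * (d : ℝ) - 8) / (3 * d))) ^ 2 *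
          (∫⁻ y, g y ^ (3 * (d : ℝ) / (3 * d - 8))) ^ ((3 * (d : ℝ) - 8) / (3 * d)) := by
  obtain ⟨K, hK1, hK, key⟩ := exists_lintegral_rieszPotential_sq_mul_le_of_le_one hd
  refine ⟨K, hK1, hK, fun f g hf hg ↦ ?_⟩
  have hd5 : (5 : ℝ) ≤ d := by exact_mod_cast hd
  have hd8 : 0 < 3 * (d : ℝ) - 8 := by linarith
  set a : ℝ := 3 * (d : ℝ) / (3 * d - 8) with ha
  have ha0 : 0 < a := by positivity
  have hainv : (3 * (d : ℝ) - 8) / (3 * d) = a⁻¹ := by rw [ha, inv_div]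
  rw [hainv]
  have hae {h : Ed d → ℝ≥0∞} (hh : Measurable h) (h0 : ∫⁻ y, h y ^ a = 0) : h =ᵐ[volume] 0 := by
    rw [lintegral_eq_zero_iff (hh.pow_const a)] at h0
    filter_upwards [h0] with y hy
    simpa [ha0, ha0.not_gt] using hy
  by_cases hf0 : ∫⁻ y, f y ^ a = 0
  · have h0 (x : Ed d) : ∫⁻ y, f y * rieszKernel 4 (x - y) = 0 := by
      rw [← lintegral_zero (μ := (volume : Measure (Ed d)))]
      refine lintegral_congr_ae ?_
      filter_upwards [hae hf hf0] with y hy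
      simp [hy]
    simp [h0]
  by_cases hg0 : ∫⁻ y, g y ^ a = 0
  · refine le_of_eq_of_le ?_ bot_le
    rw [bot_eq_zero, ← lintegral_zero (μ := (volume : Measure (Ed d)))]
    refine lintegral_congr_ae ?_
    filter_upwards [hae hg hg0] with y hy
    simp [hy]
  have hK0 : K ≠ 0 := (zero_lt_one.trans_le hK1).ne'
  have hpos {G : ℝ≥0∞} (h : G ≠ 0) : G ^ a⁻¹ ≠ 0 := by simp [h, ha0.le, ha0]
  by_cases hft : ∫⁻ y, f y ^ a = ⊤
  · rw [hft, ENNReal.top_rpow_of_pos (by positivity), ENNReal.top_pow two_ne_zero,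
      ENNReal.mul_top hK0, ENNReal.top_mul (hpos hg0)]
    exact le_top
  by_cases hgt : ∫⁻ y, g y ^ a = ⊤
  · rw [hgt, ENNReal.top_rpow_of_pos (by positivity),
      ENNReal.mul_top (mul_ne_zero hK0 (pow_ne_zero _ (hpos hf0)))]
    exact le_top
  set F := (∫⁻ y, f y ^ a) ^ a⁻¹ with hF
  set G := (∫⁻ y, g y ^ a) ^ a⁻¹ with hG
  have hF0 : F ≠ 0 := hpos hf0
  have hG0 : G ≠ 0 := hpos hg0
  have hFt : F ≠ ⊤ := ENNReal.rpow_ne_top_of_nonneg (by positivity) hft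
  have hGt : G ≠ ⊤ := ENNReal.rpow_ne_top_of_nonneg (by positivity) hgt
  have hnorm {h : Ed d → ℝ≥0∞} (hh : Measurable h) (h0 : ∫⁻ y, h y ^ a ≠ 0)
      (ht : ∫⁻ y, h y ^ a ≠ ⊤) : ∫⁻ y, (((∫⁻ y, h y ^ a) ^ a⁻¹)⁻¹ * h y) ^ a ≤ 1 := by
    simp_rw [ENNReal.mul_rpow_of_nonneg _ _ ha0.le]
    rw [lintegral_const_mul _ (hh.pow_const a), ENNReal.inv_rpow, ENNReal.rpow_inv_rpow ha0.ne',
      ENNReal.inv_mul_cancel h0 ht]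
  have hm (x : Ed d) : Measurable fun y ↦ f y * rieszKernel 4 (x - y) :=
    hf.mul ((measurable_rieszKernel 4).comp (by fun_prop))
  have h := key (fun y ↦ F⁻¹ * f y) (fun y ↦ G⁻¹ * g y) (hf.const_mul _) (hg.const_mul _)
    (hnorm hf hf0 hft) (hnorm hg hg0 hgt)
  have hscale : ∫⁻ x, (∫⁻ y, F⁻¹ * f y * rieszKernel 4 (x - y)) ^ 2 * (G⁻¹ * g x) =
      (F ^ 2 * G)⁻¹ * ∫⁻ x, (∫⁻ y, f y * rieszKernel 4 (x - y)) ^ 2 * g x := by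
    rw [← lintegral_const_mul' _ _ (by simp [hF0, hG0])]
    refine lintegral_congr fun x ↦ ?_
    simp_rw [mul_assoc F⁻¹]
    rw [lintegral_const_mul _ (hm x), ENNReal.mul_inv (by simp [hF0]) (by simp [hFt]),
      ENNReal.inv_pow]
    ring
  rw [hscale, mul_comm, ← div_eq_mul_inv, ENNReal.div_le_iff (by simp [hF0, hG0])
    (ENNReal.mul_ne_top (by simp [hFt]) hGt), ← mul_assoc] at h
  exact h

/-- Spatial Hartree estimate at fixed time. -/
lemma exists_lintegral_hartreePotE_mul_sq_le {d : ℕ} (hd : 5 ≤ d) :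
    ∃ K : ℝ≥0∞, 1 ≤ K ∧ K ≠ ⊤ ∧ ∀ u w : Ed d → ℝ, Measurable u → Measurable w →
      (∫⁻ x, (hartreePotE u x * ENNReal.ofReal |w x|) ^ 2) ^ ((1 : ℝ) / 2) ≤
        K * (((∫⁻ x, ENNReal.ofReal (|u x| ^ (6 * (d : ℝ) / (3 * d - 8))))
            ^ ((3 * (d : ℝ) - 8) / (2 * d))) ^ ((2 : ℝ) / 3) *
          ((∫⁻ x, ENNReal.ofReal (|w x| ^ (6 * (d : ℝ) / (3 * d - 8))))
            ^ ((3 * (d : ℝ) - 8) / (2 * d))) ^ ((1 : ℝ) / 3)) := by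
  obtain ⟨K, hK1, hK, key⟩ := exists_lintegral_rieszPotential_sq_mul_le hd
  have hd5 : (5 : ℝ) ≤ d := by exact_mod_cast hd
  have hd8 : 0 < 3 * (d : ℝ) - 8 := by linarith
  refine ⟨K ^ ((1 : ℝ) / 2), ENNReal.one_le_rpow hK1 (by norm_num),
    ENNReal.rpow_ne_top_of_nonneg (by norm_num) hK, fun u w hu hw ↦ ?_⟩
  have hpow (r : ℝ) : ENNReal.ofReal (r ^ 2) ^ (3 * (d : ℝ) / (3 * d - 8)) =
      ENNReal.ofReal (|r| ^ (6 * (d : ℝ) / (3 * d - 8))) := by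
    rw [← sq_abs, ENNReal.ofReal_rpow_of_nonneg (by positivity) (by positivity),
      ← Real.rpow_natCast, ← Real.rpow_mul (abs_nonneg r)]
    congr 2
    push_cast
    ring
  have h := key (fun y ↦ ENNReal.ofReal (u y ^ 2)) (fun y ↦ ENNReal.ofReal (w y ^ 2))
    (by fun_prop) (by fun_prop)
  simp only [hpow] at h
  have hpot (x : Ed d) :
      ∫⁻ y, ENNReal.ofReal (u y ^ 2) * rieszKernel 4 (x - y) = hartreePotE u x := by
    refine lintegral_congr fun y ↦ ?_
    rw [rieszKernel, ← ENNReal.ofReal_mul (by positivity), div_eq_mul_inv,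
      Real.rpow_neg (norm_nonneg _)]
    norm_cast
  have hLHS : ∫⁻ x, (hartreePotE u x * ENNReal.ofReal |w x|) ^ 2 =
      ∫⁻ x, (∫⁻ y, ENNReal.ofReal (u y ^ 2) * rieszKernel 4 (x - y)) ^ 2 *
        ENNReal.ofReal (w x ^ 2) := by
    refine lintegral_congr fun x ↦ ?_
    rw [hpot, mul_pow, ← ENNReal.ofReal_pow (abs_nonneg _), sq_abs]
  rw [hLHS]
  refine (ENNReal.rpow_le_rpow h (by norm_num)).trans_eq ?_
  rw [ENNReal.mul_rpow_of_nonneg _ _ (by norm_num), ENNReal.mul_rpow_of_nonneg _ _ (by norm_num),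
    ← ENNReal.rpow_natCast, mul_assoc]
  simp only [← ENNReal.rpow_mul]
  congr 3 <;>
  · push_cast
    field_simp

/-- Trilinear Hartree estimate:
`‖(|·|⁻⁴ ∗ |u|²) w‖_{L¹_t L²_x(J×ℝ^d)} ≤ C(d) ‖u‖²_{L³_t L^{6d/(3d-8)}_x} ‖w‖_{L³_t L^{6d/(3d-8)}_x}`,
all quantities interpreted in `[0,∞]`. -/
theorem stmt13 (d : ℕ) (hd : 5 ≤ d) (J : Set ℝ) (hJ : J.OrdConnected) :
    ∃ C : ℝ, 0 < C ∧
      ∀ u w : ℝ → Ed d → ℝ,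
        Measurable (Function.uncurry u) → Measurable (Function.uncurry w) →
        (∫⁻ t in J,
            (∫⁻ x : Ed d,
                (hartreePotE (u t) x * ENNReal.ofReal |w t x|) ^ 2) ^ ((1 : ℝ) / 2))
          ≤ ENNReal.ofReal C
            * ((∫⁻ t in J,
                (∫⁻ x : Ed d,
                    ENNReal.ofReal (|u t x| ^ ((6 * (d : ℝ)) / (3 * (d : ℝ) - 8))))
                  ^ ((3 * (d : ℝ) - 8) / (2 * (d : ℝ)))) ^ ((2 : ℝ) / 3))
            * ((∫⁻ t in J,
                (∫⁻ x : Ed d,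
                    ENNReal.ofReal (|w t x| ^ ((6 * (d : ℝ)) / (3 * (d : ℝ) - 8))))
                  ^ ((3 * (d : ℝ) - 8) / (2 * (d : ℝ)))) ^ ((1 : ℝ) / 3)) := by
  obtain ⟨K, hK1, hK, key⟩ := exists_lintegral_hartreePotE_mul_sq_le hd
  refine ⟨K.toReal, ENNReal.toReal_pos (zero_lt_one.trans_le hK1).ne' hK, fun u w hu hw ↦ ?_⟩
  rw [ENNReal.ofReal_toReal hK, mul_assoc]
  have hmeas {v : ℝ → Ed d → ℝ} (hv : Measurable (Function.uncurry v)) :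
      Measurable fun t ↦ (∫⁻ x : Ed d,
        ENNReal.ofReal (|v t x| ^ ((6 * (d : ℝ)) / (3 * (d : ℝ) - 8))))
          ^ ((3 * (d : ℝ) - 8) / (2 * (d : ℝ))) := by
    have : Measurable fun p : ℝ × Ed d ↦
        ENNReal.ofReal (|Function.uncurry v p| ^ ((6 * (d : ℝ)) / (3 * (d : ℝ) - 8))) := by
      fun_prop
    exact this.lintegral_prod_right'.pow_const _
  refine (lintegral_mono fun t ↦ key (u t) (w t) (hu.comp measurable_prodMk_left)
    (hw.comp measurable_prodMk_left)).trans ?_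
  rw [lintegral_const_mul' _ _ hK]
  gcongr
  exact ENNReal.lintegral_mul_norm_pow_le (hmeas hu).aemeasurable (hmeas hw).aemeasurable
    (by norm_num) (by norm_num) (by norm_num)
end
end

section
/- Let d ≥ 5 and let I ⊆ ℝ be an interval. Then there exists a constant C depending only on d such that for all measurable functions u, v : I × ℝ^d → ℝ, ( ∫_I ∫_{ℝ^d} | (|·|⁻⁴ ∗ (u(t)v(t)))(x) |^{(d+1)/2} dx dt )^{2/(d+1)} ≤ C · ‖u‖_{L^{d+1}_t L^{q}_x(I×ℝ^d)} · ‖v‖_{L^{d+1}_t L^{q}_x(I×ℝ^d)}, where q = 2d(d+1)/(d² − d − 4) and all quantities are interpreted in [0,∞]. -/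
open MeasureTheory
open scoped ENNReal

noncomputable section

open scoped NNReal

/-- A geometric series over the dyadic scales below `T` is comparable to its last term. -/
theorem exists_tsum_zpow_rpow_le {a : ℝ} (ha : 0 < a) :
    ∃ C : ℝ≥0, ∀ T : ℝ≥0∞,
      ∑' k : ℤ, (if (2 : ℝ≥0∞) ^ k ≤ T then ((2 : ℝ≥0∞) ^ k) ^ a else 0) ≤ C * T ^ a := by
  have h2 : ((2 : ℝ≥0∞)⁻¹) ^ a < 1 := ENNReal.rpow_lt_one (by simp) ha
  have hne : (1 - ((2 : ℝ≥0∞)⁻¹) ^ a)⁻¹ ≠ ∞ := by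
    simpa [tsub_eq_zero_iff_le] using h2
  refine ⟨((1 - ((2 : ℝ≥0∞)⁻¹) ^ a)⁻¹).toNNReal + 1, fun T => ?_⟩
  rw [ENNReal.coe_add, ENNReal.coe_toNNReal hne, ENNReal.coe_one]
  rcases eq_or_ne T 0 with rfl | hT0
  · have : ∀ k : ℤ, ¬ (2 : ℝ≥0∞) ^ k ≤ 0 := fun k =>
      (ENNReal.zpow_pos two_ne_zero ENNReal.ofNat_ne_top k).not_ge
    simp [this]
  rcases eq_or_ne T ∞ with rfl | hT
  · rw [ENNReal.top_rpow_of_pos ha, ENNReal.mul_top (by simp)]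
    exact le_top
  obtain ⟨n, hn, hn'⟩ := ENNReal.exists_mem_Ico_zpow hT0 hT ENNReal.one_lt_two ENNReal.ofNat_ne_top
  have hinj : Function.Injective (fun j : ℕ => n - (j : ℤ)) := fun i j h => by simpa using h
  rw [← hinj.tsum_eq]
  · calc _ ≤ ∑' j : ℕ, ((2 : ℝ≥0∞) ^ n) ^ a * (((2 : ℝ≥0∞)⁻¹) ^ a) ^ j := by
          refine ENNReal.tsum_le_tsum fun j => ?_
          refine (ite_le_sup _ _ _).trans (sup_le ?_ zero_le)
          rw [ENNReal.zpow_sub two_ne_zero ENNReal.ofNat_ne_top,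
            ENNReal.mul_rpow_of_nonneg _ _ ha.le, ← ENNReal.rpow_natCast, ← ENNReal.rpow_mul,
            mul_comm a, ENNReal.rpow_mul, ENNReal.rpow_natCast, zpow_natCast, ENNReal.inv_pow]
      _ = (1 - ((2 : ℝ≥0∞)⁻¹) ^ a)⁻¹ * ((2 : ℝ≥0∞) ^ n) ^ a := by
          rw [ENNReal.tsum_mul_left, ENNReal.tsum_geometric, mul_comm]
      _ ≤ _ := by
          gcongr
          exact le_self_add
  · intro k hk
    have hk' : (2 : ℝ≥0∞) ^ k ≤ T := by
      by_contra h
      simp [h] at hk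
    have : k < n + 1 := by
      by_contra! h
      exact (hn'.trans_le ((ENNReal.monotone_zpow one_le_two) h)).not_ge hk'
    exact ⟨(n - k).toNat, by simp only []; omega⟩

/-- A geometric series over the dyadic scales above `T` is comparable to its first term. -/
theorem exists_tsum_zpow_rpow_neg_le {a : ℝ} (ha : 0 < a) :
    ∃ C : ℝ≥0, ∀ T : ℝ≥0∞,
      ∑' k : ℤ, (if T ≤ (2 : ℝ≥0∞) ^ k then ((2 : ℝ≥0∞) ^ k) ^ (-a) else 0) ≤ C * T ^ (-a) := by
  obtain ⟨C, hC⟩ := exists_tsum_zpow_rpow_le ha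
  refine ⟨C, fun T => ?_⟩
  have h := hC T⁻¹
  rw [ENNReal.inv_rpow, ← ENNReal.rpow_neg] at h
  refine le_of_eq_of_le ?_ h
  rw [← (Equiv.neg ℤ).tsum_eq]
  refine tsum_congr fun k => ?_
  simp only [Equiv.neg_apply, ENNReal.zpow_neg, ENNReal.le_inv_iff_le_inv,
    ENNReal.rpow_neg, ENNReal.inv_rpow, inv_inv]

section Maximal

set_option linter.unusedSectionVars false

variable {E : Type*} [NormedAddCommGroup E] [NormedSpace ℝ E] [FiniteDimensional ℝ E]
  [MeasurableSpace E] [BorelSpace E] (μ : Measure E) [μ.IsAddHaarMeasure]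

/-- The centred Hardy–Littlewood maximal function over balls of dyadic radius. -/
def dyadicMaximal (f : E → ℝ≥0∞) (x : E) : ℝ≥0∞ :=
  ⨆ k : ℤ, (μ (Metric.closedBall x ((2 : ℝ) ^ k)))⁻¹
    * ∫⁻ y in Metric.closedBall x ((2 : ℝ) ^ k), f y ∂μ

theorem measure_closedBall_zpow (x : E) (k : ℤ) :
    μ (Metric.closedBall x ((2 : ℝ) ^ k)) =
      ((2 : ℝ≥0∞) ^ k) ^ (Module.finrank ℝ E : ℝ) * μ (Metric.closedBall 0 1) := by
  rw [Measure.addHaar_closedBall' μ x (by positivity), ENNReal.ofReal_pow (by positivity),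
    ENNReal.rpow_natCast, ← Real.rpow_intCast, ← ENNReal.ofReal_rpow_of_pos two_pos,
    ENNReal.rpow_intCast, ENNReal.ofReal_ofNat]

theorem lintegral_closedBall_le_dyadicMaximal (f : E → ℝ≥0∞) (x : E) (k : ℤ) :
    ∫⁻ y in Metric.closedBall x ((2 : ℝ) ^ k), f y ∂μ ≤
      μ (Metric.closedBall x ((2 : ℝ) ^ k)) * dyadicMaximal μ f x := by
  refine le_trans (le_of_eq ?_) (mul_le_mul_right (le_iSup _ k) _)
  rw [ENNReal.mul_inv_cancel_left ((Metric.measure_closedBall_pos μ x (by positivity)).ne')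
    (measure_closedBall_lt_top.ne)]

variable {μ} in
theorem measurable_lintegral_closedBall {f : E → ℝ≥0∞} (hf : Measurable f) (r : ℝ) :
    Measurable fun x => ∫⁻ y in Metric.closedBall x r, f y ∂μ := by
  have hs : MeasurableSet {z : E × E | z.2 ∈ Metric.closedBall z.1 r} :=
    (isClosed_le (continuous_snd.dist continuous_fst) continuous_const).measurableSet
  have h : Measurable fun x => ∫⁻ y, {z : E × E | z.2 ∈ Metric.closedBall z.1 r}.indicator
      (fun z => f z.2) (x, y) ∂μ :=
    ((hf.comp measurable_snd).indicator hs).lintegral_prod_right'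
  convert h using 2 with x
  rw [← lintegral_indicator measurableSet_closedBall]
  rfl

variable {μ} in
theorem measurable_dyadicMaximal {f : E → ℝ≥0∞} (hf : Measurable f) :
    Measurable (dyadicMaximal μ f) := by
  refine Measurable.iSup fun k => ?_
  simp only [measure_closedBall_zpow]
  exact (measurable_lintegral_closedBall hf _).const_mul _

/-- Weak type (1,1) bound for the maximal function. -/
theorem mul_measure_lt_dyadicMaximal_le (f : E → ℝ≥0∞) (s : ℝ≥0∞) :
    s * μ {x | s < dyadicMaximal μ f x} ≤ 5 ^ Module.finrank ℝ E * ∫⁻ x, f x ∂μ := by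
  set A : ℕ → Set E := fun N => {x | ∃ k : ℤ, k ≤ N ∧
    s * μ (Metric.closedBall x ((2 : ℝ) ^ k)) <
      ∫⁻ y in Metric.closedBall x ((2 : ℝ) ^ k), f y ∂μ} with hA
  have hmono : Monotone A := by
    rintro M N hMN x ⟨k, hk, hx⟩
    exact ⟨k, hk.trans (by exact_mod_cast hMN), hx⟩
  have hsub : {x | s < dyadicMaximal μ f x} ⊆ ⋃ N, A N := by
    intro x hx
    obtain ⟨k, hk⟩ := lt_iSup_iff.1 (show s < ⨆ k : ℤ, _ from hx)
    refine Set.mem_iUnion.2 ⟨k.toNat, k, by simp, ?_⟩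
    rw [mul_comm, ← div_eq_mul_inv] at hk
    exact (ENNReal.lt_div_iff_mul_lt (.inl ((Metric.measure_closedBall_pos μ x (by positivity)).ne'))
      (.inl (measure_closedBall_lt_top.ne))).1 hk
  refine (mul_le_mul_right (measure_mono hsub) s).trans ?_
  rw [hmono.measure_iUnion, ENNReal.mul_iSup]
  refine iSup_le fun N => ?_
  choose! k hkN hk using fun x (hx : x ∈ A N) => hx
  obtain ⟨u, huA, hdisj, hcover⟩ :=
    Vitali.exists_disjoint_subfamily_covering_enlargement_closedBall (A N) id
      (fun x => (2 : ℝ) ^ k x) ((2 : ℝ) ^ (N : ℤ))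
      (fun x hx => zpow_le_zpow_right₀ one_le_two (hkN x hx)) 5 (by norm_num)
  replace hdisj : u.PairwiseDisjoint fun x => Metric.closedBall x ((2 : ℝ) ^ k x) := hdisj
  have hu : u.Countable := hdisj.countable_of_nonempty_interior fun x _ =>
    ⟨x, Metric.ball_subset_interior_closedBall (Metric.mem_ball_self (by positivity))⟩
  have hAu : A N ⊆ ⋃ x ∈ u, Metric.closedBall x (5 * (2 : ℝ) ^ k x) := by
    intro x hx
    obtain ⟨b, hb, hxb⟩ := hcover x hx
    exact Set.mem_biUnion hb (hxb (Metric.mem_closedBall_self (by positivity)))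
  calc s * μ (A N) ≤ s * ∑' x : u, μ (Metric.closedBall (x : E) (5 * (2 : ℝ) ^ k x)) := by
        gcongr
        exact (measure_mono hAu).trans (measure_biUnion_le μ hu _)
    _ = 5 ^ Module.finrank ℝ E *
          ∑' x : u, s * μ (Metric.closedBall (x : E) ((2 : ℝ) ^ k x)) := by
        rw [ENNReal.tsum_mul_left, mul_left_comm, ← ENNReal.tsum_mul_left (a := 5 ^ _)]
        congr 2 with x
        rw [Measure.addHaar_closedBall_mul μ _ (by norm_num) (by positivity),
          Measure.addHaar_closedBall_center μ (x : E),
          ENNReal.ofReal_pow (by norm_num), ENNReal.ofReal_ofNat]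
    _ ≤ 5 ^ Module.finrank ℝ E *
          ∑' x : u, ∫⁻ y in Metric.closedBall (x : E) ((2 : ℝ) ^ k x), f y ∂μ := by
        gcongr with x
        exact (hk x (huA x.2)).le
    _ ≤ 5 ^ Module.finrank ℝ E * ∫⁻ x, f x ∂μ := by
        gcongr
        rw [← lintegral_biUnion hu (fun _ _ => measurableSet_closedBall) hdisj]
        exact setLIntegral_le_lintegral _ _

/-- The weak type bound for the maximal function, localised to the set where `f` is large. -/
theorem mul_measure_lt_dyadicMaximal_le_indicator {f : E → ℝ≥0∞} (s : ℝ≥0∞) :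
    s * μ {x | s < dyadicMaximal μ f x} ≤
      2 * 5 ^ Module.finrank ℝ E * ∫⁻ x, (if s ≤ 2 * f x then f x else 0) ∂μ := by
  set g : E → ℝ≥0∞ := fun x => if s ≤ 2 * f x then f x else 0 with hg
  have hfg : ∀ x, f x ≤ g x + s / 2 := by
    intro x
    by_cases h : s ≤ 2 * f x
    · simp [hg, h]
    · simp only [hg, h, if_false, zero_add]
      rw [ENNReal.le_div_iff_mul_le (by simp) (by simp), mul_comm]
      exact (not_le.1 h).le
  have hM : ∀ x, dyadicMaximal μ f x ≤ dyadicMaximal μ g x + s / 2 := by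
    intro x
    refine iSup_le fun k => ?_
    calc (μ (Metric.closedBall x ((2 : ℝ) ^ k)))⁻¹
          * ∫⁻ y in Metric.closedBall x ((2 : ℝ) ^ k), f y ∂μ
        ≤ (μ (Metric.closedBall x ((2 : ℝ) ^ k)))⁻¹
          * ∫⁻ y in Metric.closedBall x ((2 : ℝ) ^ k), (g y + s / 2) ∂μ := by
          gcongr with y
          exact hfg y
      _ = (μ (Metric.closedBall x ((2 : ℝ) ^ k)))⁻¹
          * ∫⁻ y in Metric.closedBall x ((2 : ℝ) ^ k), g y ∂μ + s / 2 := by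
          rw [lintegral_add_right _ measurable_const, setLIntegral_const, mul_add,
            mul_comm (s / 2), ENNReal.inv_mul_cancel_left
              (Metric.measure_closedBall_pos μ x (by positivity)).ne' measure_closedBall_lt_top.ne]
      _ ≤ _ := by
          gcongr
          exact le_iSup (fun k : ℤ => (μ (Metric.closedBall x ((2 : ℝ) ^ k)))⁻¹
            * ∫⁻ y in Metric.closedBall x ((2 : ℝ) ^ k), g y ∂μ) k
  have hsub : {x | s < dyadicMaximal μ f x} ⊆ {x | s / 2 < dyadicMaximal μ g x} := by
    intro x hx
    by_contra h
    refine (lt_of_lt_of_le (show s < dyadicMaximal μ f x from hx) (hM x)).not_ge ?_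
    calc dyadicMaximal μ g x + s / 2 ≤ s / 2 + s / 2 := by gcongr; exact not_lt.1 h
      _ = s := ENNReal.add_halves s
  calc s * μ {x | s < dyadicMaximal μ f x}
      ≤ 2 * (s / 2) * μ {x | s / 2 < dyadicMaximal μ g x} := by
        rw [ENNReal.mul_div_cancel two_ne_zero ENNReal.ofNat_ne_top]
        gcongr
    _ ≤ _ := by
        rw [mul_assoc, mul_assoc]
        exact mul_le_mul_right (mul_measure_lt_dyadicMaximal_le μ g (s / 2)) _

theorem rpow_le_tsum_zpow {p : ℝ} (hp : 0 < p) (t : ℝ≥0∞) :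
    t ^ p ≤ ∑' k : ℤ, (if (2 : ℝ≥0∞) ^ k < t then 2 ^ p * ((2 : ℝ≥0∞) ^ k) ^ p else 0) := by
  rcases eq_or_ne t 0 with rfl | h0
  · simp [hp]
  rcases eq_or_ne t ∞ with rfl | ht
  · refine le_trans ?_ (ENNReal.tsum_comp_le_tsum_of_injective (Nat.cast_injective (R := ℤ)) _)
    refine le_top.trans ((ENNReal.tsum_const_eq_top_of_ne_zero (α := ℕ) one_ne_zero).ge.trans ?_)
    refine ENNReal.tsum_le_tsum fun n => ?_
    rw [if_pos (ENNReal.zpow_lt_top two_ne_zero ENNReal.ofNat_ne_top _), zpow_natCast]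
    exact one_le_mul (ENNReal.one_le_rpow one_le_two hp)
      (ENNReal.one_le_rpow (one_le_pow₀ one_le_two) hp)
  obtain ⟨n, hn, hn'⟩ := ENNReal.exists_mem_Ioc_zpow h0 ht ENNReal.one_lt_two ENNReal.ofNat_ne_top
  refine le_trans ?_ (ENNReal.le_tsum n)
  rw [if_pos hn, ← ENNReal.mul_rpow_of_nonneg _ _ hp.le]
  gcongr
  rwa [ENNReal.zpow_add two_ne_zero ENNReal.ofNat_ne_top, zpow_one, mul_comm] at hn'

/-- The Hardy–Littlewood maximal theorem on `L^p`, `1 < p < ∞`. -/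
theorem exists_lintegral_dyadicMaximal_rpow_le {p : ℝ} (hp : 1 < p) :
    ∃ C : ℝ≥0, ∀ f : E → ℝ≥0∞, Measurable f →
      ∫⁻ x, dyadicMaximal μ f x ^ p ∂μ ≤ C * ∫⁻ x, f x ^ p ∂μ := by
  have hp1 : 0 < p - 1 := sub_pos.2 hp
  have hp0 : 0 < p := by linarith
  obtain ⟨C, hC⟩ := exists_tsum_zpow_rpow_le hp1
  refine ⟨2 ^ p * (2 * 5 ^ Module.finrank ℝ E) * (C * 2 ^ (p - 1)), fun f hf => ?_⟩
  have hM := measurable_dyadicMaximal (μ := μ) hf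
  have hset : ∀ k : ℤ, MeasurableSet {x | (2 : ℝ≥0∞) ^ k < dyadicMaximal μ f x} :=
    fun k => measurableSet_lt measurable_const hM
  have hset' : ∀ k : ℤ, MeasurableSet {x | (2 : ℝ≥0∞) ^ k ≤ 2 * f x} :=
    fun k => measurableSet_le measurable_const (hf.const_mul _)
  have hw0 : ∀ k : ℤ, (2 : ℝ≥0∞) ^ k ≠ 0 := fun k =>
    (ENNReal.zpow_pos two_ne_zero ENNReal.ofNat_ne_top k).ne'
  have hw : ∀ k : ℤ, (2 : ℝ≥0∞) ^ k ≠ ∞ := ENNReal.zpow_ne_top two_ne_zero ENNReal.ofNat_ne_top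
  calc ∫⁻ x, dyadicMaximal μ f x ^ p ∂μ
      ≤ ∫⁻ x, ∑' k : ℤ, (if (2 : ℝ≥0∞) ^ k < dyadicMaximal μ f x
          then 2 ^ p * ((2 : ℝ≥0∞) ^ k) ^ p else 0) ∂μ :=
        lintegral_mono fun x => rpow_le_tsum_zpow hp0 _
    _ = ∑' k : ℤ, 2 ^ p * ((2 : ℝ≥0∞) ^ k) ^ p * μ {x | (2 : ℝ≥0∞) ^ k < dyadicMaximal μ f x} := by
        rw [lintegral_tsum fun k =>
          (Measurable.ite (hset k) measurable_const measurable_const).aemeasurable]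
        refine tsum_congr fun k => ?_
        rw [← lintegral_indicator_const (hset k)]
        simp only [Set.indicator_apply, Set.mem_ofPred_eq]
    _ = ∑' k : ℤ, 2 ^ p * ((2 : ℝ≥0∞) ^ k) ^ (p - 1) *
          ((2 : ℝ≥0∞) ^ k * μ {x | (2 : ℝ≥0∞) ^ k < dyadicMaximal μ f x}) := by
        refine tsum_congr fun k => ?_
        rw [← mul_assoc, mul_assoc (2 ^ p)]
        conv_lhs => rw [← sub_add_cancel p 1, ENNReal.rpow_add _ _ (hw0 k) (hw k),
          ENNReal.rpow_one, sub_add_cancel]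
        simp only [mul_assoc]
    _ ≤ ∑' k : ℤ, 2 ^ p * ((2 : ℝ≥0∞) ^ k) ^ (p - 1) * (2 * 5 ^ Module.finrank ℝ E *
          ∫⁻ x, (if (2 : ℝ≥0∞) ^ k ≤ 2 * f x then f x else 0) ∂μ) := by
        exact ENNReal.tsum_le_tsum fun k =>
          mul_le_mul_right (mul_measure_lt_dyadicMaximal_le_indicator μ _) _
    _ = 2 ^ p * (2 * 5 ^ Module.finrank ℝ E) * ∫⁻ x, ∑' k : ℤ,
          ((2 : ℝ≥0∞) ^ k) ^ (p - 1) * (if (2 : ℝ≥0∞) ^ k ≤ 2 * f x then f x else 0) ∂μ := by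
        rw [lintegral_tsum fun k =>
          ((Measurable.ite (hset' k) hf measurable_const).const_mul _).aemeasurable,
          ← ENNReal.tsum_mul_left]
        refine tsum_congr fun k => ?_
        rw [lintegral_const_mul _ (Measurable.ite (hset' k) hf measurable_const)]
        ring
    _ ≤ 2 ^ p * (2 * 5 ^ Module.finrank ℝ E) *
          ∫⁻ x, (C * 2 ^ (p - 1)) * f x ^ p ∂μ := by
        gcongr with x
        calc ∑' k : ℤ, ((2 : ℝ≥0∞) ^ k) ^ (p - 1) * (if (2 : ℝ≥0∞) ^ k ≤ 2 * f x then f x else 0)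
            = f x * ∑' k : ℤ,
                (if (2 : ℝ≥0∞) ^ k ≤ 2 * f x then ((2 : ℝ≥0∞) ^ k) ^ (p - 1) else 0) := by
              rw [← ENNReal.tsum_mul_left]
              refine tsum_congr fun k => ?_
              split_ifs <;> ring
          _ ≤ f x * (C * (2 * f x) ^ (p - 1)) := by gcongr; exact hC _
          _ = (C * 2 ^ (p - 1)) * f x ^ p := by
              conv_rhs => rw [← sub_add_cancel p 1, ENNReal.rpow_add_of_nonneg _ _ hp1.le zero_le_one,
                ENNReal.rpow_one, sub_add_cancel]
              rw [ENNReal.mul_rpow_of_nonneg _ _ hp1.le]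
              ring
    _ = _ := by
        rw [lintegral_const_mul _ (hf.pow_const p), ← mul_assoc]
        norm_cast
        rw [← ENNReal.coe_ofNat, ← ENNReal.coe_rpow_of_nonneg _ hp0.le,
          ← ENNReal.coe_rpow_of_nonneg _ hp1.le]
        push_cast
        rfl

theorem ofReal_norm_rpow_neg_le_tsum (lam : ℝ) (hlam : 0 < lam) (x y : E) :
    ENNReal.ofReal (‖x - y‖ ^ (-lam)) ≤ ∑' k : ℤ, 2 ^ lam * ((2 : ℝ≥0∞) ^ k) ^ (-lam) *
      (Metric.closedBall x ((2 : ℝ) ^ k)).indicator 1 y := by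
  rcases eq_or_ne (‖x - y‖) 0 with h0 | h0
  · simp [h0, Real.zero_rpow (neg_ne_zero.2 hlam.ne')]
  have hpos : 0 < ‖x - y‖ := lt_of_le_of_ne (norm_nonneg _) h0.symm
  obtain ⟨n, hn, hn'⟩ := exists_mem_Ioc_zpow hpos (one_lt_two (α := ℝ))
  refine le_trans ?_ (ENNReal.le_tsum (n + 1))
  have hy : y ∈ Metric.closedBall x ((2 : ℝ) ^ (n + 1)) := by
    rwa [Metric.mem_closedBall, dist_comm, dist_eq_norm]
  rw [Set.indicator_of_mem hy, Pi.one_apply, mul_one,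
    ENNReal.zpow_add two_ne_zero ENNReal.ofNat_ne_top, zpow_one, ENNReal.rpow_neg,
    ENNReal.mul_rpow_of_nonneg _ _ hlam.le, ENNReal.mul_inv (by simp) (by simp), mul_left_comm,
    ENNReal.mul_inv_cancel (by simp) (by simp), mul_one,
    ← ENNReal.rpow_neg, ← ENNReal.ofReal_rpow_of_pos hpos, ENNReal.rpow_neg, ENNReal.rpow_neg]
  gcongr
  calc (2 : ℝ≥0∞) ^ n = ENNReal.ofReal ((2 : ℝ) ^ n) := by
        rw [← Real.rpow_intCast, ← ENNReal.ofReal_rpow_of_pos two_pos, ENNReal.rpow_intCast,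
          ENNReal.ofReal_ofNat]
    _ ≤ _ := ENNReal.ofReal_le_ofReal hn.le

variable {μ} in
theorem lintegral_mul_norm_rpow_neg_le_tsum {lam : ℝ} (hlam : 0 < lam) {f : E → ℝ≥0∞}
    (hf : Measurable f) (x : E) :
    ∫⁻ y, f y * ENNReal.ofReal (‖x - y‖ ^ (-lam)) ∂μ ≤
      2 ^ lam * ∑' k : ℤ, ((2 : ℝ≥0∞) ^ k) ^ (-lam) *
        ∫⁻ y in Metric.closedBall x ((2 : ℝ) ^ k), f y ∂μ := by
  have hind : ∀ k : ℤ,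
      Measurable ((Metric.closedBall x ((2 : ℝ) ^ k)).indicator f) :=
    fun k => hf.indicator measurableSet_closedBall
  calc ∫⁻ y, f y * ENNReal.ofReal (‖x - y‖ ^ (-lam)) ∂μ
      ≤ ∫⁻ y, ∑' k : ℤ, 2 ^ lam * ((2 : ℝ≥0∞) ^ k) ^ (-lam) *
          (Metric.closedBall x ((2 : ℝ) ^ k)).indicator f y ∂μ := by
        refine lintegral_mono fun y => ?_
        refine (mul_le_mul_right (ofReal_norm_rpow_neg_le_tsum lam hlam x y) (f y)).trans ?_
        rw [← ENNReal.tsum_mul_left]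
        refine ENNReal.tsum_le_tsum fun k => le_of_eq ?_
        by_cases hy : y ∈ Metric.closedBall x ((2 : ℝ) ^ k)
        · simp [Set.indicator_of_mem hy, mul_comm]
        · simp [Set.indicator_of_notMem hy]
    _ = _ := by
        rw [lintegral_tsum fun k => ((hind k).const_mul _).aemeasurable, ← ENNReal.tsum_mul_left]
        refine tsum_congr fun k => ?_
        rw [lintegral_const_mul _ (hind k), lintegral_indicator measurableSet_closedBall, mul_assoc]

variable {μ} in
theorem setLIntegral_le_measure_rpow_mul {p : ℝ} (hp : 1 < p) {f : E → ℝ≥0∞}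
    (hf : Measurable f) (s : Set E) :
    ∫⁻ y in s, f y ∂μ ≤ μ s ^ (1 - 1 / p) * (∫⁻ y, f y ^ p ∂μ) ^ (1 / p) := by
  have hpq := Real.HolderConjugate.conjExponent hp
  have h := ENNReal.lintegral_mul_le_Lp_mul_Lq (μ.restrict s) hpq hf.aemeasurable
    (g := fun _ => 1) aemeasurable_const
  simp only [Pi.mul_apply, mul_one, ENNReal.one_rpow, lintegral_const, one_mul,
    Measure.restrict_apply_univ] at h
  have hq : 1 / p.conjExponent = 1 - 1 / p := by
    rw [one_div, one_div]
    linarith [hpq.inv_add_inv_eq_one]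
  rw [hq, mul_comm] at h
  refine h.trans ?_
  gcongr
  exact Measure.restrict_le_self

/-- Hedberg's pointwise inequality, bounding a Riesz potential by the maximal function. -/
theorem exists_riesz_le_dyadicMaximal {p r lam : ℝ} (hp : 1 < p) (hr : 0 < r) (hlam : 0 < lam)
    (hlamd : lam < Module.finrank ℝ E)
    (hscale : Module.finrank ℝ E / r = Module.finrank ℝ E / p + lam - Module.finrank ℝ E) :
    ∃ C : ℝ≥0, ∀ f : E → ℝ≥0∞, Measurable f → ∀ x,
      (∫⁻ y, f y ^ p ∂μ) ≠ 0 → (∫⁻ y, f y ^ p ∂μ) ≠ ∞ →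
      ∫⁻ y, f y * ENNReal.ofReal (‖x - y‖ ^ (-lam)) ∂μ ≤
        C * (dyadicMaximal μ f x ^ (p / r) * ((∫⁻ y, f y ^ p ∂μ) ^ (1 / p)) ^ (1 - p / r)) := by
  set D : ℝ := (Module.finrank ℝ E : ℝ) with hD
  have hD0 : 0 < D := hlam.trans hlamd
  have hp0 : 0 < p := by linarith
  have hpr : 0 < p / r := div_pos hp0 hr
  have hb : 0 < D / r := div_pos hD0 hr
  obtain ⟨C₁, hC₁⟩ := exists_tsum_zpow_rpow_le (sub_pos.2 hlamd)
  obtain ⟨C₂, hC₂⟩ := exists_tsum_zpow_rpow_neg_le hb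
  set β : ℝ≥0∞ := μ (Metric.closedBall 0 1) with hβ
  have hβt : β ≠ ∞ := measure_closedBall_lt_top.ne
  have hβ' : β ^ (1 - 1 / p) ≠ ∞ :=
    ENNReal.rpow_ne_top_of_nonneg (sub_nonneg.2 ((div_le_one hp0).2 hp.le)) hβt
  have hKt : 2 ^ lam * (β * C₁ + β ^ (1 - 1 / p) * C₂) + 1 ≠ ∞ := by
    finiteness
  refine ⟨(2 ^ lam * (β * C₁ + β ^ (1 - 1 / p) * C₂) + 1).toNNReal, fun f hf x hF0 hFt => ?_⟩
  rw [ENNReal.coe_toNNReal hKt]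
  set N : ℝ≥0∞ := (∫⁻ y, f y ^ p ∂μ) ^ (1 / p) with hN
  set M : ℝ≥0∞ := dyadicMaximal μ f x with hM
  have hN0 : N ≠ 0 := by
    simp [hN, ENNReal.rpow_eq_zero_iff, hF0, hFt]
  have hNt : N ≠ ∞ := ENNReal.rpow_ne_top_of_nonneg (by positivity) hFt
  refine (lintegral_mul_norm_rpow_neg_le_tsum hlam hf x).trans ?_
  have hA₁ : ∀ k : ℤ, ∫⁻ y in Metric.closedBall x ((2 : ℝ) ^ k), f y ∂μ ≤
      ((2 : ℝ≥0∞) ^ k) ^ D * β * M := fun k => by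
    rw [hβ, ← measure_closedBall_zpow μ x]
    exact lintegral_closedBall_le_dyadicMaximal μ f x k
  have hA₂ : ∀ k : ℤ, ∫⁻ y in Metric.closedBall x ((2 : ℝ) ^ k), f y ∂μ ≤
      ((2 : ℝ≥0∞) ^ k) ^ (D * (1 - 1 / p)) * β ^ (1 - 1 / p) * N := fun k => by
    rw [ENNReal.rpow_mul, ← ENNReal.mul_rpow_of_nonneg _ _
      (sub_nonneg.2 ((div_le_one hp0).2 hp.le)), hβ, ← measure_closedBall_zpow μ x]
    exact setLIntegral_le_measure_rpow_mul hp hf _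
  rcases eq_or_ne M 0 with hM0 | hM0
  · have : ∀ k : ℤ, ∫⁻ y in Metric.closedBall x ((2 : ℝ) ^ k), f y ∂μ = 0 := fun k => by
      simpa [hM0] using hA₁ k
    simp [this]
  rcases eq_or_ne M ∞ with hMt | hMt
  · rw [hMt, ENNReal.top_rpow_of_pos hpr, ENNReal.top_mul, ENNReal.mul_top]
    · exact le_top
    · simp
    · simp [ENNReal.rpow_eq_zero_iff, hN0, hNt]
  set T : ℝ≥0∞ := (N / M) ^ (p / D) with hT
  have hw0 : ∀ k : ℤ, (2 : ℝ≥0∞) ^ k ≠ 0 := fun k =>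
    (ENNReal.zpow_pos two_ne_zero ENNReal.ofNat_ne_top k).ne'
  have hw : ∀ k : ℤ, (2 : ℝ≥0∞) ^ k ≠ ∞ := ENNReal.zpow_ne_top two_ne_zero ENNReal.ofNat_ne_top
  have hT₁ : M * T ^ (D - lam) = M ^ (p / r) * N ^ (1 - p / r) := by
    have he : p / D * (D - lam) = 1 - p / r := by
      field_simp at hscale ⊢
      linear_combination hscale
    rw [hT, ← ENNReal.rpow_mul, he, ENNReal.div_rpow_of_nonneg, div_eq_mul_inv, ← ENNReal.rpow_neg,
      mul_left_comm, mul_comm (M ^ (p / r))]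
    · congr 1
      nth_rewrite 1 [← ENNReal.rpow_one M]
      rw [← ENNReal.rpow_add _ _ hM0 hMt]
      ring_nf
    · rw [← he]
      exact mul_nonneg (by positivity) (sub_nonneg.2 hlamd.le)
  have hT₂ : N * T ^ (-(D / r)) = M ^ (p / r) * N ^ (1 - p / r) := by
    have he : p / D * (D / r) = p / r := by field_simp
    rw [hT, ← ENNReal.rpow_mul, mul_neg, he, ENNReal.rpow_neg, ENNReal.div_rpow_of_nonneg _ _ hpr.le,
      ENNReal.inv_div (.inr (by simp [hN0, hNt]))
        (.inr (by simp [ENNReal.rpow_eq_zero_iff, hN0, hNt])), sub_eq_add_neg,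
      ENNReal.rpow_add _ _ hN0 hNt, ENNReal.rpow_one, ENNReal.rpow_neg, div_eq_mul_inv]
    ring
  have hterm : ∀ k : ℤ, ((2 : ℝ≥0∞) ^ k) ^ (-lam) *
      ∫⁻ y in Metric.closedBall x ((2 : ℝ) ^ k), f y ∂μ ≤
        β * M * (if (2 : ℝ≥0∞) ^ k ≤ T then ((2 : ℝ≥0∞) ^ k) ^ (D - lam) else 0) +
        β ^ (1 - 1 / p) * N *
          (if T ≤ (2 : ℝ≥0∞) ^ k then ((2 : ℝ≥0∞) ^ k) ^ (-(D / r)) else 0) := by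
    intro k
    rcases le_total ((2 : ℝ≥0∞) ^ k) T with h | h
    · rw [if_pos h]
      refine le_trans ?_ le_self_add
      refine (mul_le_mul_right (hA₁ k) _).trans (le_of_eq ?_)
      rw [sub_eq_neg_add, ENNReal.rpow_add _ _ (hw0 k) (hw k)]
      ring
    · rw [if_pos h]
      refine le_trans ?_ le_add_self
      refine (mul_le_mul_right (hA₂ k) _).trans (le_of_eq ?_)
      have he : -(D / r) = -lam + D * (1 - 1 / p) := by
        rw [hscale]; ring
      rw [he, ENNReal.rpow_add _ _ (hw0 k) (hw k)]
      ring
  calc 2 ^ lam * ∑' k : ℤ, ((2 : ℝ≥0∞) ^ k) ^ (-lam) *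
        ∫⁻ y in Metric.closedBall x ((2 : ℝ) ^ k), f y ∂μ
      ≤ 2 ^ lam * (β * M * (C₁ * T ^ (D - lam)) +
          β ^ (1 - 1 / p) * N * (C₂ * T ^ (-(D / r)))) := by
        refine mul_le_mul_right ((ENNReal.tsum_le_tsum hterm).trans ?_) _
        rw [ENNReal.tsum_add, ENNReal.tsum_mul_left, ENNReal.tsum_mul_left]
        exact add_le_add (mul_le_mul_right (hC₁ T) _) (mul_le_mul_right (hC₂ T) _)
    _ = 2 ^ lam * (β * C₁ * (M * T ^ (D - lam)) +
          β ^ (1 - 1 / p) * C₂ * (N * T ^ (-(D / r)))) := by ring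
    _ = 2 ^ lam * (β * C₁ + β ^ (1 - 1 / p) * C₂) * (M ^ (p / r) * N ^ (1 - p / r)) := by
        rw [hT₁, hT₂]; ring
    _ ≤ _ := by
        gcongr
        exact le_self_add

/-- The Hardy–Littlewood–Sobolev inequality for the Riesz potential. -/
theorem exists_lintegral_riesz_rpow_le {p r lam : ℝ} (hp : 1 < p) (hr : 0 < r) (hlam : 0 < lam)
    (hlamd : lam < Module.finrank ℝ E)
    (hscale : Module.finrank ℝ E / r = Module.finrank ℝ E / p + lam - Module.finrank ℝ E) :
    ∃ C : ℝ≥0, ∀ f : E → ℝ≥0∞, Measurable f →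
      ∫⁻ x, (∫⁻ y, f y * ENNReal.ofReal (‖x - y‖ ^ (-lam)) ∂μ) ^ r ∂μ ≤
        C * (∫⁻ y, f y ^ p ∂μ) ^ (r / p) := by
  obtain ⟨C₁, hC₁⟩ := exists_riesz_le_dyadicMaximal μ hp hr hlam hlamd hscale
  obtain ⟨C₂, hC₂⟩ := exists_lintegral_dyadicMaximal_rpow_le μ hp
  have hp0 : 0 < p := by linarith
  refine ⟨C₁ ^ r * C₂ + 1, fun f hf => ?_⟩
  set F : ℝ≥0∞ := ∫⁻ y, f y ^ p ∂μ with hF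
  rcases eq_or_ne F 0 with hF0 | hF0
  · have hf0 : f =ᵐ[μ] 0 := by
      filter_upwards [(lintegral_eq_zero_iff (hf.pow_const p)).1 hF0] with y hy
      simpa [ENNReal.rpow_eq_zero_iff, hp0, hp0.not_gt] using hy
    have : ∀ x, ∫⁻ y, f y * ENNReal.ofReal (‖x - y‖ ^ (-lam)) ∂μ = 0 := fun x => by
      rw [← lintegral_zero (μ := μ)]
      refine lintegral_congr_ae ?_
      filter_upwards [hf0] with y hy
      simp [hy]
    simp [this, hr]
  rcases eq_or_ne F ∞ with hFt | hFt
  · rw [hFt, ENNReal.top_rpow_of_pos (div_pos hr hp0), ENNReal.mul_top (by simp)]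
    exact le_top
  calc ∫⁻ x, (∫⁻ y, f y * ENNReal.ofReal (‖x - y‖ ^ (-lam)) ∂μ) ^ r ∂μ
      ≤ ∫⁻ x, (C₁ * (dyadicMaximal μ f x ^ (p / r) * (F ^ (1 / p)) ^ (1 - p / r))) ^ r ∂μ := by
        gcongr with x
        exact hC₁ f hf x hF0 hFt
    _ = ∫⁻ x, C₁ ^ r * F ^ (r / p - 1) * dyadicMaximal μ f x ^ p ∂μ := by
        refine lintegral_congr fun x => ?_
        rw [ENNReal.mul_rpow_of_nonneg _ _ hr.le, ENNReal.mul_rpow_of_nonneg _ _ hr.le,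
          ← ENNReal.rpow_mul, ← ENNReal.rpow_mul, ← ENNReal.rpow_mul]
        have h1 : p / r * r = p := by field_simp
        have h2 : 1 / p * ((1 - p / r) * r) = r / p - 1 := by field_simp
        rw [h1, h2]
        ring
    _ ≤ C₁ ^ r * F ^ (r / p - 1) * (C₂ * F) := by
        rw [lintegral_const_mul _ ((measurable_dyadicMaximal hf).pow_const p)]
        gcongr
        exact hC₂ f hf
    _ = C₁ ^ r * C₂ * F ^ (r / p) := by
        conv_rhs => rw [← sub_add_cancel (r / p) 1, ENNReal.rpow_add _ _ hF0 hFt, ENNReal.rpow_one]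
        ring
    _ ≤ _ := by
        gcongr
        rw [ENNReal.coe_add, ENNReal.coe_mul, ENNReal.coe_rpow_of_nonneg _ hr.le]
        exact le_self_add

/-- A mixed-norm bilinear form of the Hardy–Littlewood–Sobolev inequality. -/
theorem exists_lintegral_lintegral_riesz_mul_rpow_le {p r lam : ℝ} (hp : 1 < p) (hr : 0 < r)
    (hlam : 0 < lam) (hlamd : lam < Module.finrank ℝ E)
    (hscale : Module.finrank ℝ E / r = Module.finrank ℝ E / p + lam - Module.finrank ℝ E) :
    ∃ C : ℝ≥0, ∀ {Ω : Type*} [MeasurableSpace Ω] (ν : Measure Ω) (a b : Ω → E → ℝ≥0∞),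
      Measurable (Function.uncurry a) → Measurable (Function.uncurry b) →
      (∫⁻ t, ∫⁻ x, (∫⁻ y, a t y * b t y * ENNReal.ofReal (‖x - y‖ ^ (-lam)) ∂μ) ^ r ∂μ ∂ν) ^ (1 / r)
        ≤ C * (∫⁻ t, (∫⁻ x, a t x ^ (2 * p) ∂μ) ^ (r / p) ∂ν) ^ (1 / (2 * r))
          * (∫⁻ t, (∫⁻ x, b t x ^ (2 * p) ∂μ) ^ (r / p) ∂ν) ^ (1 / (2 * r)) := by
  obtain ⟨C, hC⟩ := exists_lintegral_riesz_rpow_le μ hp hr hlam hlamd hscale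
  have hp0 : 0 < p := by linarith
  refine ⟨C ^ (1 / r), fun {Ω} _ ν a b ha hb => ?_⟩
  have hat : ∀ t, Measurable (a t) := fun t => ha.comp measurable_prodMk_left
  have hbt : ∀ t, Measurable (b t) := fun t => hb.comp measurable_prodMk_left
  have key : ∀ {c : Ω → E → ℝ≥0∞}, Measurable (Function.uncurry c) →
      Measurable fun t => ((∫⁻ x, c t x ^ (2 * p) ∂μ) ^ (r / p)) ^ (1 / 2 : ℝ) := fun hc =>
    (((hc.pow_const (2 * p)).lintegral_prod_right').pow_const _).pow_const _
  have hsq : ∀ z : ℝ≥0∞, (z ^ (1 / 2 : ℝ)) ^ (2 : ℝ) = z := fun z => by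
    rw [← ENNReal.rpow_mul]; norm_num
  have hpt : ∀ t, ∫⁻ x, (∫⁻ y, a t y * b t y * ENNReal.ofReal (‖x - y‖ ^ (-lam)) ∂μ) ^ r ∂μ ≤
      C * (((∫⁻ x, a t x ^ (2 * p) ∂μ) ^ (r / p)) ^ (1 / 2 : ℝ) *
        ((∫⁻ x, b t x ^ (2 * p) ∂μ) ^ (r / p)) ^ (1 / 2 : ℝ)) := fun t => by
    refine (hC _ ((hat t).mul (hbt t))).trans ?_
    gcongr
    have h := ENNReal.lintegral_mul_le_Lp_mul_Lq μ Real.HolderConjugate.two_two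
      ((hat t).pow_const p).aemeasurable ((hbt t).pow_const p).aemeasurable
    simp only [Pi.mul_apply, ← ENNReal.rpow_mul, mul_comm p] at h
    simp only [Pi.mul_apply, ENNReal.mul_rpow_of_nonneg _ _ hp0.le]
    refine (ENNReal.rpow_le_rpow h (div_pos hr hp0).le).trans (le_of_eq ?_)
    rw [ENNReal.mul_rpow_of_nonneg _ _ (div_pos hr hp0).le]
    simp only [← ENNReal.rpow_mul, mul_comm (r / p)]
  have ht := ENNReal.lintegral_mul_le_Lp_mul_Lq ν Real.HolderConjugate.two_two
    (key ha).aemeasurable (key hb).aemeasurable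
  simp only [Pi.mul_apply, hsq] at ht
  have hr1 : 0 ≤ 1 / r := by positivity
  calc (∫⁻ t, ∫⁻ x, (∫⁻ y, a t y * b t y * ENNReal.ofReal (‖x - y‖ ^ (-lam)) ∂μ) ^ r ∂μ ∂ν)
        ^ (1 / r)
      ≤ (C * ((∫⁻ t, (∫⁻ x, a t x ^ (2 * p) ∂μ) ^ (r / p) ∂ν) ^ (1 / 2 : ℝ) *
          (∫⁻ t, (∫⁻ x, b t x ^ (2 * p) ∂μ) ^ (r / p) ∂ν) ^ (1 / 2 : ℝ))) ^ (1 / r) := by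
        refine ENNReal.rpow_le_rpow ((lintegral_mono hpt).trans ?_) hr1
        rw [lintegral_const_mul' _ _ ENNReal.coe_ne_top]
        exact mul_le_mul_right ht _
    _ = _ := by
        have he : 1 / 2 * (1 / r) = 1 / (2 * r) := by field_simp
        rw [ENNReal.mul_rpow_of_nonneg _ _ hr1, ENNReal.mul_rpow_of_nonneg _ _ hr1,
          ← ENNReal.rpow_mul, ← ENNReal.rpow_mul, he, ENNReal.coe_rpow_of_nonneg _ hr1, mul_assoc]

end Maximal

/-- Bilinear Hartree (Hardy–Littlewood–Sobolev) estimate: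
`‖ |·|⁻⁴ ∗ (u v) ‖_{L^{(d+1)/2}_{t,x}(I×ℝ^d)} ≤ C(d) ‖u‖_{L^{d+1}_t L^q_x} ‖v‖_{L^{d+1}_t L^q_x}`
with `q = 2d(d+1)/(d²-d-4)`, all quantities interpreted in `[0,∞]`. -/
theorem stmt14 (d : ℕ) (hd : 5 ≤ d) (I : Set ℝ) (hI : I.OrdConnected) :
    ∃ C : ℝ, 0 < C ∧
      ∀ u v : ℝ → Ed d → ℝ,
        Measurable (Function.uncurry u) → Measurable (Function.uncurry v) →
        (∫⁻ t in I, ∫⁻ x : Ed d,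
            (∫⁻ y : Ed d, ENNReal.ofReal (|u t y * v t y| / ‖x - y‖ ^ 4))
              ^ (((d : ℝ) + 1) / 2)) ^ (2 / ((d : ℝ) + 1))
          ≤ ENNReal.ofReal C
            * ((∫⁻ t in I,
                (∫⁻ x : Ed d,
                    ENNReal.ofReal
                      (|u t x| ^ ((2 * (d : ℝ) * ((d : ℝ) + 1)) / ((d : ℝ) ^ 2 - (d : ℝ) - 4))))
                  ^ (((d : ℝ) ^ 2 - (d : ℝ) - 4) / (2 * (d : ℝ)))) ^ (1 / ((d : ℝ) + 1)))
            * ((∫⁻ t in I,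
                (∫⁻ x : Ed d,
                    ENNReal.ofReal
                      (|v t x| ^ ((2 * (d : ℝ) * ((d : ℝ) + 1)) / ((d : ℝ) ^ 2 - (d : ℝ) - 4))))
                  ^ (((d : ℝ) ^ 2 - (d : ℝ) - 4) / (2 * (d : ℝ)))) ^ (1 / ((d : ℝ) + 1))) := by
  have hd' : (5 : ℝ) ≤ d := by exact_mod_cast hd
  have hn : 0 < (d : ℝ) ^ 2 - d - 4 := by nlinarith
  have hfin : (Module.finrank ℝ (Ed d) : ℝ) = d := by simp
  set p : ℝ := (d : ℝ) * (d + 1) / ((d : ℝ) ^ 2 - d - 4) with hp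
  have hp1 : 1 < p := by
    rw [hp, one_lt_div hn]
    nlinarith
  obtain ⟨C, hC⟩ := exists_lintegral_lintegral_riesz_mul_rpow_le (volume : Measure (Ed d))
    (p := p) (r := ((d : ℝ) + 1) / 2) (lam := 4) hp1 (by positivity) (by norm_num)
    (by rw [hfin]; linarith) (by rw [hfin, hp]; field_simp; ring)
  refine ⟨C + 1, by positivity, fun u v hu hv => ?_⟩
  have h := hC (volume.restrict I) (fun t x => ENNReal.ofReal |u t x|)
    (fun t x => ENNReal.ofReal |v t x|) hu.abs.ennreal_ofReal hv.abs.ennreal_ofReal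
  have hq : 2 * (d : ℝ) * ((d : ℝ) + 1) / ((d : ℝ) ^ 2 - (d : ℝ) - 4) = 2 * p := by
    rw [hp]; ring
  have hrp : ((d : ℝ) ^ 2 - (d : ℝ) - 4) / (2 * (d : ℝ)) = ((d : ℝ) + 1) / 2 / p := by
    rw [hp]; field_simp
  have hr : 2 / ((d : ℝ) + 1) = 1 / (((d : ℝ) + 1) / 2) := by field_simp
  have hr' : 1 / ((d : ℝ) + 1) = 1 / (2 * (((d : ℝ) + 1) / 2)) := by field_simp
  have hker : ∀ (s t : ℝ) (z : Ed d), ENNReal.ofReal (|s * t| / ‖z‖ ^ 4) =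
      ENNReal.ofReal |s| * ENNReal.ofReal |t| * ENNReal.ofReal (‖z‖ ^ (-4 : ℝ)) := fun s t z => by
    rw [← ENNReal.ofReal_mul (abs_nonneg _), ← ENNReal.ofReal_mul (by positivity), ← abs_mul,
      Real.rpow_neg (norm_nonneg _), div_eq_mul_inv]
    norm_cast
  have hpow : ∀ s : ℝ, ENNReal.ofReal (|s| ^ (2 * p)) = ENNReal.ofReal |s| ^ (2 * p) := fun s =>
    (ENNReal.ofReal_rpow_of_nonneg (abs_nonneg s) (by linarith)).symm
  simp only [hq, hrp, hr, hr', hker, hpow]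
  refine h.trans ?_
  gcongr
  rw [← ENNReal.ofReal_coe_nnreal]
  exact ENNReal.ofReal_le_ofReal (by simp)
end
end
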